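/- The edge-inducibility constant λ_{6,7} equals 15/32. Moreover, the problem of maximising λ_{6,7} is perfectly stable with respect to the family of graphs that are vertex-disjoint unions of two (possibly empty) cliques. -/

import Mathlib

open Finset
open scoped Classical

/-- Number of edges of `G` inside the vertex subset `S`. -/
noncomputable def edgeCount {n : ℕ} (G : SimpleGraph (Fin n)) (S : Finset (Fin n)) : ℕ :=
  (Finset.univ.filter (fun p : Fin n × Fin n =>
    p.1 ∈ S ∧ p.2 ∈ S ∧ p.1 < p.2 ∧ G.Adj p.1 p.2)).card

/-- `Λ_{κ,ℓ}(G)`: number of `κ`-subsets of vertices inducing exactly `ℓ` edges. -/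
noncomputable def numKL (κ ℓ : ℕ) {n : ℕ} (G : SimpleGraph (Fin n)) : ℕ :=
  ((Finset.powersetCard κ Finset.univ).filter (fun S => edgeCount G S = ℓ)).card

/-- `λ_{κ,ℓ}(G) = Λ_{κ,ℓ}(G) / C(n,κ)`. -/
noncomputable def lamKL (κ ℓ : ℕ) {n : ℕ} (G : SimpleGraph (Fin n)) : ℝ :=
  (numKL κ ℓ G : ℝ) / (n.choose κ : ℝ)

/-- `λ_{κ,ℓ}(n)`: the maximum of `λ_{κ,ℓ}(G)` over all graphs on `n` vertices. -/
noncomputable def lamKLmax (κ ℓ n : ℕ) : ℝ :=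
  ⨆ G : SimpleGraph (Fin n), lamKL κ ℓ G

/-- Edit distance between two graphs on `Fin n`: the minimum over bijections of the number
of vertex pairs whose adjacency must be changed in `G` to obtain a graph isomorphic to `H`. -/
noncomputable def editDist {n : ℕ} (G H : SimpleGraph (Fin n)) : ℕ :=
  ⨅ σ : Equiv.Perm (Fin n),
    (Finset.univ.filter (fun p : Fin n × Fin n =>
      p.1 < p.2 ∧ ¬ (G.Adj p.1 p.2 ↔ H.Adj (σ p.1) (σ p.2)))).card

/-- Edit distance of `G` to the family of `n`-vertex graphs satisfying `P`. -/
noncomputable def distToFam {n : ℕ} (G : SimpleGraph (Fin n))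
    (P : SimpleGraph (Fin n) → Prop) : ℕ :=
  ⨅ H : {H : SimpleGraph (Fin n) // P H}, editDist G H.1

/-- A vertex-disjoint union of two (possibly empty) cliques. -/
def isTwoCliques {n : ℕ} (G : SimpleGraph (Fin n)) : Prop :=
  ∃ c : Fin n → Fin 2, ∀ u v, G.Adj u v ↔ (u ≠ v ∧ c u = c v)

/-- Four integers: values of the (at most four) test functions attached to a four-vertex type. -/
structure V4 where
  a : ℤ
  b : ℤ
  c : ℤ
  d : ℤ

/-- Binary selection among sixteen values. -/
def sel16 {α : Type} (m0 m1 m2 m3 : Bool) (x0 x1 x2 x3 x4 x5 x6 x7 x8 x9 x10 x11 x12 x13 x14 x15 : α) : α :=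
  (bif m3 then (bif m2 then (bif m1 then (bif m0 then x15 else x14) else (bif m0 then x13 else x12)) else (bif m1 then (bif m0 then x11 else x10) else (bif m0 then x9 else x8))) else (bif m2 then (bif m1 then (bif m0 then x7 else x6) else (bif m0 then x5 else x4)) else (bif m1 then (bif m0 then x3 else x2) else (bif m0 then x1 else x0))))

def zz : V4 := ⟨.ofNat 0, .ofNat 0, .ofNat 0, .ofNat 0⟩

def wt3 : V4 := ⟨.ofNat 397, .ofNat 238, .ofNat 51, .ofNat 24⟩
def k3_0 : V4 := ⟨.ofNat 7, .negSucc 6, .ofNat 21, .negSucc 29⟩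
def k3_1 : V4 := ⟨.ofNat 11, .ofNat 1, .negSucc 23, .negSucc 21⟩
def k3_2 : V4 := ⟨.ofNat 12, .negSucc 7, .negSucc 12, .negSucc 2⟩
def k3_3 : V4 := ⟨.negSucc 0, .ofNat 8, .negSucc 21, .ofNat 0⟩
def k3_4 : V4 := ⟨.ofNat 12, .negSucc 13, .negSucc 5, .ofNat 6⟩
def k3_5 : V4 := ⟨.negSucc 17, .ofNat 4, .ofNat 30, .negSucc 12⟩
def k3_6 : V4 := ⟨.ofNat 12, .ofNat 3, .ofNat 18, .ofNat 6⟩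
def k3_7 : V4 := ⟨.ofNat 2, .ofNat 30, .ofNat 7, .negSucc 7⟩
def k3_8 : V4 := ⟨.ofNat 19, .negSucc 3, .ofNat 12, .ofNat 17⟩
def k3_9 : V4 := ⟨.negSucc 29, .negSucc 2, .negSucc 18, .negSucc 9⟩
def k3_10 : V4 := ⟨.negSucc 24, .negSucc 15, .ofNat 8, .ofNat 14⟩
def k3_11 : V4 := ⟨.negSucc 5, .ofNat 20, .negSucc 3, .ofNat 20⟩
def wt7 : V4 := ⟨.ofNat 307, .ofNat 196, .ofNat 0, .ofNat 0⟩
def k7_0 : V4 := ⟨.ofNat 6, .ofNat 30, .ofNat 0, .ofNat 0⟩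
def k7_1 : V4 := ⟨.ofNat 13, .negSucc 6, .ofNat 0, .ofNat 0⟩
def k7_2 : V4 := ⟨.ofNat 30, .negSucc 2, .ofNat 0, .ofNat 0⟩
def k7_3 : V4 := ⟨.negSucc 5, .negSucc 7, .ofNat 0, .ofNat 0⟩
def k7_4 : V4 := ⟨.negSucc 15, .ofNat 15, .ofNat 0, .ofNat 0⟩
def k7_5 : V4 := ⟨.negSucc 29, .negSucc 5, .ofNat 0, .ofNat 0⟩
def k7_6 : V4 := ⟨.negSucc 8, .negSucc 10, .ofNat 0, .ofNat 0⟩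
def k7_7 : V4 := ⟨.ofNat 6, .negSucc 20, .ofNat 0, .ofNat 0⟩
def wt11 : V4 := ⟨.ofNat 360, .ofNat 143, .ofNat 40, .ofNat 388⟩
def k11_0 : V4 := ⟨.ofNat 16, .ofNat 12, .ofNat 7, .ofNat 0⟩
def k11_1 : V4 := ⟨.ofNat 30, .negSucc 21, .ofNat 6, .ofNat 0⟩
def k11_2 : V4 := ⟨.ofNat 5, .ofNat 30, .negSucc 3, .ofNat 0⟩
def k11_3 : V4 := ⟨.negSucc 7, .ofNat 2, .ofNat 30, .ofNat 1⟩
def k11_4 : V4 := ⟨.ofNat 8, .negSucc 1, .negSucc 29, .negSucc 0⟩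
def k11_5 : V4 := ⟨.negSucc 17, .negSucc 11, .ofNat 4, .ofNat 0⟩
def k11_6 : V4 := ⟨.negSucc 28, .negSucc 1, .ofNat 0, .ofNat 0⟩
def k11_7 : V4 := ⟨.negSucc 1, .negSucc 29, .negSucc 5, .ofNat 0⟩
def wt13 : V4 := ⟨.ofNat 220, .ofNat 59, .ofNat 60, .ofNat 0⟩
def k13_0 : V4 := ⟨.ofNat 3, .ofNat 18, .ofNat 14, .ofNat 0⟩
def k13_1 : V4 := ⟨.negSucc 2, .negSucc 17, .negSucc 13, .ofNat 0⟩
def k13_2 : V4 := ⟨.negSucc 10, .negSucc 29, .ofNat 21, .ofNat 0⟩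
def k13_3 : V4 := ⟨.negSucc 2, .ofNat 22, .ofNat 30, .ofNat 0⟩
def k13_4 : V4 := ⟨.negSucc 29, .ofNat 29, .negSucc 5, .ofNat 0⟩
def k13_5 : V4 := ⟨.negSucc 2, .negSucc 29, .ofNat 7, .ofNat 0⟩
def k13_6 : V4 := ⟨.ofNat 11, .ofNat 30, .negSucc 20, .ofNat 0⟩
def k13_7 : V4 := ⟨.ofNat 30, .negSucc 28, .ofNat 6, .ofNat 0⟩
def k13_8 : V4 := ⟨.ofNat 3, .negSucc 21, .negSucc 29, .ofNat 0⟩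
def k13_9 : V4 := ⟨.ofNat 3, .ofNat 30, .negSucc 6, .ofNat 0⟩
def k13_10 : V4 := ⟨.ofNat 28, .ofNat 15, .ofNat 5, .ofNat 0⟩
def k13_11 : V4 := ⟨.negSucc 27, .negSucc 14, .negSucc 4, .ofNat 0⟩
def wt15 : V4 := ⟨.ofNat 422, .ofNat 286, .ofNat 215, .ofNat 11⟩
def k15_0 : V4 := ⟨.ofNat 12, .negSucc 29, .negSucc 3, .ofNat 1⟩
def k15_1 : V4 := ⟨.ofNat 11, .ofNat 7, .negSucc 24, .ofNat 1⟩
def k15_2 : V4 := ⟨.ofNat 30, .negSucc 2, .ofNat 8, .negSucc 4⟩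
def k15_3 : V4 := ⟨.ofNat 3, .ofNat 13, .ofNat 10, .ofNat 8⟩
def k15_4 : V4 := ⟨.ofNat 15, .ofNat 8, .ofNat 30, .negSucc 4⟩
def k15_5 : V4 := ⟨.ofNat 6, .ofNat 13, .negSucc 7, .ofNat 22⟩
def k15_6 : V4 := ⟨.negSucc 15, .negSucc 25, .negSucc 0, .ofNat 7⟩
def k15_7 : V4 := ⟨.negSucc 24, .negSucc 2, .ofNat 21, .ofNat 3⟩
def k15_8 : V4 := ⟨.negSucc 21, .ofNat 9, .negSucc 1, .negSucc 17⟩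
def k15_9 : V4 := ⟨.negSucc 7, .ofNat 12, .negSucc 1, .ofNat 7⟩
def k15_10 : V4 := ⟨.negSucc 2, .ofNat 8, .negSucc 12, .negSucc 29⟩
def k15_11 : V4 := ⟨.negSucc 6, .ofNat 6, .negSucc 4, .ofNat 25⟩
def fn3 (m0 m1 m2 m3 : Bool) : V4 :=
  sel16 m0 m1 m2 m3 k3_0 k3_1 k3_2 k3_3 k3_2 k3_3 k3_4 k3_5 k3_6 k3_7 k3_8 k3_9 k3_8 k3_9 k3_10 k3_11
def fn7 (m0 m1 m2 m3 : Bool) : V4 :=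
  sel16 m0 m1 m2 m3 k7_0 k7_1 k7_2 k7_3 k7_2 k7_3 k7_4 k7_5 k7_2 k7_3 k7_4 k7_5 k7_4 k7_5 k7_6 k7_7
def fn11 (m0 m1 m2 m3 : Bool) : V4 :=
  sel16 m0 m1 m2 m3 k11_0 k11_1 k11_1 k11_2 k11_1 k11_2 k11_2 k11_3 k11_4 k11_5 k11_5 k11_6 k11_5 k11_6 k11_6 k11_7
def fn13 (m0 m1 m2 m3 : Bool) : V4 :=
  sel16 m0 m1 m2 m3 zz k13_0 k13_1 zz k13_2 k13_3 k13_4 k13_5 k13_6 k13_7 k13_8 k13_9 zz k13_10 k13_11 zz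
def fn15 (m0 m1 m2 m3 : Bool) : V4 :=
  sel16 m0 m1 m2 m3 k15_0 k15_1 k15_2 k15_3 k15_2 k15_3 k15_4 k15_5 k15_6 k15_7 k15_8 k15_9 k15_8 k15_9 k15_10 k15_11

/-- Weights of the squares, by the labelled graph on four vertices. -/
def wt (h0 h1 h2 h3 h4 h5 : Bool) : V4 :=
  (bif h5 then
   (bif h4 then
    (bif h3 then
     (bif h2 then (bif h1 then (bif h0 then zz else zz) else (bif h0 then zz else wt15)) else (bif h1 then (bif h0 then zz else wt15) else (bif h0 then wt15 else wt11)))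
    else
     (bif h2 then (bif h1 then (bif h0 then zz else wt15) else (bif h0 then wt15 else wt7)) else (bif h1 then (bif h0 then zz else wt13) else (bif h0 then wt13 else wt3))))
   else
    (bif h3 then
     (bif h2 then (bif h1 then (bif h0 then zz else wt15) else (bif h0 then zz else wt13)) else (bif h1 then (bif h0 then wt15 else wt7) else (bif h0 then wt13 else wt3)))
    else
     (bif h2 then (bif h1 then (bif h0 then wt15 else wt11) else (bif h0 then wt13 else wt3)) else (bif h1 then (bif h0 then wt13 else wt3) else (bif h0 then zz else zz)))))
  else
   (bif h4 then
    (bif h3 then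
     (bif h2 then (bif h1 then (bif h0 then zz else zz) else (bif h0 then wt15 else wt13)) else (bif h1 then (bif h0 then wt15 else wt13) else (bif h0 then wt7 else wt3)))
    else
     (bif h2 then (bif h1 then (bif h0 then wt15 else wt13) else (bif h0 then wt11 else wt3)) else (bif h1 then (bif h0 then wt13 else zz) else (bif h0 then wt3 else zz))))
   else
    (bif h3 then
     (bif h2 then (bif h1 then (bif h0 then wt15 else wt13) else (bif h0 then wt13 else zz)) else (bif h1 then (bif h0 then wt11 else wt3) else (bif h0 then wt3 else zz)))
    else
     (bif h2 then (bif h1 then (bif h0 then wt7 else wt3) else (bif h0 then wt3 else zz)) else (bif h1 then (bif h0 then wt3 else zz) else (bif h0 then zz else zz))))))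

/-- Test functions: labelled four-vertex graph and the attachment of a fifth vertex. -/
def phi (h0 h1 h2 h3 h4 h5 m0 m1 m2 m3 : Bool) : V4 :=
  (bif h5 then
   (bif h4 then
    (bif h3 then
     (bif h2 then (bif h1 then (bif h0 then zz else zz) else (bif h0 then zz else fn15 m3 m1 m2 m0)) else (bif h1 then (bif h0 then zz else fn15 m2 m1 m3 m0) else (bif h0 then fn15 m1 m2 m3 m0 else fn11 m1 m2 m3 m0)))
    else
     (bif h2 then (bif h1 then (bif h0 then zz else fn15 m3 m0 m2 m1) else (bif h0 then fn15 m3 m0 m1 m2 else fn7 m3 m0 m1 m2)) else (bif h1 then (bif h0 then zz else fn13 m2 m3 m1 m0) else (bif h0 then fn13 m1 m3 m2 m0 else fn3 m3 m1 m2 m0))))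
   else
    (bif h3 then
     (bif h2 then (bif h1 then (bif h0 then zz else fn15 m2 m0 m3 m1) else (bif h0 then zz else fn13 m2 m3 m0 m1)) else (bif h1 then (bif h0 then fn15 m2 m0 m1 m3 else fn7 m2 m0 m1 m3) else (bif h0 then fn13 m1 m2 m3 m0 else fn3 m2 m1 m3 m0)))
    else
     (bif h2 then (bif h1 then (bif h0 then fn15 m0 m2 m3 m1 else fn11 m0 m2 m3 m1) else (bif h0 then fn13 m0 m3 m2 m1 else fn3 m3 m0 m2 m1)) else (bif h1 then (bif h0 then fn13 m0 m2 m3 m1 else fn3 m2 m0 m3 m1) else (bif h0 then zz else zz)))))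
  else
   (bif h4 then
    (bif h3 then
     (bif h2 then (bif h1 then (bif h0 then zz else zz) else (bif h0 then fn15 m1 m0 m3 m2 else fn13 m1 m3 m0 m2)) else (bif h1 then (bif h0 then fn15 m1 m0 m2 m3 else fn13 m1 m2 m0 m3) else (bif h0 then fn7 m1 m0 m2 m3 else fn3 m1 m2 m3 m0)))
    else
     (bif h2 then (bif h1 then (bif h0 then fn15 m0 m1 m3 m2 else fn13 m0 m3 m1 m2) else (bif h0 then fn11 m0 m1 m3 m2 else fn3 m3 m0 m1 m2)) else (bif h1 then (bif h0 then fn13 m0 m1 m3 m2 else zz) else (bif h0 then fn3 m1 m0 m3 m2 else zz))))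
   else
    (bif h3 then
     (bif h2 then (bif h1 then (bif h0 then fn15 m0 m1 m2 m3 else fn13 m0 m2 m1 m3) else (bif h0 then fn13 m0 m1 m2 m3 else zz)) else (bif h1 then (bif h0 then fn11 m0 m1 m2 m3 else fn3 m2 m0 m1 m3) else (bif h0 then fn3 m1 m0 m2 m3 else zz)))
    else
     (bif h2 then (bif h1 then (bif h0 then fn7 m0 m1 m2 m3 else fn3 m0 m2 m3 m1) else (bif h0 then fn3 m0 m1 m3 m2 else zz)) else (bif h1 then (bif h0 then fn3 m0 m1 m2 m3 else zz) else (bif h0 then zz else zz))))))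

/-- Sum of weighted products of test functions, for one placement of the four roots. -/
def Tb (h0 h1 h2 h3 h4 h5 m0 m1 m2 m3 k0 k1 k2 k3 : Bool) : ℤ :=
  match wt h0 h1 h2 h3 h4 h5, phi h0 h1 h2 h3 h4 h5 m0 m1 m2 m3, phi h0 h1 h2 h3 h4 h5 k0 k1 k2 k3 with
  | ⟨w1, w2, w3, w4⟩, ⟨x1, x2, x3, x4⟩, ⟨y1, y2, y3, y4⟩ =>
    w1 * (x1 * y1) + w2 * (x2 * y2) + w3 * (x3 * y3) + w4 * (x4 * y4)

/-- Selection by the number of edges of a triple. -/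
def sel3 (p q r : Bool) (x0 x1 x2 x3 : ℤ) : ℤ :=
  bif p then (bif q then (bif r then x3 else x2) else (bif r then x2 else x1))
  else (bif q then (bif r then x2 else x1) else (bif r then x1 else x0))

def ps1 (p q r : Bool) : ℤ := sel3 p q r (.negSucc 28) (.negSucc 9) (.ofNat 16) (.ofNat 30)
def ps2 (p q r : Bool) : ℤ := sel3 p q r (.ofNat 28) (.negSucc 9) (.negSucc 5) (.ofNat 30)
def ps3 (p q r : Bool) : ℤ := sel3 p q r (.negSucc 2) (.negSucc 0) (.ofNat 1) (.ofNat 3)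
/-- Indicator of a triple with an even number of edges. -/
def bd (p q r : Bool) : ℤ := sel3 p q r (.ofNat 1) (.ofNat 0) (.ofNat 1) (.ofNat 0)

def Ub (p q r s t u : Bool) : ℤ :=
  .ofNat 26 * (ps1 p q r * ps1 s t u) + .ofNat 12 * (ps2 p q r * ps2 s t u)
    + .ofNat 1200 * (ps3 p q r * ps3 s t u)

def b2n (b : Bool) : ℕ := bif b then 1 else 0

def Ec (e01 e02 e03 e04 e12 e13 e14 e23 e24 e34 e05 e15 e25 e35 e45 : Bool) : ℕ :=
  b2n e01 + b2n e02 + b2n e03 + b2n e04 + b2n e12 + b2n e13 + b2n e14 + b2n e23 + b2n e24 + b2n e34 + b2n e05 + b2n e15 + b2n e25 + b2n e35 + b2n e45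

def Bs (e01 e02 e03 e04 e12 e13 e14 e23 e24 e34 e05 e15 e25 e35 e45 : Bool) : ℤ :=
  bd e01 e02 e12 + bd e01 e03 e13 + bd e01 e04 e14 + bd e01 e05 e15 + bd e02 e03 e23 + bd e02 e04 e24 + bd e02 e05 e25 + bd e03 e04 e34 + bd e03 e05 e35 + bd e04 e05 e45 + bd e12 e13 e23 + bd e12 e14 e24 + bd e12 e15 e25 + bd e13 e14 e34 + bd e13 e15 e35 + bd e14 e15 e45 + bd e23 e24 e34 + bd e23 e25 e35 + bd e24 e25 e45 + bd e34 e35 e45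

def Us (e01 e02 e03 e04 e12 e13 e14 e23 e24 e34 e05 e15 e25 e35 e45 : Bool) : ℤ :=
  Ub e01 e02 e12 e34 e35 e45 + Ub e01 e03 e13 e24 e25 e45 + Ub e01 e04 e14 e23 e25 e35 + Ub e01 e05 e15 e23 e24 e34 + Ub e02 e03 e23 e14 e15 e45 + Ub e02 e04 e24 e13 e15 e35 + Ub e02 e05 e25 e13 e14 e34 + Ub e03 e04 e34 e12 e15 e25 + Ub e03 e05 e35 e12 e14 e24 + Ub e04 e05 e45 e12 e13 e23

def Ts (e01 e02 e03 e04 e12 e13 e14 e23 e24 e34 e05 e15 e25 e35 e45 : Bool) : ℤ :=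
  Tb e01 e02 e03 e12 e13 e23 e04 e14 e24 e34 e05 e15 e25 e35
  + Tb e01 e02 e04 e12 e14 e24 e03 e13 e23 e34 e05 e15 e25 e45
  + Tb e01 e02 e05 e12 e15 e25 e03 e13 e23 e35 e04 e14 e24 e45
  + Tb e01 e03 e04 e13 e14 e34 e02 e12 e23 e24 e05 e15 e35 e45
  + Tb e01 e03 e05 e13 e15 e35 e02 e12 e23 e25 e04 e14 e34 e45
  + Tb e01 e04 e05 e14 e15 e45 e02 e12 e24 e25 e03 e13 e34 e35
  + Tb e02 e03 e04 e23 e24 e34 e01 e12 e13 e14 e05 e25 e35 e45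
  + Tb e02 e03 e05 e23 e25 e35 e01 e12 e13 e15 e04 e24 e34 e45
  + Tb e02 e04 e05 e24 e25 e45 e01 e12 e14 e15 e03 e23 e34 e35
  + Tb e03 e04 e05 e34 e35 e45 e01 e13 e14 e15 e02 e23 e24 e25
  + Tb e12 e13 e14 e23 e24 e34 e01 e02 e03 e04 e15 e25 e35 e45
  + Tb e12 e13 e15 e23 e25 e35 e01 e02 e03 e05 e14 e24 e34 e45
  + Tb e12 e14 e15 e24 e25 e45 e01 e02 e04 e05 e13 e23 e34 e35
  + Tb e13 e14 e15 e34 e35 e45 e01 e03 e04 e05 e12 e23 e24 e25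
  + Tb e23 e24 e25 e34 e35 e45 e02 e03 e04 e05 e12 e13 e14 e15

/-- The slack of the certificate at a labelled graph on six vertices. -/
def Rb (e01 e02 e03 e04 e12 e13 e14 e23 e24 e34 e05 e15 e25 e35 e45 : Bool) : ℤ :=
  (bif Nat.beq (Ec e01 e02 e03 e04 e12 e13 e14 e23 e24 e34 e05 e15 e25 e35 e45) 7 then (.negSucc 509999) else (.ofNat 450000))
    - (Ts e01 e02 e03 e04 e12 e13 e14 e23 e24 e34 e05 e15 e25 e35 e45 + (Us e01 e02 e03 e04 e12 e13 e14 e23 e24 e34 e05 e15 e25 e35 e45 + Bs e01 e02 e03 e04 e12 e13 e14 e23 e24 e34 e05 e15 e25 e35 e45))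

def code (e01 e02 e03 e04 e12 e13 e14 e23 e24 e34 : Bool) : ℕ :=
  b2n e01 * 1 + b2n e02 * 2 + b2n e03 * 4 + b2n e04 * 8 + b2n e12 * 16 + b2n e13 * 32 + b2n e14 * 64 + b2n e23 * 128 + b2n e24 * 256 + b2n e34 * 512

def lowers (e01 e02 e03 e04 e12 e13 e14 e23 e24 e34 : Bool) : Bool :=
  Nat.blt (code e01 e12 e13 e14 e02 e03 e04 e23 e24 e34) (code e01 e02 e03 e04 e12 e13 e14 e23 e24 e34) || Nat.blt (code e02 e01 e03 e04 e12 e23 e24 e13 e14 e34) (code e01 e02 e03 e04 e12 e13 e14 e23 e24 e34) || Nat.blt (code e01 e03 e02 e04 e13 e12 e14 e23 e34 e24) (code e01 e02 e03 e04 e12 e13 e14 e23 e24 e34) || Nat.blt (code e01 e02 e04 e03 e12 e14 e13 e24 e23 e34) (code e01 e02 e03 e04 e12 e13 e14 e23 e24 e34)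

def allB (f : Bool → Bool) : Bool := f true && f false

theorem allB_spec {f : Bool → Bool} (h : allB f = true) (b : Bool) : f b = true := by
  unfold allB at h
  rw [Bool.and_eq_true] at h
  cases b
  · exact h.2
  · exact h.1

def nonneg (x : ℤ) : Bool :=
  match x with
  | .ofNat _ => true
  | .negSucc _ => false

theorem nonneg_spec {x : ℤ} (h : nonneg x = true) : 0 ≤ x := by
  cases x with
  | ofNat a => exact Int.natCast_nonneg a
  | negSucc a => simp [nonneg] at h

def bigCheck : Bool :=
  allB fun e01 => allB fun e02 => allB fun e03 => allB fun e04 => allB fun e12 => allB fun e13 => allB fun e14 => allB fun e23 => allB fun e24 => allB fun e34 =>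
  lowers e01 e02 e03 e04 e12 e13 e14 e23 e24 e34 ||
  (allB fun e05 => allB fun e15 => allB fun e25 => allB fun e35 => allB fun e45 =>
    nonneg (Rb e01 e02 e03 e04 e12 e13 e14 e23 e24 e34 e05 e15 e25 e35 e45))

theorem bigCheck_true : bigCheck = true := by decide +kernel

def swCheck0 : Bool :=
  allB fun h0 => allB fun h1 => allB fun h2 => allB fun h3 => allB fun h4 => allB fun h5 => allB fun m0 => allB fun m1 => allB fun m2 => allB fun m3 => allB fun k0 => allB fun k1 => allB fun k2 => allB fun k3 =>
  nonneg (Tb h0 h1 h2 h3 h4 h5 m0 m1 m2 m3 k0 k1 k2 k3 - Tb h0 h3 h4 h1 h2 h5 m1 m0 m2 m3 k1 k0 k2 k3)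

theorem swCheck0_true : swCheck0 = true := by decide +kernel

theorem Tb_swap0_le (h0 h1 h2 h3 h4 h5 m0 m1 m2 m3 k0 k1 k2 k3 : Bool) : Tb h0 h3 h4 h1 h2 h5 m1 m0 m2 m3 k1 k0 k2 k3 ≤ Tb h0 h1 h2 h3 h4 h5 m0 m1 m2 m3 k0 k1 k2 k3 := by
  have h := swCheck0_true
  unfold swCheck0 at h
  replace h := allB_spec h h0
  replace h := allB_spec h h1
  replace h := allB_spec h h2
  replace h := allB_spec h h3
  replace h := allB_spec h h4
  replace h := allB_spec h h5
  replace h := allB_spec h m0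
  replace h := allB_spec h m1
  replace h := allB_spec h m2
  replace h := allB_spec h m3
  replace h := allB_spec h k0
  replace h := allB_spec h k1
  replace h := allB_spec h k2
  replace h := allB_spec h k3
  have := nonneg_spec h
  linarith

theorem Tb_swap0 (h0 h1 h2 h3 h4 h5 m0 m1 m2 m3 k0 k1 k2 k3 : Bool) : Tb h0 h3 h4 h1 h2 h5 m1 m0 m2 m3 k1 k0 k2 k3 = Tb h0 h1 h2 h3 h4 h5 m0 m1 m2 m3 k0 k1 k2 k3 :=
  le_antisymm (Tb_swap0_le h0 h1 h2 h3 h4 h5 m0 m1 m2 m3 k0 k1 k2 k3) (Tb_swap0_le h0 h3 h4 h1 h2 h5 m1 m0 m2 m3 k1 k0 k2 k3)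

def swCheck1 : Bool :=
  allB fun h0 => allB fun h1 => allB fun h2 => allB fun h3 => allB fun h4 => allB fun h5 => allB fun m0 => allB fun m1 => allB fun m2 => allB fun m3 => allB fun k0 => allB fun k1 => allB fun k2 => allB fun k3 =>
  nonneg (Tb h0 h1 h2 h3 h4 h5 m0 m1 m2 m3 k0 k1 k2 k3 - Tb h1 h0 h2 h3 h5 h4 m0 m2 m1 m3 k0 k2 k1 k3)

theorem swCheck1_true : swCheck1 = true := by decide +kernel

theorem Tb_swap1_le (h0 h1 h2 h3 h4 h5 m0 m1 m2 m3 k0 k1 k2 k3 : Bool) : Tb h1 h0 h2 h3 h5 h4 m0 m2 m1 m3 k0 k2 k1 k3 ≤ Tb h0 h1 h2 h3 h4 h5 m0 m1 m2 m3 k0 k1 k2 k3 := by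
  have h := swCheck1_true
  unfold swCheck1 at h
  replace h := allB_spec h h0
  replace h := allB_spec h h1
  replace h := allB_spec h h2
  replace h := allB_spec h h3
  replace h := allB_spec h h4
  replace h := allB_spec h h5
  replace h := allB_spec h m0
  replace h := allB_spec h m1
  replace h := allB_spec h m2
  replace h := allB_spec h m3
  replace h := allB_spec h k0
  replace h := allB_spec h k1
  replace h := allB_spec h k2
  replace h := allB_spec h k3
  have := nonneg_spec h
  linarith

theorem Tb_swap1 (h0 h1 h2 h3 h4 h5 m0 m1 m2 m3 k0 k1 k2 k3 : Bool) : Tb h1 h0 h2 h3 h5 h4 m0 m2 m1 m3 k0 k2 k1 k3 = Tb h0 h1 h2 h3 h4 h5 m0 m1 m2 m3 k0 k1 k2 k3 :=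
  le_antisymm (Tb_swap1_le h0 h1 h2 h3 h4 h5 m0 m1 m2 m3 k0 k1 k2 k3) (Tb_swap1_le h1 h0 h2 h3 h5 h4 m0 m2 m1 m3 k0 k2 k1 k3)

def swCheck2 : Bool :=
  allB fun h0 => allB fun h1 => allB fun h2 => allB fun h3 => allB fun h4 => allB fun h5 => allB fun m0 => allB fun m1 => allB fun m2 => allB fun m3 => allB fun k0 => allB fun k1 => allB fun k2 => allB fun k3 =>
  nonneg (Tb h0 h1 h2 h3 h4 h5 m0 m1 m2 m3 k0 k1 k2 k3 - Tb h0 h2 h1 h4 h3 h5 m0 m1 m3 m2 k0 k1 k3 k2)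

theorem swCheck2_true : swCheck2 = true := by decide +kernel

theorem Tb_swap2_le (h0 h1 h2 h3 h4 h5 m0 m1 m2 m3 k0 k1 k2 k3 : Bool) : Tb h0 h2 h1 h4 h3 h5 m0 m1 m3 m2 k0 k1 k3 k2 ≤ Tb h0 h1 h2 h3 h4 h5 m0 m1 m2 m3 k0 k1 k2 k3 := by
  have h := swCheck2_true
  unfold swCheck2 at h
  replace h := allB_spec h h0
  replace h := allB_spec h h1
  replace h := allB_spec h h2
  replace h := allB_spec h h3
  replace h := allB_spec h h4
  replace h := allB_spec h h5
  replace h := allB_spec h m0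
  replace h := allB_spec h m1
  replace h := allB_spec h m2
  replace h := allB_spec h m3
  replace h := allB_spec h k0
  replace h := allB_spec h k1
  replace h := allB_spec h k2
  replace h := allB_spec h k3
  have := nonneg_spec h
  linarith

theorem Tb_swap2 (h0 h1 h2 h3 h4 h5 m0 m1 m2 m3 k0 k1 k2 k3 : Bool) : Tb h0 h2 h1 h4 h3 h5 m0 m1 m3 m2 k0 k1 k3 k2 = Tb h0 h1 h2 h3 h4 h5 m0 m1 m2 m3 k0 k1 k2 k3 :=
  le_antisymm (Tb_swap2_le h0 h1 h2 h3 h4 h5 m0 m1 m2 m3 k0 k1 k2 k3) (Tb_swap2_le h0 h2 h1 h4 h3 h5 m0 m1 m3 m2 k0 k1 k3 k2)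

theorem Tb_comm (h0 h1 h2 h3 h4 h5 m0 m1 m2 m3 k0 k1 k2 k3 : Bool) : Tb h0 h1 h2 h3 h4 h5 k0 k1 k2 k3 m0 m1 m2 m3 = Tb h0 h1 h2 h3 h4 h5 m0 m1 m2 m3 k0 k1 k2 k3 := by
  unfold Tb
  simp only
  ring

theorem sel3_01 (p q r : Bool) (x0 x1 x2 x3 : ℤ) : sel3 q p r x0 x1 x2 x3 = sel3 p q r x0 x1 x2 x3 := by
  cases p <;> cases q <;> cases r <;> rfl

theorem sel3_12 (p q r : Bool) (x0 x1 x2 x3 : ℤ) : sel3 p r q x0 x1 x2 x3 = sel3 p q r x0 x1 x2 x3 := by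
  cases p <;> cases q <;> cases r <;> rfl

theorem ps1_01 (p q r : Bool) : ps1 q p r = ps1 p q r := sel3_01 _ _ _ _ _ _ _

theorem ps1_12 (p q r : Bool) : ps1 p r q = ps1 p q r := sel3_12 _ _ _ _ _ _ _

theorem ps2_01 (p q r : Bool) : ps2 q p r = ps2 p q r := sel3_01 _ _ _ _ _ _ _

theorem ps2_12 (p q r : Bool) : ps2 p r q = ps2 p q r := sel3_12 _ _ _ _ _ _ _

theorem ps3_01 (p q r : Bool) : ps3 q p r = ps3 p q r := sel3_01 _ _ _ _ _ _ _

theorem ps3_12 (p q r : Bool) : ps3 p r q = ps3 p q r := sel3_12 _ _ _ _ _ _ _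

theorem bd_01 (p q r : Bool) : bd q p r = bd p q r := sel3_01 _ _ _ _ _ _ _

theorem bd_12 (p q r : Bool) : bd p r q = bd p q r := sel3_12 _ _ _ _ _ _ _

theorem Ec_swap0 (e01 e02 e03 e04 e12 e13 e14 e23 e24 e34 e05 e15 e25 e35 e45 : Bool) :
    Ec e01 e12 e13 e14 e02 e03 e04 e23 e24 e34 e15 e05 e25 e35 e45 = Ec e01 e02 e03 e04 e12 e13 e14 e23 e24 e34 e05 e15 e25 e35 e45 := by
  unfold Ec
  ring

theorem Us_swap0 (e01 e02 e03 e04 e12 e13 e14 e23 e24 e34 e05 e15 e25 e35 e45 : Bool) :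
    Us e01 e12 e13 e14 e02 e03 e04 e23 e24 e34 e15 e05 e25 e35 e45 = Us e01 e02 e03 e04 e12 e13 e14 e23 e24 e34 e05 e15 e25 e35 e45 := by
  unfold Us Ub
  rw [ps1_12 e01 e02 e12, ps1_12 e01 e03 e13, ps1_12 e01 e04 e14, ps1_12 e01 e05 e15, ps2_12 e01 e02 e12, ps2_12 e01 e03 e13, ps2_12 e01 e04 e14, ps2_12 e01 e05 e15, ps3_12 e01 e02 e12, ps3_12 e01 e03 e13, ps3_12 e01 e04 e14, ps3_12 e01 e05 e15]
  ring

theorem Bs_swap0 (e01 e02 e03 e04 e12 e13 e14 e23 e24 e34 e05 e15 e25 e35 e45 : Bool) :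
    Bs e01 e12 e13 e14 e02 e03 e04 e23 e24 e34 e15 e05 e25 e35 e45 = Bs e01 e02 e03 e04 e12 e13 e14 e23 e24 e34 e05 e15 e25 e35 e45 := by
  unfold Bs
  rw [bd_12 e01 e02 e12, bd_12 e01 e03 e13, bd_12 e01 e04 e14, bd_12 e01 e05 e15]
  ring

theorem Ts_swap0 (e01 e02 e03 e04 e12 e13 e14 e23 e24 e34 e05 e15 e25 e35 e45 : Bool) :
    Ts e01 e12 e13 e14 e02 e03 e04 e23 e24 e34 e15 e05 e25 e35 e45 = Ts e01 e02 e03 e04 e12 e13 e14 e23 e24 e34 e05 e15 e25 e35 e45 := by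
  unfold Ts
  rw [Tb_swap0 e01 e02 e03 e12 e13 e23 e04 e14 e24 e34 e05 e15 e25 e35,
    Tb_swap0 e01 e02 e04 e12 e14 e24 e03 e13 e23 e34 e05 e15 e25 e45,
    Tb_swap0 e01 e02 e05 e12 e15 e25 e03 e13 e23 e35 e04 e14 e24 e45,
    Tb_swap0 e01 e03 e04 e13 e14 e34 e02 e12 e23 e24 e05 e15 e35 e45,
    Tb_swap0 e01 e03 e05 e13 e15 e35 e02 e12 e23 e25 e04 e14 e34 e45,
    Tb_swap0 e01 e04 e05 e14 e15 e45 e02 e12 e24 e25 e03 e13 e34 e35,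
    Tb_comm e23 e24 e25 e34 e35 e45 e02 e03 e04 e05 e12 e13 e14 e15]
  ring

theorem Rb_swap0 (e01 e02 e03 e04 e12 e13 e14 e23 e24 e34 e05 e15 e25 e35 e45 : Bool) :
    Rb e01 e12 e13 e14 e02 e03 e04 e23 e24 e34 e15 e05 e25 e35 e45 = Rb e01 e02 e03 e04 e12 e13 e14 e23 e24 e34 e05 e15 e25 e35 e45 := by
  unfold Rb
  rw [Ec_swap0, Ts_swap0, Us_swap0, Bs_swap0]

theorem Ec_swap1 (e01 e02 e03 e04 e12 e13 e14 e23 e24 e34 e05 e15 e25 e35 e45 : Bool) :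
    Ec e02 e01 e03 e04 e12 e23 e24 e13 e14 e34 e05 e25 e15 e35 e45 = Ec e01 e02 e03 e04 e12 e13 e14 e23 e24 e34 e05 e15 e25 e35 e45 := by
  unfold Ec
  ring

theorem Us_swap1 (e01 e02 e03 e04 e12 e13 e14 e23 e24 e34 e05 e15 e25 e35 e45 : Bool) :
    Us e02 e01 e03 e04 e12 e23 e24 e13 e14 e34 e05 e25 e15 e35 e45 = Us e01 e02 e03 e04 e12 e13 e14 e23 e24 e34 e05 e15 e25 e35 e45 := by
  unfold Us Ub
  rw [ps1_01 e01 e02 e12, ps1_12 e12 e13 e23, ps1_12 e12 e14 e24, ps1_12 e12 e15 e25, ps2_01 e01 e02 e12, ps2_12 e12 e13 e23, ps2_12 e12 e14 e24, ps2_12 e12 e15 e25, ps3_01 e01 e02 e12, ps3_12 e12 e13 e23, ps3_12 e12 e14 e24, ps3_12 e12 e15 e25]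
  ring

theorem Bs_swap1 (e01 e02 e03 e04 e12 e13 e14 e23 e24 e34 e05 e15 e25 e35 e45 : Bool) :
    Bs e02 e01 e03 e04 e12 e23 e24 e13 e14 e34 e05 e25 e15 e35 e45 = Bs e01 e02 e03 e04 e12 e13 e14 e23 e24 e34 e05 e15 e25 e35 e45 := by
  unfold Bs
  rw [bd_01 e01 e02 e12, bd_12 e12 e13 e23, bd_12 e12 e14 e24, bd_12 e12 e15 e25]
  ring

theorem Ts_swap1 (e01 e02 e03 e04 e12 e13 e14 e23 e24 e34 e05 e15 e25 e35 e45 : Bool) :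
    Ts e02 e01 e03 e04 e12 e23 e24 e13 e14 e34 e05 e25 e15 e35 e45 = Ts e01 e02 e03 e04 e12 e13 e14 e23 e24 e34 e05 e15 e25 e35 e45 := by
  unfold Ts
  rw [Tb_swap1 e01 e02 e03 e12 e13 e23 e04 e14 e24 e34 e05 e15 e25 e35,
    Tb_swap1 e01 e02 e04 e12 e14 e24 e03 e13 e23 e34 e05 e15 e25 e45,
    Tb_swap1 e01 e02 e05 e12 e15 e25 e03 e13 e23 e35 e04 e14 e24 e45,
    Tb_comm e03 e04 e05 e34 e35 e45 e01 e13 e14 e15 e02 e23 e24 e25,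
    Tb_swap0 e12 e13 e14 e23 e24 e34 e01 e02 e03 e04 e15 e25 e35 e45,
    Tb_swap0 e12 e13 e15 e23 e25 e35 e01 e02 e03 e05 e14 e24 e34 e45,
    Tb_swap0 e12 e14 e15 e24 e25 e45 e01 e02 e04 e05 e13 e23 e34 e35]
  ring

theorem Rb_swap1 (e01 e02 e03 e04 e12 e13 e14 e23 e24 e34 e05 e15 e25 e35 e45 : Bool) :
    Rb e02 e01 e03 e04 e12 e23 e24 e13 e14 e34 e05 e25 e15 e35 e45 = Rb e01 e02 e03 e04 e12 e13 e14 e23 e24 e34 e05 e15 e25 e35 e45 := by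
  unfold Rb
  rw [Ec_swap1, Ts_swap1, Us_swap1, Bs_swap1]

theorem Ec_swap2 (e01 e02 e03 e04 e12 e13 e14 e23 e24 e34 e05 e15 e25 e35 e45 : Bool) :
    Ec e01 e03 e02 e04 e13 e12 e14 e23 e34 e24 e05 e15 e35 e25 e45 = Ec e01 e02 e03 e04 e12 e13 e14 e23 e24 e34 e05 e15 e25 e35 e45 := by
  unfold Ec
  ring

theorem Us_swap2 (e01 e02 e03 e04 e12 e13 e14 e23 e24 e34 e05 e15 e25 e35 e45 : Bool) :
    Us e01 e03 e02 e04 e13 e12 e14 e23 e34 e24 e05 e15 e35 e25 e45 = Us e01 e02 e03 e04 e12 e13 e14 e23 e24 e34 e05 e15 e25 e35 e45 := by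
  unfold Us Ub
  rw [ps1_01 e02 e03 e23, ps1_01 e12 e13 e23, ps1_12 e23 e24 e34, ps1_12 e23 e25 e35, ps2_01 e02 e03 e23, ps2_01 e12 e13 e23, ps2_12 e23 e24 e34, ps2_12 e23 e25 e35, ps3_01 e02 e03 e23, ps3_01 e12 e13 e23, ps3_12 e23 e24 e34, ps3_12 e23 e25 e35]
  ring

theorem Bs_swap2 (e01 e02 e03 e04 e12 e13 e14 e23 e24 e34 e05 e15 e25 e35 e45 : Bool) :
    Bs e01 e03 e02 e04 e13 e12 e14 e23 e34 e24 e05 e15 e35 e25 e45 = Bs e01 e02 e03 e04 e12 e13 e14 e23 e24 e34 e05 e15 e25 e35 e45 := by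
  unfold Bs
  rw [bd_01 e02 e03 e23, bd_01 e12 e13 e23, bd_12 e23 e24 e34, bd_12 e23 e25 e35]
  ring

theorem Ts_swap2 (e01 e02 e03 e04 e12 e13 e14 e23 e24 e34 e05 e15 e25 e35 e45 : Bool) :
    Ts e01 e03 e02 e04 e13 e12 e14 e23 e34 e24 e05 e15 e35 e25 e45 = Ts e01 e02 e03 e04 e12 e13 e14 e23 e24 e34 e05 e15 e25 e35 e45 := by
  unfold Ts
  rw [Tb_swap2 e01 e02 e03 e12 e13 e23 e04 e14 e24 e34 e05 e15 e25 e35,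
    Tb_comm e01 e04 e05 e14 e15 e45 e02 e12 e24 e25 e03 e13 e34 e35,
    Tb_swap1 e02 e03 e04 e23 e24 e34 e01 e12 e13 e14 e05 e25 e35 e45,
    Tb_swap1 e02 e03 e05 e23 e25 e35 e01 e12 e13 e15 e04 e24 e34 e45,
    Tb_swap1 e12 e13 e14 e23 e24 e34 e01 e02 e03 e04 e15 e25 e35 e45,
    Tb_swap1 e12 e13 e15 e23 e25 e35 e01 e02 e03 e05 e14 e24 e34 e45,
    Tb_swap0 e23 e24 e25 e34 e35 e45 e02 e03 e04 e05 e12 e13 e14 e15]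
  ring

theorem Rb_swap2 (e01 e02 e03 e04 e12 e13 e14 e23 e24 e34 e05 e15 e25 e35 e45 : Bool) :
    Rb e01 e03 e02 e04 e13 e12 e14 e23 e34 e24 e05 e15 e35 e25 e45 = Rb e01 e02 e03 e04 e12 e13 e14 e23 e24 e34 e05 e15 e25 e35 e45 := by
  unfold Rb
  rw [Ec_swap2, Ts_swap2, Us_swap2, Bs_swap2]

theorem Ec_swap3 (e01 e02 e03 e04 e12 e13 e14 e23 e24 e34 e05 e15 e25 e35 e45 : Bool) :
    Ec e01 e02 e04 e03 e12 e14 e13 e24 e23 e34 e05 e15 e25 e45 e35 = Ec e01 e02 e03 e04 e12 e13 e14 e23 e24 e34 e05 e15 e25 e35 e45 := by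
  unfold Ec
  ring

theorem Us_swap3 (e01 e02 e03 e04 e12 e13 e14 e23 e24 e34 e05 e15 e25 e35 e45 : Bool) :
    Us e01 e02 e04 e03 e12 e14 e13 e24 e23 e34 e05 e15 e25 e45 e35 = Us e01 e02 e03 e04 e12 e13 e14 e23 e24 e34 e05 e15 e25 e35 e45 := by
  unfold Us Ub
  rw [ps1_01 e03 e04 e34, ps1_01 e13 e14 e34, ps1_01 e23 e24 e34, ps1_12 e34 e35 e45, ps2_01 e03 e04 e34, ps2_01 e13 e14 e34, ps2_01 e23 e24 e34, ps2_12 e34 e35 e45, ps3_01 e03 e04 e34, ps3_01 e13 e14 e34, ps3_01 e23 e24 e34, ps3_12 e34 e35 e45]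
  ring

theorem Bs_swap3 (e01 e02 e03 e04 e12 e13 e14 e23 e24 e34 e05 e15 e25 e35 e45 : Bool) :
    Bs e01 e02 e04 e03 e12 e14 e13 e24 e23 e34 e05 e15 e25 e45 e35 = Bs e01 e02 e03 e04 e12 e13 e14 e23 e24 e34 e05 e15 e25 e35 e45 := by
  unfold Bs
  rw [bd_01 e03 e04 e34, bd_01 e13 e14 e34, bd_01 e23 e24 e34, bd_12 e34 e35 e45]
  ring

theorem Ts_swap3 (e01 e02 e03 e04 e12 e13 e14 e23 e24 e34 e05 e15 e25 e35 e45 : Bool) :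
    Ts e01 e02 e04 e03 e12 e14 e13 e24 e23 e34 e05 e15 e25 e45 e35 = Ts e01 e02 e03 e04 e12 e13 e14 e23 e24 e34 e05 e15 e25 e35 e45 := by
  unfold Ts
  rw [Tb_comm e01 e02 e05 e12 e15 e25 e03 e13 e23 e35 e04 e14 e24 e45,
    Tb_swap2 e01 e03 e04 e13 e14 e34 e02 e12 e23 e24 e05 e15 e35 e45,
    Tb_swap2 e02 e03 e04 e23 e24 e34 e01 e12 e13 e14 e05 e25 e35 e45,
    Tb_swap1 e03 e04 e05 e34 e35 e45 e01 e13 e14 e15 e02 e23 e24 e25,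
    Tb_swap2 e12 e13 e14 e23 e24 e34 e01 e02 e03 e04 e15 e25 e35 e45,
    Tb_swap1 e13 e14 e15 e34 e35 e45 e01 e03 e04 e05 e12 e23 e24 e25,
    Tb_swap1 e23 e24 e25 e34 e35 e45 e02 e03 e04 e05 e12 e13 e14 e15]
  ring

theorem Rb_swap3 (e01 e02 e03 e04 e12 e13 e14 e23 e24 e34 e05 e15 e25 e35 e45 : Bool) :
    Rb e01 e02 e04 e03 e12 e14 e13 e24 e23 e34 e05 e15 e25 e45 e35 = Rb e01 e02 e03 e04 e12 e13 e14 e23 e24 e34 e05 e15 e25 e35 e45 := by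
  unfold Rb
  rw [Ec_swap3, Ts_swap3, Us_swap3, Bs_swap3]

theorem Rb_nonneg_aux (N : ℕ) : ∀ (e01 e02 e03 e04 e12 e13 e14 e23 e24 e34 e05 e15 e25 e35 e45 : Bool), code e01 e02 e03 e04 e12 e13 e14 e23 e24 e34 < N →
    0 ≤ Rb e01 e02 e03 e04 e12 e13 e14 e23 e24 e34 e05 e15 e25 e35 e45 := by
  induction N with
  | zero => intro e01 e02 e03 e04 e12 e13 e14 e23 e24 e34 e05 e15 e25 e35 e45 h; exact absurd h (Nat.not_lt_zero _)
  | succ N ih =>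
    intro e01 e02 e03 e04 e12 e13 e14 e23 e24 e34 e05 e15 e25 e35 e45 hN
    have h := bigCheck_true
    unfold bigCheck at h
    replace h := allB_spec h e01
    replace h := allB_spec h e02
    replace h := allB_spec h e03
    replace h := allB_spec h e04
    replace h := allB_spec h e12
    replace h := allB_spec h e13
    replace h := allB_spec h e14
    replace h := allB_spec h e23
    replace h := allB_spec h e24
    replace h := allB_spec h e34
    rw [Bool.or_eq_true] at h
    rcases h with h | h
    · unfold lowers at h
      simp only [Bool.or_eq_true, Nat.blt_eq] at h
      rcases h with ((h | h) | h) | h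
      · rw [← Rb_swap0]
        exact ih _ _ _ _ _ _ _ _ _ _ _ _ _ _ _ (lt_of_lt_of_le h (Nat.le_of_lt_succ hN))
      · rw [← Rb_swap1]
        exact ih _ _ _ _ _ _ _ _ _ _ _ _ _ _ _ (lt_of_lt_of_le h (Nat.le_of_lt_succ hN))
      · rw [← Rb_swap2]
        exact ih _ _ _ _ _ _ _ _ _ _ _ _ _ _ _ (lt_of_lt_of_le h (Nat.le_of_lt_succ hN))
      · rw [← Rb_swap3]
        exact ih _ _ _ _ _ _ _ _ _ _ _ _ _ _ _ (lt_of_lt_of_le h (Nat.le_of_lt_succ hN))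
    · replace h := allB_spec h e05
      replace h := allB_spec h e15
      replace h := allB_spec h e25
      replace h := allB_spec h e35
      replace h := allB_spec h e45
      exact nonneg_spec h

theorem Rb_nonneg (e01 e02 e03 e04 e12 e13 e14 e23 e24 e34 e05 e15 e25 e35 e45 : Bool) : 0 ≤ Rb e01 e02 e03 e04 e12 e13 e14 e23 e24 e34 e05 e15 e25 e35 e45 :=
  Rb_nonneg_aux _ _ _ _ _ _ _ _ _ _ _ _ _ _ _ _ (Nat.lt_succ_self _)

section CoreIneq
variable {V : Type} [Fintype V]

theorem sumTupleCons {k : ℕ} (f : (Fin (k + 1) → V) → ℤ) :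
    ∑ x : Fin (k + 1) → V, f x = ∑ v : V, ∑ y : Fin k → V, f (Fin.cons v y) := by
  rw [← Fintype.sum_prod_type']
  exact (Equiv.sum_comp (Fin.consEquiv (fun _ : Fin (k + 1) => V)) f).symm

theorem sum_reindex (e : Equiv.Perm (Fin 6)) (f : (Fin 6 → V) → ℤ) :
    ∑ x : Fin 6 → V, f (fun i => x (e i)) = ∑ x : Fin 6 → V, f x :=
  Equiv.sum_comp (Equiv.arrowCongr e.symm (Equiv.refl V)) f

theorem sum_reindex_fun (q : Fin 6 → Fin 6) (hq : Function.Injective q) (f : (Fin 6 → V) → ℤ) :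
    ∑ x : Fin 6 → V, f (fun i => x (q i)) = ∑ x : Fin 6 → V, f x :=
  sum_reindex (Equiv.ofBijective q (Finite.injective_iff_bijective.mp hq)) f

theorem sum_six (f : V → V → V → V → V → V → ℤ) :
    ∑ x : Fin 6 → V, f (x 0) (x 1) (x 2) (x 3) (x 4) (x 5)
      = ∑ u0, ∑ u1, ∑ u2, ∑ u3, ∑ u4, ∑ u5, f u0 u1 u2 u3 u4 u5 := by
  simp only [sumTupleCons]
  simp only [Fintype.sum_unique]
  rfl

def TsV (a : V → V → Bool) (x : Fin 6 → V) : ℤ := Ts (a (x 0) (x 1)) (a (x 0) (x 2)) (a (x 0) (x 3)) (a (x 0) (x 4)) (a (x 1) (x 2)) (a (x 1) (x 3)) (a (x 1) (x 4)) (a (x 2) (x 3)) (a (x 2) (x 4)) (a (x 3) (x 4)) (a (x 0) (x 5)) (a (x 1) (x 5)) (a (x 2) (x 5)) (a (x 3) (x 5)) (a (x 4) (x 5))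
def UsV (a : V → V → Bool) (x : Fin 6 → V) : ℤ := Us (a (x 0) (x 1)) (a (x 0) (x 2)) (a (x 0) (x 3)) (a (x 0) (x 4)) (a (x 1) (x 2)) (a (x 1) (x 3)) (a (x 1) (x 4)) (a (x 2) (x 3)) (a (x 2) (x 4)) (a (x 3) (x 4)) (a (x 0) (x 5)) (a (x 1) (x 5)) (a (x 2) (x 5)) (a (x 3) (x 5)) (a (x 4) (x 5))
def BsV (a : V → V → Bool) (x : Fin 6 → V) : ℤ := Bs (a (x 0) (x 1)) (a (x 0) (x 2)) (a (x 0) (x 3)) (a (x 0) (x 4)) (a (x 1) (x 2)) (a (x 1) (x 3)) (a (x 1) (x 4)) (a (x 2) (x 3)) (a (x 2) (x 4)) (a (x 3) (x 4)) (a (x 0) (x 5)) (a (x 1) (x 5)) (a (x 2) (x 5)) (a (x 3) (x 5)) (a (x 4) (x 5))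
def EcV (a : V → V → Bool) (x : Fin 6 → V) : ℕ := Ec (a (x 0) (x 1)) (a (x 0) (x 2)) (a (x 0) (x 3)) (a (x 0) (x 4)) (a (x 1) (x 2)) (a (x 1) (x 3)) (a (x 1) (x 4)) (a (x 2) (x 3)) (a (x 2) (x 4)) (a (x 3) (x 4)) (a (x 0) (x 5)) (a (x 1) (x 5)) (a (x 2) (x 5)) (a (x 3) (x 5)) (a (x 4) (x 5))

/-- One test term, roots are the first four positions. -/
def Tf (a : V → V → Bool) (y : Fin 6 → V) : ℤ :=
  Tb (a (y 0) (y 1)) (a (y 0) (y 2)) (a (y 0) (y 3)) (a (y 1) (y 2)) (a (y 1) (y 3)) (a (y 2) (y 3))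
    (a (y 4) (y 0)) (a (y 4) (y 1)) (a (y 4) (y 2)) (a (y 4) (y 3))
    (a (y 5) (y 0)) (a (y 5) (y 1)) (a (y 5) (y 2)) (a (y 5) (y 3))

theorem wt_nonneg (h0 h1 h2 h3 h4 h5 : Bool) :
    0 ≤ (wt h0 h1 h2 h3 h4 h5).a ∧ 0 ≤ (wt h0 h1 h2 h3 h4 h5).b ∧
    0 ≤ (wt h0 h1 h2 h3 h4 h5).c ∧ 0 ≤ (wt h0 h1 h2 h3 h4 h5).d := by
  revert h0 h1 h2 h3 h4 h5
  decide +kernel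

theorem sum_sq_aux (w : ℤ) (g : V → ℤ) : ∑ u, ∑ v, w * (g u * g v) = w * (∑ u, g u) ^ 2 := by
  rw [sq, Finset.sum_mul_sum, Finset.mul_sum]
  simp only [Finset.mul_sum]

theorem sum_Tf_nonneg (a : V → V → Bool) : 0 ≤ ∑ x : Fin 6 → V, Tf a x := by
  unfold Tf
  rw [sum_six (fun u0 u1 u2 u3 u4 u5 => Tb (a u0 u1) (a u0 u2) (a u0 u3) (a u1 u2) (a u1 u3) (a u2 u3)
    (a u4 u0) (a u4 u1) (a u4 u2) (a u4 u3) (a u5 u0) (a u5 u1) (a u5 u2) (a u5 u3))]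
  refine Finset.sum_nonneg fun u0 _ => Finset.sum_nonneg fun u1 _ => Finset.sum_nonneg fun u2 _ =>
    Finset.sum_nonneg fun u3 _ => ?_
  unfold Tb
  simp only [Finset.sum_add_distrib]
  have h := wt_nonneg (a u0 u1) (a u0 u2) (a u0 u3) (a u1 u2) (a u1 u3) (a u2 u3)
  generalize wt (a u0 u1) (a u0 u2) (a u0 u3) (a u1 u2) (a u1 u3) (a u2 u3) = W at h
  obtain ⟨h1, h2, h3, h4⟩ := h
  rw [sum_sq_aux, sum_sq_aux, sum_sq_aux, sum_sq_aux]
  positivity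

theorem sum_TsV_nonneg (a : V → V → Bool) (hs : ∀ u v, a u v = a v u) : 0 ≤ ∑ x : Fin 6 → V, TsV a x := by
  unfold TsV Ts
  simp only [Finset.sum_add_distrib]
  have h0 := sum_Tf_nonneg a
  have k0 : ∑ x : Fin 6 → V, Tb (a (x 0) (x 1)) (a (x 0) (x 2)) (a (x 0) (x 3)) (a (x 1) (x 2)) (a (x 1) (x 3)) (a (x 2) (x 3)) (a (x 0) (x 4)) (a (x 1) (x 4)) (a (x 2) (x 4)) (a (x 3) (x 4)) (a (x 0) (x 5)) (a (x 1) (x 5)) (a (x 2) (x 5)) (a (x 3) (x 5))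
      = ∑ x : Fin 6 → V, Tf a x := by
    rw [← sum_reindex_fun ![0, 1, 2, 3, 4, 5] (by decide) (Tf a)]
    refine Finset.sum_congr rfl fun x _ => ?_
    change _ = Tb (a (x 0) (x 1)) (a (x 0) (x 2)) (a (x 0) (x 3)) (a (x 1) (x 2)) (a (x 1) (x 3)) (a (x 2) (x 3)) (a (x 4) (x 0)) (a (x 4) (x 1)) (a (x 4) (x 2)) (a (x 4) (x 3)) (a (x 5) (x 0)) (a (x 5) (x 1)) (a (x 5) (x 2)) (a (x 5) (x 3))
    rw [hs (x 4) (x 0), hs (x 4) (x 1), hs (x 4) (x 2), hs (x 4) (x 3), hs (x 5) (x 0), hs (x 5) (x 1), hs (x 5) (x 2), hs (x 5) (x 3)]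
  have k1 : ∑ x : Fin 6 → V, Tb (a (x 0) (x 1)) (a (x 0) (x 2)) (a (x 0) (x 4)) (a (x 1) (x 2)) (a (x 1) (x 4)) (a (x 2) (x 4)) (a (x 0) (x 3)) (a (x 1) (x 3)) (a (x 2) (x 3)) (a (x 3) (x 4)) (a (x 0) (x 5)) (a (x 1) (x 5)) (a (x 2) (x 5)) (a (x 4) (x 5))
      = ∑ x : Fin 6 → V, Tf a x := by
    rw [← sum_reindex_fun ![0, 1, 2, 4, 3, 5] (by decide) (Tf a)]
    refine Finset.sum_congr rfl fun x _ => ?_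
    change _ = Tb (a (x 0) (x 1)) (a (x 0) (x 2)) (a (x 0) (x 4)) (a (x 1) (x 2)) (a (x 1) (x 4)) (a (x 2) (x 4)) (a (x 3) (x 0)) (a (x 3) (x 1)) (a (x 3) (x 2)) (a (x 3) (x 4)) (a (x 5) (x 0)) (a (x 5) (x 1)) (a (x 5) (x 2)) (a (x 5) (x 4))
    rw [hs (x 3) (x 0), hs (x 3) (x 1), hs (x 3) (x 2), hs (x 5) (x 0), hs (x 5) (x 1), hs (x 5) (x 2), hs (x 5) (x 4)]
  have k2 : ∑ x : Fin 6 → V, Tb (a (x 0) (x 1)) (a (x 0) (x 2)) (a (x 0) (x 5)) (a (x 1) (x 2)) (a (x 1) (x 5)) (a (x 2) (x 5)) (a (x 0) (x 3)) (a (x 1) (x 3)) (a (x 2) (x 3)) (a (x 3) (x 5)) (a (x 0) (x 4)) (a (x 1) (x 4)) (a (x 2) (x 4)) (a (x 4) (x 5))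
      = ∑ x : Fin 6 → V, Tf a x := by
    rw [← sum_reindex_fun ![0, 1, 2, 5, 3, 4] (by decide) (Tf a)]
    refine Finset.sum_congr rfl fun x _ => ?_
    change _ = Tb (a (x 0) (x 1)) (a (x 0) (x 2)) (a (x 0) (x 5)) (a (x 1) (x 2)) (a (x 1) (x 5)) (a (x 2) (x 5)) (a (x 3) (x 0)) (a (x 3) (x 1)) (a (x 3) (x 2)) (a (x 3) (x 5)) (a (x 4) (x 0)) (a (x 4) (x 1)) (a (x 4) (x 2)) (a (x 4) (x 5))
    rw [hs (x 3) (x 0), hs (x 3) (x 1), hs (x 3) (x 2), hs (x 4) (x 0), hs (x 4) (x 1), hs (x 4) (x 2)]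
  have k3 : ∑ x : Fin 6 → V, Tb (a (x 0) (x 1)) (a (x 0) (x 3)) (a (x 0) (x 4)) (a (x 1) (x 3)) (a (x 1) (x 4)) (a (x 3) (x 4)) (a (x 0) (x 2)) (a (x 1) (x 2)) (a (x 2) (x 3)) (a (x 2) (x 4)) (a (x 0) (x 5)) (a (x 1) (x 5)) (a (x 3) (x 5)) (a (x 4) (x 5))
      = ∑ x : Fin 6 → V, Tf a x := by
    rw [← sum_reindex_fun ![0, 1, 3, 4, 2, 5] (by decide) (Tf a)]
    refine Finset.sum_congr rfl fun x _ => ?_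
    change _ = Tb (a (x 0) (x 1)) (a (x 0) (x 3)) (a (x 0) (x 4)) (a (x 1) (x 3)) (a (x 1) (x 4)) (a (x 3) (x 4)) (a (x 2) (x 0)) (a (x 2) (x 1)) (a (x 2) (x 3)) (a (x 2) (x 4)) (a (x 5) (x 0)) (a (x 5) (x 1)) (a (x 5) (x 3)) (a (x 5) (x 4))
    rw [hs (x 2) (x 0), hs (x 2) (x 1), hs (x 5) (x 0), hs (x 5) (x 1), hs (x 5) (x 3), hs (x 5) (x 4)]
  have k4 : ∑ x : Fin 6 → V, Tb (a (x 0) (x 1)) (a (x 0) (x 3)) (a (x 0) (x 5)) (a (x 1) (x 3)) (a (x 1) (x 5)) (a (x 3) (x 5)) (a (x 0) (x 2)) (a (x 1) (x 2)) (a (x 2) (x 3)) (a (x 2) (x 5)) (a (x 0) (x 4)) (a (x 1) (x 4)) (a (x 3) (x 4)) (a (x 4) (x 5))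
      = ∑ x : Fin 6 → V, Tf a x := by
    rw [← sum_reindex_fun ![0, 1, 3, 5, 2, 4] (by decide) (Tf a)]
    refine Finset.sum_congr rfl fun x _ => ?_
    change _ = Tb (a (x 0) (x 1)) (a (x 0) (x 3)) (a (x 0) (x 5)) (a (x 1) (x 3)) (a (x 1) (x 5)) (a (x 3) (x 5)) (a (x 2) (x 0)) (a (x 2) (x 1)) (a (x 2) (x 3)) (a (x 2) (x 5)) (a (x 4) (x 0)) (a (x 4) (x 1)) (a (x 4) (x 3)) (a (x 4) (x 5))
    rw [hs (x 2) (x 0), hs (x 2) (x 1), hs (x 4) (x 0), hs (x 4) (x 1), hs (x 4) (x 3)]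
  have k5 : ∑ x : Fin 6 → V, Tb (a (x 0) (x 1)) (a (x 0) (x 4)) (a (x 0) (x 5)) (a (x 1) (x 4)) (a (x 1) (x 5)) (a (x 4) (x 5)) (a (x 0) (x 2)) (a (x 1) (x 2)) (a (x 2) (x 4)) (a (x 2) (x 5)) (a (x 0) (x 3)) (a (x 1) (x 3)) (a (x 3) (x 4)) (a (x 3) (x 5))
      = ∑ x : Fin 6 → V, Tf a x := by
    rw [← sum_reindex_fun ![0, 1, 4, 5, 2, 3] (by decide) (Tf a)]
    refine Finset.sum_congr rfl fun x _ => ?_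
    change _ = Tb (a (x 0) (x 1)) (a (x 0) (x 4)) (a (x 0) (x 5)) (a (x 1) (x 4)) (a (x 1) (x 5)) (a (x 4) (x 5)) (a (x 2) (x 0)) (a (x 2) (x 1)) (a (x 2) (x 4)) (a (x 2) (x 5)) (a (x 3) (x 0)) (a (x 3) (x 1)) (a (x 3) (x 4)) (a (x 3) (x 5))
    rw [hs (x 2) (x 0), hs (x 2) (x 1), hs (x 3) (x 0), hs (x 3) (x 1)]
  have k6 : ∑ x : Fin 6 → V, Tb (a (x 0) (x 2)) (a (x 0) (x 3)) (a (x 0) (x 4)) (a (x 2) (x 3)) (a (x 2) (x 4)) (a (x 3) (x 4)) (a (x 0) (x 1)) (a (x 1) (x 2)) (a (x 1) (x 3)) (a (x 1) (x 4)) (a (x 0) (x 5)) (a (x 2) (x 5)) (a (x 3) (x 5)) (a (x 4) (x 5))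
      = ∑ x : Fin 6 → V, Tf a x := by
    rw [← sum_reindex_fun ![0, 2, 3, 4, 1, 5] (by decide) (Tf a)]
    refine Finset.sum_congr rfl fun x _ => ?_
    change _ = Tb (a (x 0) (x 2)) (a (x 0) (x 3)) (a (x 0) (x 4)) (a (x 2) (x 3)) (a (x 2) (x 4)) (a (x 3) (x 4)) (a (x 1) (x 0)) (a (x 1) (x 2)) (a (x 1) (x 3)) (a (x 1) (x 4)) (a (x 5) (x 0)) (a (x 5) (x 2)) (a (x 5) (x 3)) (a (x 5) (x 4))
    rw [hs (x 1) (x 0), hs (x 5) (x 0), hs (x 5) (x 2), hs (x 5) (x 3), hs (x 5) (x 4)]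
  have k7 : ∑ x : Fin 6 → V, Tb (a (x 0) (x 2)) (a (x 0) (x 3)) (a (x 0) (x 5)) (a (x 2) (x 3)) (a (x 2) (x 5)) (a (x 3) (x 5)) (a (x 0) (x 1)) (a (x 1) (x 2)) (a (x 1) (x 3)) (a (x 1) (x 5)) (a (x 0) (x 4)) (a (x 2) (x 4)) (a (x 3) (x 4)) (a (x 4) (x 5))
      = ∑ x : Fin 6 → V, Tf a x := by
    rw [← sum_reindex_fun ![0, 2, 3, 5, 1, 4] (by decide) (Tf a)]
    refine Finset.sum_congr rfl fun x _ => ?_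
    change _ = Tb (a (x 0) (x 2)) (a (x 0) (x 3)) (a (x 0) (x 5)) (a (x 2) (x 3)) (a (x 2) (x 5)) (a (x 3) (x 5)) (a (x 1) (x 0)) (a (x 1) (x 2)) (a (x 1) (x 3)) (a (x 1) (x 5)) (a (x 4) (x 0)) (a (x 4) (x 2)) (a (x 4) (x 3)) (a (x 4) (x 5))
    rw [hs (x 1) (x 0), hs (x 4) (x 0), hs (x 4) (x 2), hs (x 4) (x 3)]
  have k8 : ∑ x : Fin 6 → V, Tb (a (x 0) (x 2)) (a (x 0) (x 4)) (a (x 0) (x 5)) (a (x 2) (x 4)) (a (x 2) (x 5)) (a (x 4) (x 5)) (a (x 0) (x 1)) (a (x 1) (x 2)) (a (x 1) (x 4)) (a (x 1) (x 5)) (a (x 0) (x 3)) (a (x 2) (x 3)) (a (x 3) (x 4)) (a (x 3) (x 5))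
      = ∑ x : Fin 6 → V, Tf a x := by
    rw [← sum_reindex_fun ![0, 2, 4, 5, 1, 3] (by decide) (Tf a)]
    refine Finset.sum_congr rfl fun x _ => ?_
    change _ = Tb (a (x 0) (x 2)) (a (x 0) (x 4)) (a (x 0) (x 5)) (a (x 2) (x 4)) (a (x 2) (x 5)) (a (x 4) (x 5)) (a (x 1) (x 0)) (a (x 1) (x 2)) (a (x 1) (x 4)) (a (x 1) (x 5)) (a (x 3) (x 0)) (a (x 3) (x 2)) (a (x 3) (x 4)) (a (x 3) (x 5))
    rw [hs (x 1) (x 0), hs (x 3) (x 0), hs (x 3) (x 2)]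
  have k9 : ∑ x : Fin 6 → V, Tb (a (x 0) (x 3)) (a (x 0) (x 4)) (a (x 0) (x 5)) (a (x 3) (x 4)) (a (x 3) (x 5)) (a (x 4) (x 5)) (a (x 0) (x 1)) (a (x 1) (x 3)) (a (x 1) (x 4)) (a (x 1) (x 5)) (a (x 0) (x 2)) (a (x 2) (x 3)) (a (x 2) (x 4)) (a (x 2) (x 5))
      = ∑ x : Fin 6 → V, Tf a x := by
    rw [← sum_reindex_fun ![0, 3, 4, 5, 1, 2] (by decide) (Tf a)]
    refine Finset.sum_congr rfl fun x _ => ?_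
    change _ = Tb (a (x 0) (x 3)) (a (x 0) (x 4)) (a (x 0) (x 5)) (a (x 3) (x 4)) (a (x 3) (x 5)) (a (x 4) (x 5)) (a (x 1) (x 0)) (a (x 1) (x 3)) (a (x 1) (x 4)) (a (x 1) (x 5)) (a (x 2) (x 0)) (a (x 2) (x 3)) (a (x 2) (x 4)) (a (x 2) (x 5))
    rw [hs (x 1) (x 0), hs (x 2) (x 0)]
  have k10 : ∑ x : Fin 6 → V, Tb (a (x 1) (x 2)) (a (x 1) (x 3)) (a (x 1) (x 4)) (a (x 2) (x 3)) (a (x 2) (x 4)) (a (x 3) (x 4)) (a (x 0) (x 1)) (a (x 0) (x 2)) (a (x 0) (x 3)) (a (x 0) (x 4)) (a (x 1) (x 5)) (a (x 2) (x 5)) (a (x 3) (x 5)) (a (x 4) (x 5))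
      = ∑ x : Fin 6 → V, Tf a x := by
    rw [← sum_reindex_fun ![1, 2, 3, 4, 0, 5] (by decide) (Tf a)]
    refine Finset.sum_congr rfl fun x _ => ?_
    change _ = Tb (a (x 1) (x 2)) (a (x 1) (x 3)) (a (x 1) (x 4)) (a (x 2) (x 3)) (a (x 2) (x 4)) (a (x 3) (x 4)) (a (x 0) (x 1)) (a (x 0) (x 2)) (a (x 0) (x 3)) (a (x 0) (x 4)) (a (x 5) (x 1)) (a (x 5) (x 2)) (a (x 5) (x 3)) (a (x 5) (x 4))
    rw [hs (x 5) (x 1), hs (x 5) (x 2), hs (x 5) (x 3), hs (x 5) (x 4)]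
  have k11 : ∑ x : Fin 6 → V, Tb (a (x 1) (x 2)) (a (x 1) (x 3)) (a (x 1) (x 5)) (a (x 2) (x 3)) (a (x 2) (x 5)) (a (x 3) (x 5)) (a (x 0) (x 1)) (a (x 0) (x 2)) (a (x 0) (x 3)) (a (x 0) (x 5)) (a (x 1) (x 4)) (a (x 2) (x 4)) (a (x 3) (x 4)) (a (x 4) (x 5))
      = ∑ x : Fin 6 → V, Tf a x := by
    rw [← sum_reindex_fun ![1, 2, 3, 5, 0, 4] (by decide) (Tf a)]
    refine Finset.sum_congr rfl fun x _ => ?_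
    change _ = Tb (a (x 1) (x 2)) (a (x 1) (x 3)) (a (x 1) (x 5)) (a (x 2) (x 3)) (a (x 2) (x 5)) (a (x 3) (x 5)) (a (x 0) (x 1)) (a (x 0) (x 2)) (a (x 0) (x 3)) (a (x 0) (x 5)) (a (x 4) (x 1)) (a (x 4) (x 2)) (a (x 4) (x 3)) (a (x 4) (x 5))
    rw [hs (x 4) (x 1), hs (x 4) (x 2), hs (x 4) (x 3)]
  have k12 : ∑ x : Fin 6 → V, Tb (a (x 1) (x 2)) (a (x 1) (x 4)) (a (x 1) (x 5)) (a (x 2) (x 4)) (a (x 2) (x 5)) (a (x 4) (x 5)) (a (x 0) (x 1)) (a (x 0) (x 2)) (a (x 0) (x 4)) (a (x 0) (x 5)) (a (x 1) (x 3)) (a (x 2) (x 3)) (a (x 3) (x 4)) (a (x 3) (x 5))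
      = ∑ x : Fin 6 → V, Tf a x := by
    rw [← sum_reindex_fun ![1, 2, 4, 5, 0, 3] (by decide) (Tf a)]
    refine Finset.sum_congr rfl fun x _ => ?_
    change _ = Tb (a (x 1) (x 2)) (a (x 1) (x 4)) (a (x 1) (x 5)) (a (x 2) (x 4)) (a (x 2) (x 5)) (a (x 4) (x 5)) (a (x 0) (x 1)) (a (x 0) (x 2)) (a (x 0) (x 4)) (a (x 0) (x 5)) (a (x 3) (x 1)) (a (x 3) (x 2)) (a (x 3) (x 4)) (a (x 3) (x 5))
    rw [hs (x 3) (x 1), hs (x 3) (x 2)]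
  have k13 : ∑ x : Fin 6 → V, Tb (a (x 1) (x 3)) (a (x 1) (x 4)) (a (x 1) (x 5)) (a (x 3) (x 4)) (a (x 3) (x 5)) (a (x 4) (x 5)) (a (x 0) (x 1)) (a (x 0) (x 3)) (a (x 0) (x 4)) (a (x 0) (x 5)) (a (x 1) (x 2)) (a (x 2) (x 3)) (a (x 2) (x 4)) (a (x 2) (x 5))
      = ∑ x : Fin 6 → V, Tf a x := by
    rw [← sum_reindex_fun ![1, 3, 4, 5, 0, 2] (by decide) (Tf a)]
    refine Finset.sum_congr rfl fun x _ => ?_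
    change _ = Tb (a (x 1) (x 3)) (a (x 1) (x 4)) (a (x 1) (x 5)) (a (x 3) (x 4)) (a (x 3) (x 5)) (a (x 4) (x 5)) (a (x 0) (x 1)) (a (x 0) (x 3)) (a (x 0) (x 4)) (a (x 0) (x 5)) (a (x 2) (x 1)) (a (x 2) (x 3)) (a (x 2) (x 4)) (a (x 2) (x 5))
    rw [hs (x 2) (x 1)]
  have k14 : ∑ x : Fin 6 → V, Tb (a (x 2) (x 3)) (a (x 2) (x 4)) (a (x 2) (x 5)) (a (x 3) (x 4)) (a (x 3) (x 5)) (a (x 4) (x 5)) (a (x 0) (x 2)) (a (x 0) (x 3)) (a (x 0) (x 4)) (a (x 0) (x 5)) (a (x 1) (x 2)) (a (x 1) (x 3)) (a (x 1) (x 4)) (a (x 1) (x 5))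
      = ∑ x : Fin 6 → V, Tf a x := by
    rw [← sum_reindex_fun ![2, 3, 4, 5, 0, 1] (by decide) (Tf a)]
    refine Finset.sum_congr rfl fun x _ => ?_
    change _ = Tb (a (x 2) (x 3)) (a (x 2) (x 4)) (a (x 2) (x 5)) (a (x 3) (x 4)) (a (x 3) (x 5)) (a (x 4) (x 5)) (a (x 0) (x 2)) (a (x 0) (x 3)) (a (x 0) (x 4)) (a (x 0) (x 5)) (a (x 1) (x 2)) (a (x 1) (x 3)) (a (x 1) (x 4)) (a (x 1) (x 5))
    rfl
  rw [k0, k1, k2, k3, k4, k5, k6, k7, k8, k9, k10, k11, k12, k13, k14]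
  linarith

def sg (b : Bool) : ℤ := bif b then 1 else -1

theorem ps3_eq (p q r : Bool) : ps3 p q r = sg p + sg q + sg r := by
  cases p <;> cases q <;> cases r <;> rfl

theorem sum_prod33 (ps : V → V → V → ℤ) :
    ∑ x : Fin 6 → V, ps (x 0) (x 1) (x 2) * ps (x 3) (x 4) (x 5) = (∑ u, ∑ v, ∑ w, ps u v w) ^ 2 := by
  rw [sum_six (fun u0 u1 u2 u3 u4 u5 => ps u0 u1 u2 * ps u3 u4 u5)]
  simp only [← Finset.mul_sum, ← Finset.sum_mul]
  rw [sq]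

theorem sum_ps3 (a : V → V → Bool) :
    ∑ u, ∑ v, ∑ w, ps3 (a u v) (a u w) (a v w) = 3 * (Fintype.card V : ℤ) * ∑ u, ∑ v, sg (a u v) := by
  simp only [ps3_eq, Finset.sum_add_distrib, Finset.sum_const, Finset.card_univ, nsmul_eq_mul,
    ← Finset.mul_sum]
  ring

def Uf (a : V → V → Bool) (y : Fin 6 → V) : ℤ :=
  Ub (a (y 0) (y 1)) (a (y 0) (y 2)) (a (y 1) (y 2)) (a (y 3) (y 4)) (a (y 3) (y 5)) (a (y 4) (y 5))

theorem sum_Uf (a : V → V → Bool) :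
    10800 * (Fintype.card V : ℤ) ^ 2 * (∑ u, ∑ v, sg (a u v)) ^ 2 ≤ ∑ x : Fin 6 → V, Uf a x := by
  unfold Uf Ub
  simp only [Finset.sum_add_distrib, ← Finset.mul_sum]
  rw [sum_prod33 (fun u v w => ps1 (a u v) (a u w) (a v w)),
    sum_prod33 (fun u v w => ps2 (a u v) (a u w) (a v w)),
    sum_prod33 (fun u v w => ps3 (a u v) (a u w) (a v w)), sum_ps3]
  have h1 := sq_nonneg (∑ u, ∑ v, ∑ w, ps1 (a u v) (a u w) (a v w))
  have h2 := sq_nonneg (∑ u, ∑ v, ∑ w, ps2 (a u v) (a u w) (a v w))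
  simp only [Int.ofNat_eq_natCast, Nat.cast_ofNat]
  nlinarith

theorem sum_UsV (a : V → V → Bool) :
    108000 * (Fintype.card V : ℤ) ^ 2 * (∑ u, ∑ v, sg (a u v)) ^ 2 ≤ ∑ x : Fin 6 → V, UsV a x := by
  unfold UsV Us
  simp only [Finset.sum_add_distrib]
  have h0 := sum_Uf a
  have k0 : ∑ x : Fin 6 → V, Ub (a (x 0) (x 1)) (a (x 0) (x 2)) (a (x 1) (x 2)) (a (x 3) (x 4)) (a (x 3) (x 5)) (a (x 4) (x 5))
      = ∑ x : Fin 6 → V, Uf a x := sum_reindex_fun ![0, 1, 2, 3, 4, 5] (by decide) (Uf a)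
  have k1 : ∑ x : Fin 6 → V, Ub (a (x 0) (x 1)) (a (x 0) (x 3)) (a (x 1) (x 3)) (a (x 2) (x 4)) (a (x 2) (x 5)) (a (x 4) (x 5))
      = ∑ x : Fin 6 → V, Uf a x := sum_reindex_fun ![0, 1, 3, 2, 4, 5] (by decide) (Uf a)
  have k2 : ∑ x : Fin 6 → V, Ub (a (x 0) (x 1)) (a (x 0) (x 4)) (a (x 1) (x 4)) (a (x 2) (x 3)) (a (x 2) (x 5)) (a (x 3) (x 5))
      = ∑ x : Fin 6 → V, Uf a x := sum_reindex_fun ![0, 1, 4, 2, 3, 5] (by decide) (Uf a)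
  have k3 : ∑ x : Fin 6 → V, Ub (a (x 0) (x 1)) (a (x 0) (x 5)) (a (x 1) (x 5)) (a (x 2) (x 3)) (a (x 2) (x 4)) (a (x 3) (x 4))
      = ∑ x : Fin 6 → V, Uf a x := sum_reindex_fun ![0, 1, 5, 2, 3, 4] (by decide) (Uf a)
  have k4 : ∑ x : Fin 6 → V, Ub (a (x 0) (x 2)) (a (x 0) (x 3)) (a (x 2) (x 3)) (a (x 1) (x 4)) (a (x 1) (x 5)) (a (x 4) (x 5))
      = ∑ x : Fin 6 → V, Uf a x := sum_reindex_fun ![0, 2, 3, 1, 4, 5] (by decide) (Uf a)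
  have k5 : ∑ x : Fin 6 → V, Ub (a (x 0) (x 2)) (a (x 0) (x 4)) (a (x 2) (x 4)) (a (x 1) (x 3)) (a (x 1) (x 5)) (a (x 3) (x 5))
      = ∑ x : Fin 6 → V, Uf a x := sum_reindex_fun ![0, 2, 4, 1, 3, 5] (by decide) (Uf a)
  have k6 : ∑ x : Fin 6 → V, Ub (a (x 0) (x 2)) (a (x 0) (x 5)) (a (x 2) (x 5)) (a (x 1) (x 3)) (a (x 1) (x 4)) (a (x 3) (x 4))
      = ∑ x : Fin 6 → V, Uf a x := sum_reindex_fun ![0, 2, 5, 1, 3, 4] (by decide) (Uf a)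
  have k7 : ∑ x : Fin 6 → V, Ub (a (x 0) (x 3)) (a (x 0) (x 4)) (a (x 3) (x 4)) (a (x 1) (x 2)) (a (x 1) (x 5)) (a (x 2) (x 5))
      = ∑ x : Fin 6 → V, Uf a x := sum_reindex_fun ![0, 3, 4, 1, 2, 5] (by decide) (Uf a)
  have k8 : ∑ x : Fin 6 → V, Ub (a (x 0) (x 3)) (a (x 0) (x 5)) (a (x 3) (x 5)) (a (x 1) (x 2)) (a (x 1) (x 4)) (a (x 2) (x 4))
      = ∑ x : Fin 6 → V, Uf a x := sum_reindex_fun ![0, 3, 5, 1, 2, 4] (by decide) (Uf a)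
  have k9 : ∑ x : Fin 6 → V, Ub (a (x 0) (x 4)) (a (x 0) (x 5)) (a (x 4) (x 5)) (a (x 1) (x 2)) (a (x 1) (x 3)) (a (x 2) (x 3))
      = ∑ x : Fin 6 → V, Uf a x := sum_reindex_fun ![0, 4, 5, 1, 2, 3] (by decide) (Uf a)
  rw [k0, k1, k2, k3, k4, k5, k6, k7, k8, k9]
  linarith

def Bf (a : V → V → Bool) (y : Fin 6 → V) : ℤ :=
  bd (a (y 0) (y 1)) (a (y 0) (y 2)) (a (y 1) (y 2))

theorem sum_Bf (a : V → V → Bool) :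
    ∑ x : Fin 6 → V, Bf a x
      = (Fintype.card V : ℤ) ^ 3 * ∑ u, ∑ v, ∑ w, bd (a u v) (a u w) (a v w) := by
  unfold Bf
  rw [sum_six (fun u v w _ _ _ => bd (a u v) (a u w) (a v w))]
  simp only [Finset.sum_const, Finset.card_univ, nsmul_eq_mul, ← Finset.mul_sum]
  ring

theorem sum_BsV (a : V → V → Bool) :
    ∑ x : Fin 6 → V, BsV a x = 20 * ((Fintype.card V : ℤ) ^ 3 * ∑ u, ∑ v, ∑ w, bd (a u v) (a u w) (a v w)) := by
  unfold BsV Bs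
  simp only [Finset.sum_add_distrib]
  rw [← sum_Bf]
  have k0 : ∑ x : Fin 6 → V, bd (a (x 0) (x 1)) (a (x 0) (x 2)) (a (x 1) (x 2))
      = ∑ x : Fin 6 → V, Bf a x := sum_reindex_fun ![0, 1, 2, 3, 4, 5] (by decide) (Bf a)
  have k1 : ∑ x : Fin 6 → V, bd (a (x 0) (x 1)) (a (x 0) (x 3)) (a (x 1) (x 3))
      = ∑ x : Fin 6 → V, Bf a x := sum_reindex_fun ![0, 1, 3, 2, 4, 5] (by decide) (Bf a)
  have k2 : ∑ x : Fin 6 → V, bd (a (x 0) (x 1)) (a (x 0) (x 4)) (a (x 1) (x 4))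
      = ∑ x : Fin 6 → V, Bf a x := sum_reindex_fun ![0, 1, 4, 2, 3, 5] (by decide) (Bf a)
  have k3 : ∑ x : Fin 6 → V, bd (a (x 0) (x 1)) (a (x 0) (x 5)) (a (x 1) (x 5))
      = ∑ x : Fin 6 → V, Bf a x := sum_reindex_fun ![0, 1, 5, 2, 3, 4] (by decide) (Bf a)
  have k4 : ∑ x : Fin 6 → V, bd (a (x 0) (x 2)) (a (x 0) (x 3)) (a (x 2) (x 3))
      = ∑ x : Fin 6 → V, Bf a x := sum_reindex_fun ![0, 2, 3, 1, 4, 5] (by decide) (Bf a)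
  have k5 : ∑ x : Fin 6 → V, bd (a (x 0) (x 2)) (a (x 0) (x 4)) (a (x 2) (x 4))
      = ∑ x : Fin 6 → V, Bf a x := sum_reindex_fun ![0, 2, 4, 1, 3, 5] (by decide) (Bf a)
  have k6 : ∑ x : Fin 6 → V, bd (a (x 0) (x 2)) (a (x 0) (x 5)) (a (x 2) (x 5))
      = ∑ x : Fin 6 → V, Bf a x := sum_reindex_fun ![0, 2, 5, 1, 3, 4] (by decide) (Bf a)
  have k7 : ∑ x : Fin 6 → V, bd (a (x 0) (x 3)) (a (x 0) (x 4)) (a (x 3) (x 4))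
      = ∑ x : Fin 6 → V, Bf a x := sum_reindex_fun ![0, 3, 4, 1, 2, 5] (by decide) (Bf a)
  have k8 : ∑ x : Fin 6 → V, bd (a (x 0) (x 3)) (a (x 0) (x 5)) (a (x 3) (x 5))
      = ∑ x : Fin 6 → V, Bf a x := sum_reindex_fun ![0, 3, 5, 1, 2, 4] (by decide) (Bf a)
  have k9 : ∑ x : Fin 6 → V, bd (a (x 0) (x 4)) (a (x 0) (x 5)) (a (x 4) (x 5))
      = ∑ x : Fin 6 → V, Bf a x := sum_reindex_fun ![0, 4, 5, 1, 2, 3] (by decide) (Bf a)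
  have k10 : ∑ x : Fin 6 → V, bd (a (x 1) (x 2)) (a (x 1) (x 3)) (a (x 2) (x 3))
      = ∑ x : Fin 6 → V, Bf a x := sum_reindex_fun ![1, 2, 3, 0, 4, 5] (by decide) (Bf a)
  have k11 : ∑ x : Fin 6 → V, bd (a (x 1) (x 2)) (a (x 1) (x 4)) (a (x 2) (x 4))
      = ∑ x : Fin 6 → V, Bf a x := sum_reindex_fun ![1, 2, 4, 0, 3, 5] (by decide) (Bf a)
  have k12 : ∑ x : Fin 6 → V, bd (a (x 1) (x 2)) (a (x 1) (x 5)) (a (x 2) (x 5))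
      = ∑ x : Fin 6 → V, Bf a x := sum_reindex_fun ![1, 2, 5, 0, 3, 4] (by decide) (Bf a)
  have k13 : ∑ x : Fin 6 → V, bd (a (x 1) (x 3)) (a (x 1) (x 4)) (a (x 3) (x 4))
      = ∑ x : Fin 6 → V, Bf a x := sum_reindex_fun ![1, 3, 4, 0, 2, 5] (by decide) (Bf a)
  have k14 : ∑ x : Fin 6 → V, bd (a (x 1) (x 3)) (a (x 1) (x 5)) (a (x 3) (x 5))
      = ∑ x : Fin 6 → V, Bf a x := sum_reindex_fun ![1, 3, 5, 0, 2, 4] (by decide) (Bf a)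
  have k15 : ∑ x : Fin 6 → V, bd (a (x 1) (x 4)) (a (x 1) (x 5)) (a (x 4) (x 5))
      = ∑ x : Fin 6 → V, Bf a x := sum_reindex_fun ![1, 4, 5, 0, 2, 3] (by decide) (Bf a)
  have k16 : ∑ x : Fin 6 → V, bd (a (x 2) (x 3)) (a (x 2) (x 4)) (a (x 3) (x 4))
      = ∑ x : Fin 6 → V, Bf a x := sum_reindex_fun ![2, 3, 4, 0, 1, 5] (by decide) (Bf a)
  have k17 : ∑ x : Fin 6 → V, bd (a (x 2) (x 3)) (a (x 2) (x 5)) (a (x 3) (x 5))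
      = ∑ x : Fin 6 → V, Bf a x := sum_reindex_fun ![2, 3, 5, 0, 1, 4] (by decide) (Bf a)
  have k18 : ∑ x : Fin 6 → V, bd (a (x 2) (x 4)) (a (x 2) (x 5)) (a (x 4) (x 5))
      = ∑ x : Fin 6 → V, Bf a x := sum_reindex_fun ![2, 4, 5, 0, 1, 3] (by decide) (Bf a)
  have k19 : ∑ x : Fin 6 → V, bd (a (x 3) (x 4)) (a (x 3) (x 5)) (a (x 4) (x 5))
      = ∑ x : Fin 6 → V, Bf a x := sum_reindex_fun ![3, 4, 5, 0, 1, 2] (by decide) (Bf a)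
  rw [k0, k1, k2, k3, k4, k5, k6, k7, k8, k9, k10, k11, k12, k13, k14, k15, k16, k17, k18, k19]
  ring

/-- The main inequality. -/
theorem core_ineq (a : V → V → Bool) (hs : ∀ u v, a u v = a v u) :
    960000 * (∑ x : Fin 6 → V, if EcV a x = 7 then (1 : ℤ) else 0)
      + 108000 * (Fintype.card V : ℤ) ^ 2 * (∑ u, ∑ v, sg (a u v)) ^ 2
      + 20 * ((Fintype.card V : ℤ) ^ 3 * ∑ u, ∑ v, ∑ w, bd (a u v) (a u w) (a v w))
      ≤ 450000 * (Fintype.card V : ℤ) ^ 6 := by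
  have h1 : ∀ x : Fin 6 → V, 960000 * (if EcV a x = 7 then (1 : ℤ) else 0) + (TsV a x + (UsV a x + BsV a x))
      ≤ 450000 := by
    intro x
    have h := Rb_nonneg (a (x 0) (x 1)) (a (x 0) (x 2)) (a (x 0) (x 3)) (a (x 0) (x 4)) (a (x 1) (x 2)) (a (x 1) (x 3)) (a (x 1) (x 4)) (a (x 2) (x 3)) (a (x 2) (x 4)) (a (x 3) (x 4)) (a (x 0) (x 5)) (a (x 1) (x 5)) (a (x 2) (x 5)) (a (x 3) (x 5)) (a (x 4) (x 5))
    unfold Rb at h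
    change 0 ≤ (bif Nat.beq (EcV a x) 7 then _ else _) - (TsV a x + (UsV a x + BsV a x)) at h
    by_cases h7 : EcV a x = 7
    · rw [h7] at h
      simp only [h7, if_true]
      change 0 ≤ (-510000 : ℤ) - _ at h
      linarith
    · have : Nat.beq (EcV a x) 7 = false := by
        rw [← Bool.not_eq_true, Nat.beq_eq]
        exact h7
      rw [this] at h
      simp only [h7, if_false]
      change 0 ≤ (450000 : ℤ) - _ at h
      linarith
  have h2 := Finset.sum_le_sum fun (x : Fin 6 → V) (_ : x ∈ Finset.univ) => h1 x
  simp only [Finset.sum_add_distrib, ← Finset.mul_sum, Finset.sum_const, Finset.card_univ,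
    Fintype.card_fun, Fintype.card_fin, nsmul_eq_mul] at h2
  rw [sum_BsV] at h2
  have h3 := sum_TsV_nonneg a hs
  have h4 := sum_UsV a
  push_cast at h2
  linarith

end CoreIneq

noncomputable def adjB {n : ℕ} (G : SimpleGraph (Fin n)) (u v : Fin n) : Bool := decide (G.Adj u v)

theorem adjB_symm {n : ℕ} (G : SimpleGraph (Fin n)) (u v : Fin n) : adjB G u v = adjB G v u := by
  unfold adjB
  simp only [G.adj_comm]

theorem adjB_self {n : ℕ} (G : SimpleGraph (Fin n)) (u : Fin n) : adjB G u u = false := by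
  simp [adjB]

theorem two_Ec {V : Type} (a : V → V → Bool) (hs : ∀ u v, a u v = a v u) (h0 : ∀ u, a u u = false)
    (x : Fin 6 → V) : ∑ i, ∑ j, b2n (a (x i) (x j)) = 2 * EcV a x := by
  have hz : b2n false = 0 := rfl
  simp only [Fin.sum_univ_six, h0, hz]
  rw [hs (x 1) (x 0), hs (x 2) (x 0), hs (x 2) (x 1), hs (x 3) (x 0), hs (x 3) (x 1), hs (x 3) (x 2),
    hs (x 4) (x 0), hs (x 4) (x 1), hs (x 4) (x 2), hs (x 4) (x 3),
    hs (x 5) (x 0), hs (x 5) (x 1), hs (x 5) (x 2), hs (x 5) (x 3), hs (x 5) (x 4)]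
  unfold EcV Ec
  ring

theorem EcV_perm {V : Type} (a : V → V → Bool) (hs : ∀ u v, a u v = a v u) (h0 : ∀ u, a u u = false)
    (x : Fin 6 → V) (e : Equiv.Perm (Fin 6)) : EcV a (fun i => x (e i)) = EcV a x := by
  have h1 := two_Ec a hs h0 x
  have h2 := two_Ec a hs h0 (fun i => x (e i))
  have h3 : ∑ i, ∑ j, b2n (a (x (e i)) (x (e j))) = ∑ i, ∑ j, b2n (a (x i) (x j)) := by
    rw [← Equiv.sum_comp e (fun i => ∑ j, b2n (a (x i) (x j)))]
    refine Finset.sum_congr rfl fun i _ => ?_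
    exact Equiv.sum_comp e (fun j => b2n (a (x (e i)) (x j)))
  omega

theorem two_edgeCount {n : ℕ} (G : SimpleGraph (Fin n)) (S : Finset (Fin n)) :
    ∑ p ∈ S, ∑ q ∈ S, b2n (adjB G p q) = 2 * edgeCount G S := by
  have h1 : ∑ p ∈ S, ∑ q ∈ S, b2n (adjB G p q)
      = ((Finset.univ : Finset (Fin n × Fin n)).filter
        (fun p => p.1 ∈ S ∧ p.2 ∈ S ∧ G.Adj p.1 p.2)).card := by
    rw [← Finset.sum_product', Finset.card_filter]
    rw [← Finset.sum_filter_add_sum_filter_not (Finset.univ : Finset (Fin n × Fin n)) (fun p => p ∈ S ×ˢ S)]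
    have : ∑ x ∈ (Finset.univ : Finset (Fin n × Fin n)).filter (fun p => p ∉ S ×ˢ S),
        (if x.1 ∈ S ∧ x.2 ∈ S ∧ G.Adj x.1 x.2 then 1 else 0) = 0 := by
      refine Finset.sum_eq_zero fun x hx => ?_
      simp only [Finset.mem_filter, Finset.mem_univ, true_and, Finset.mem_product] at hx
      rw [if_neg]
      tauto
    rw [this, add_zero]
    refine Finset.sum_congr (by ext; simp) fun x hx => ?_
    rw [Finset.mem_filter, Finset.mem_product] at hx
    simp [hx.2.1, hx.2.2, adjB, b2n]
  have h2 : ((Finset.univ : Finset (Fin n × Fin n)).filter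
        (fun p => p.1 ∈ S ∧ p.2 ∈ S ∧ G.Adj p.1 p.2))
      = (Finset.univ.filter (fun p : Fin n × Fin n =>
          p.1 ∈ S ∧ p.2 ∈ S ∧ p.1 < p.2 ∧ G.Adj p.1 p.2)) ∪
        (Finset.univ.filter (fun p : Fin n × Fin n =>
          p.1 ∈ S ∧ p.2 ∈ S ∧ p.2 < p.1 ∧ G.Adj p.1 p.2)) := by
    ext ⟨p, q⟩
    simp only [Finset.mem_filter, Finset.mem_univ, true_and, Finset.mem_union]
    constructor
    · rintro ⟨h1, h2, h3⟩
      rcases lt_trichotomy p q with h | h | h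
      · exact Or.inl ⟨h1, h2, h, h3⟩
      · exact absurd h (G.ne_of_adj h3)
      · exact Or.inr ⟨h1, h2, h, h3⟩
    · rintro (h | h) <;> tauto
  have h3 : (Finset.univ.filter (fun p : Fin n × Fin n =>
          p.1 ∈ S ∧ p.2 ∈ S ∧ p.2 < p.1 ∧ G.Adj p.1 p.2)).card = edgeCount G S := by
    unfold edgeCount
    refine Finset.card_bij (fun p _ => (p.2, p.1)) ?_ ?_ ?_
    · rintro ⟨p, q⟩ h
      simp only [Finset.mem_filter, Finset.mem_univ, true_and] at h ⊢
      exact ⟨h.2.1, h.1, h.2.2.1, h.2.2.2.symm⟩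
    · rintro ⟨p, q⟩ _ ⟨p', q'⟩ _ h
      simp only [Prod.mk.injEq] at h ⊢
      tauto
    · rintro ⟨p, q⟩ h
      simp only [Finset.mem_filter, Finset.mem_univ, true_and] at h
      refine ⟨(q, p), ?_, rfl⟩
      simp only [Finset.mem_filter, Finset.mem_univ, true_and]
      exact ⟨h.2.1, h.1, h.2.2.1, h.2.2.2.symm⟩
  rw [h1, h2, Finset.card_union_of_disjoint, h3]
  · unfold edgeCount
    ring
  · rw [Finset.disjoint_left]
    rintro ⟨p, q⟩ h h'
    simp only [Finset.mem_filter, Finset.mem_univ, true_and] at h h'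
    exact absurd h.2.2.1 (not_lt.mpr h'.2.2.1.le)

theorem edgeCount_image {n : ℕ} (G : SimpleGraph (Fin n)) (x : Fin 6 → Fin n)
    (hx : Function.Injective x) : edgeCount G (Finset.univ.image x) = EcV (adjB G) x := by
  have h1 := two_edgeCount G (Finset.univ.image x)
  have h2 := two_Ec (adjB G) (adjB_symm G) (adjB_self G) x
  rw [Finset.sum_image (fun a _ b _ h => hx h)] at h1
  simp only [Finset.sum_image (fun a _ b _ h => hx h)] at h1
  omega

theorem card_inj_into {n : ℕ} (S : Finset (Fin n)) (hS : S.card = 6) :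
    ((Finset.univ : Finset (Fin 6 → Fin n)).filter
      (fun x => Function.Injective x ∧ Finset.univ.image x = S)).card = 720 := by
  have h : Fintype.card (Fin 6 ↪ S) = 720 := by
    rw [Fintype.card_embedding_eq]
    simp [hS]
  rw [← h, ← Finset.card_univ]
  symm
  refine Finset.card_bij (fun f _ i => (f i : Fin n)) ?_ ?_ ?_
  · intro f _
    have hi : Function.Injective (fun i => (f i : Fin n)) := fun i j hij => f.injective (Subtype.ext hij)
    simp only [Finset.mem_filter, Finset.mem_univ, true_and]
    refine ⟨hi, Finset.eq_of_subset_of_card_le ?_ ?_⟩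
    · intro u hu
      rw [Finset.mem_image] at hu
      obtain ⟨i, _, rfl⟩ := hu
      exact (f i).2
    · rw [Finset.card_image_of_injective _ hi, hS]
      simp
  · intro f _ g _ h
    ext i
    exact congrArg Fin.val (congrFun h i)
  · intro x hx
    simp only [Finset.mem_filter, Finset.mem_univ, true_and] at hx
    refine ⟨⟨fun i => ⟨x i, ?_⟩, ?_⟩, Finset.mem_univ _, rfl⟩
    · rw [← hx.2]
      exact Finset.mem_image_of_mem _ (Finset.mem_univ _)
    · intro i j hij
      exact hx.1 (congrArg Subtype.val hij)

/-- Counting over sets is counting over injective tuples. -/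
theorem card_sets_tuples {n : ℕ} (P : Finset (Fin n) → Prop) [DecidablePred P] :
    720 * ((Finset.powersetCard 6 Finset.univ).filter P).card
      = ((Finset.univ : Finset (Fin 6 → Fin n)).filter
        (fun x => Function.Injective x ∧ P (Finset.univ.image x))).card := by
  rw [Finset.card_eq_sum_card_fiberwise (f := fun x : Fin 6 → Fin n => Finset.univ.image x)
    (t := (Finset.powersetCard 6 Finset.univ).filter P)]
  · rw [mul_comm, ← smul_eq_mul, ← Finset.sum_const]
    refine Finset.sum_congr rfl fun S hS => ?_
    rw [Finset.mem_filter, Finset.mem_powersetCard] at hS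
    rw [← card_inj_into S hS.1.2, Finset.filter_filter]
    congr 1
    ext x
    simp only [Finset.mem_filter, Finset.mem_univ, true_and]
    constructor
    · rintro ⟨h1, h2⟩
      exact ⟨⟨h1, h2 ▸ hS.2⟩, h2⟩
    · rintro ⟨h1, h2⟩
      exact ⟨h1.1, h2⟩
  · intro x hx
    simp only [Finset.coe_filter, Finset.mem_univ, true_and, Set.mem_ofPred_eq] at hx
    simp only [Finset.coe_filter, Set.mem_ofPred_eq, Finset.mem_powersetCard]
    refine ⟨⟨Finset.subset_univ _, ?_⟩, hx.2⟩
    rw [Finset.card_image_of_injective _ hx.1]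
    simp

theorem numKL_tuples {n : ℕ} (G : SimpleGraph (Fin n)) :
    720 * numKL 6 7 G = ((Finset.univ : Finset (Fin 6 → Fin n)).filter
        (fun x => Function.Injective x ∧ EcV (adjB G) x = 7)).card := by
  unfold numKL
  rw [card_sets_tuples]
  congr 1
  ext x
  simp only [Finset.mem_filter, Finset.mem_univ, true_and]
  constructor
  · rintro ⟨h1, h2⟩
    exact ⟨h1, by rw [← edgeCount_image G x h1]; exact h2⟩
  · rintro ⟨h1, h2⟩
    exact ⟨h1, by rw [edgeCount_image G x h1]; exact h2⟩

def twoCl {n : ℕ} (c : Fin n → Fin 2) : SimpleGraph (Fin n) where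
  Adj u v := u ≠ v ∧ c u = c v
  symm := ⟨fun _ _ h => ⟨h.1.symm, h.2.symm⟩⟩
  loopless := ⟨fun _ h => h.1 rfl⟩

theorem twoCl_isTwo {n : ℕ} (c : Fin n → Fin 2) : isTwoCliques (twoCl c) :=
  ⟨c, fun _ _ => Iff.rfl⟩

/-- Edge count of the two-clique pattern. -/
def eq2 (u v : Fin 2) : Bool := u.val == v.val

theorem EcV_twoCl {n : ℕ} (c : Fin n → Fin 2) (x : Fin 6 → Fin n) (hx : Function.Injective x) :
    EcV (adjB (twoCl c)) x = EcV eq2 (fun i => c (x i)) := by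
  have h : ∀ i j : Fin 6, i ≠ j → adjB (twoCl c) (x i) (x j) = eq2 (c (x i)) (c (x j)) := by
    intro i j hij
    have : x i ≠ x j := fun h => hij (hx h)
    have h2 : adjB (twoCl c) (x i) (x j) = decide (c (x i) = c (x j)) := by
      unfold adjB
      congr 1
      exact propext ⟨fun h => h.2, fun h => ⟨this, h⟩⟩
    rw [h2, Bool.eq_iff_iff, decide_eq_true_iff, eq2, beq_iff_eq, Fin.ext_iff]
  unfold EcV
  rw [h 0 1 (by decide), h 0 2 (by decide), h 0 3 (by decide), h 0 4 (by decide), h 0 5 (by decide),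
    h 1 2 (by decide), h 1 3 (by decide), h 1 4 (by decide), h 1 5 (by decide), h 2 3 (by decide),
    h 2 4 (by decide), h 2 5 (by decide), h 3 4 (by decide), h 3 5 (by decide), h 4 5 (by decide)]

theorem count_pattern : (∑ d : Fin 6 → Fin 2, if EcV eq2 d = 7 then 1 else 0) = 30 := by
  decide +kernel

theorem count_col {n : ℕ} (x : Fin 6 → Fin n) (hx : Function.Injective x) :
    64 * (∑ c : Fin n → Fin 2, if EcV eq2 (fun i => c (x i)) = 7 then 1 else 0) = 2 ^ n * 30 := by
  have h1 : ∀ d : Fin 6 → Fin 2,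
      (∑ c : Fin n → Fin 2, if EcV eq2 (fun i => c (x i) + d i) = 7 then 1 else 0)
      = ∑ c : Fin n → Fin 2, if EcV eq2 (fun i => c (x i)) = 7 then 1 else 0 := by
    intro d
    rw [← Equiv.sum_comp (Equiv.addRight (Function.extend x d 0))
      (fun c : Fin n → Fin 2 => if EcV eq2 (fun i => c (x i)) = 7 then 1 else 0)]
    refine Finset.sum_congr rfl fun c _ => ?_
    simp [hx.extend_apply]
  have h2 : ∀ c : Fin n → Fin 2,
      (∑ d : Fin 6 → Fin 2, if EcV eq2 (fun i => c (x i) + d i) = 7 then 1 else 0) = 30 := by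
    intro c
    rw [← count_pattern]
    exact Equiv.sum_comp (Equiv.addLeft (fun i => c (x i)))
      (fun d : Fin 6 → Fin 2 => if EcV eq2 d = 7 then 1 else 0)
  have h3 := Finset.sum_comm (s := (Finset.univ : Finset (Fin 6 → Fin 2)))
    (t := (Finset.univ : Finset (Fin n → Fin 2)))
    (f := fun d c => if EcV eq2 (fun i => c (x i) + d i) = 7 then 1 else 0)
  simp only [h1, h2, Finset.sum_const, Finset.card_univ, Fintype.card_fun, Fintype.card_fin,
    smul_eq_mul] at h3
  exact h3

theorem card_inj_tuples (n : ℕ) :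
    ((Finset.univ : Finset (Fin 6 → Fin n)).filter (fun x => Function.Injective x)).card
      = 720 * n.choose 6 := by
  have h := card_sets_tuples (n := n) (fun _ => True)
  simp only [and_true, Finset.filter_true, Finset.card_powersetCard, Finset.card_univ,
    Fintype.card_fin] at h
  exact h.symm

theorem exists_good (n : ℕ) : ∃ c : Fin n → Fin 2, 15 * n.choose 6 ≤ 32 * numKL 6 7 (twoCl c) := by
  by_contra hcon
  push Not at hcon
  have h1 : ∑ c : Fin n → Fin 2, 720 * numKL 6 7 (twoCl c)
      = ∑ x ∈ (Finset.univ : Finset (Fin 6 → Fin n)).filter (fun x => Function.Injective x),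
        ∑ c : Fin n → Fin 2, if EcV eq2 (fun i => c (x i)) = 7 then 1 else 0 := by
    rw [Finset.sum_comm]
    refine Finset.sum_congr rfl fun c _ => ?_
    rw [numKL_tuples, ← Finset.filter_filter, Finset.card_filter]
    refine Finset.sum_congr rfl fun x hx => ?_
    rw [Finset.mem_filter] at hx
    rw [EcV_twoCl c x hx.2]
  have h2 : 64 * ∑ c : Fin n → Fin 2, 720 * numKL 6 7 (twoCl c) = 720 * n.choose 6 * (2 ^ n * 30) := by
    rw [h1, Finset.mul_sum, ← card_inj_tuples, ← smul_eq_mul, ← Finset.sum_const]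
    refine Finset.sum_congr rfl fun x hx => ?_
    rw [Finset.mem_filter] at hx
    exact count_col x hx.2
  have h3 : ∑ c : Fin n → Fin 2, 32 * numKL 6 7 (twoCl c) < ∑ c : Fin n → Fin 2, 15 * n.choose 6 :=
    Finset.sum_lt_sum_of_nonempty Finset.univ_nonempty fun c _ => hcon c
  simp only [← Finset.mul_sum, Finset.sum_const, Finset.card_univ, Fintype.card_fun,
    Fintype.card_fin, smul_eq_mul] at h2 h3
  nlinarith

theorem lamKL_le_max {n : ℕ} (G : SimpleGraph (Fin n)) : lamKL 6 7 G ≤ lamKLmax 6 7 n :=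
  le_ciSup (f := fun G : SimpleGraph (Fin n) => lamKL 6 7 G) (Set.finite_range _).bddAbove G

theorem lamKLmax_ge (n : ℕ) (hn : 6 ≤ n) : 15 / 32 ≤ lamKLmax 6 7 n := by
  obtain ⟨c, hc⟩ := exists_good n
  refine le_trans ?_ (lamKL_le_max (twoCl c))
  unfold lamKL
  have hp : (0 : ℝ) < n.choose 6 := by exact_mod_cast Nat.choose_pos hn
  rw [le_div_iff₀ hp]
  have : (15 : ℝ) * n.choose 6 ≤ 32 * numKL 6 7 (twoCl c) := by exact_mod_cast hc
  linarith

theorem desc_formula (n : ℕ) (hn : 6 ≤ n) : (720 : ℝ) * n.choose 6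
    = n * (n - 1) * (n - 2) * (n - 3) * (n - 4) * (n - 5) := by
  have h := Nat.descFactorial_eq_factorial_mul_choose n 6
  have h6 : Nat.factorial 6 = 720 := rfl
  rw [h6] at h
  have h' : ((n.descFactorial 6 : ℕ) : ℝ) = 720 * n.choose 6 := by rw [h]; push_cast; ring
  rw [← h']
  simp only [Nat.descFactorial, Nat.sub_zero]
  push_cast [Nat.cast_sub (show 5 ≤ n by omega), Nat.cast_sub (show 4 ≤ n by omega),
    Nat.cast_sub (show 3 ≤ n by omega), Nat.cast_sub (show 2 ≤ n by omega),
    Nat.cast_sub (show 1 ≤ n by omega)]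
  ring

theorem desc_lower (n : ℕ) (hn : 6 ≤ n) : (n : ℝ) ^ 6 - 15 * (n : ℝ) ^ 5 ≤ 720 * n.choose 6 := by
  rw [desc_formula n hn]
  have h : (6 : ℝ) ≤ n := by exact_mod_cast hn
  obtain ⟨t, ht⟩ : ∃ t : ℝ, (n : ℝ) = 6 + t := ⟨n - 6, by ring⟩
  have ht0 : 0 ≤ t := by linarith
  rw [ht]
  have : 0 ≤ 85 * (6 + t) ^ 4 - 225 * (6 + t) ^ 3 + 274 * (6 + t) ^ 2 - 120 * (6 + t) := by
    ring_nf
    positivity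
  nlinarith

theorem desc_upper (n : ℕ) (hn : 6 ≤ n) : 720 * (n.choose 6 : ℝ) ≤ (n : ℝ) ^ 6 := by
  rw [desc_formula n hn]
  have h : (6 : ℝ) ≤ n := by exact_mod_cast hn
  calc (n : ℝ) * (n - 1) * (n - 2) * (n - 3) * (n - 4) * (n - 5)
      ≤ n * n * n * n * n * n := by
        gcongr <;> linarith
    _ = (n : ℝ) ^ 6 := by ring

/-- Core inequality in terms of the number of induced subgraphs. -/
theorem core_num {n : ℕ} (G : SimpleGraph (Fin n)) :
    960000 * (720 * (numKL 6 7 G : ℤ))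
      + 108000 * (n : ℤ) ^ 2 * (∑ u, ∑ v, sg (adjB G u v)) ^ 2
      + 20 * ((n : ℤ) ^ 3 * ∑ u, ∑ v, ∑ w, bd (adjB G u v) (adjB G u w) (adjB G v w))
      ≤ 450000 * (n : ℤ) ^ 6 := by
  have h := core_ineq (adjB G) (adjB_symm G)
  rw [Fintype.card_fin] at h
  have h2 : 720 * (numKL 6 7 G : ℤ) ≤ ∑ x : Fin 6 → Fin n, if EcV (adjB G) x = 7 then (1 : ℤ) else 0 := by
    have := numKL_tuples G
    have h3 : ((720 * numKL 6 7 G : ℕ) : ℤ) = 720 * (numKL 6 7 G : ℤ) := by push_cast; ring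
    rw [← h3, this, Finset.sum_boole]
    exact_mod_cast Finset.card_le_card (fun x hx => by
      simp only [Finset.mem_filter, Finset.mem_univ, true_and] at hx ⊢
      exact hx.2)
  linarith

theorem bd_nonneg (p q r : Bool) : 0 ≤ bd p q r := by
  cases p <;> cases q <;> cases r <;> decide

theorem lamKLmax_le (n : ℕ) (hn : 16 ≤ n) : lamKLmax 6 7 n ≤ 15 / 32 / (1 - 15 / (n : ℝ)) := by
  have hn' : (16 : ℝ) ≤ n := by exact_mod_cast hn
  refine ciSup_le fun G => ?_
  unfold lamKL
  have hp : (0 : ℝ) < n.choose 6 := by exact_mod_cast Nat.choose_pos (by omega : 6 ≤ n)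
  have hd : (0 : ℝ) < 1 - 15 / (n : ℝ) := by
    rw [sub_pos, div_lt_one (by linarith)]
    linarith
  rw [div_le_div_iff₀ hp hd]
  have h := core_num G
  have h1 : 0 ≤ 108000 * (n : ℤ) ^ 2 * (∑ u, ∑ v, sg (adjB G u v)) ^ 2 := by positivity
  have h2 : 0 ≤ 20 * ((n : ℤ) ^ 3 * ∑ u, ∑ v, ∑ w, bd (adjB G u v) (adjB G u w) (adjB G v w)) := by
    have : 0 ≤ ∑ u, ∑ v, ∑ w, bd (adjB G u v) (adjB G u w) (adjB G v w) :=
      Finset.sum_nonneg fun _ _ => Finset.sum_nonneg fun _ _ => Finset.sum_nonneg fun _ _ => bd_nonneg _ _ _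
    positivity
  have h3 : 960000 * (720 * (numKL 6 7 G : ℤ)) ≤ 450000 * (n : ℤ) ^ 6 := by linarith
  have h4 : 960000 * (720 * (numKL 6 7 G : ℝ)) ≤ 450000 * (n : ℝ) ^ 6 := by exact_mod_cast h3
  have h5 := desc_lower n (by omega)
  have h6 : (n : ℝ) ^ 6 * (1 - 15 / n) = (n : ℝ) ^ 6 - 15 * (n : ℝ) ^ 5 := by
    field_simp
  calc (numKL 6 7 G : ℝ) * (1 - 15 / n) ≤ (15 / 32 * (n : ℝ) ^ 6 / 720) * (1 - 15 / n) := by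
        gcongr
        linarith
    _ = 15 / 32 / 720 * ((n : ℝ) ^ 6 * (1 - 15 / n)) := by ring
    _ ≤ 15 / 32 * n.choose 6 := by rw [h6]; linarith

theorem limit_part : Filter.Tendsto (fun n => lamKLmax 6 7 n) Filter.atTop (nhds (15/32)) := by
  have h : Filter.Tendsto (fun n : ℕ => 15 / 32 / (1 - 15 / (n : ℝ))) Filter.atTop (nhds (15/32)) := by
    have h1 : Filter.Tendsto (fun n : ℕ => 15 / (n : ℝ)) Filter.atTop (nhds 0) :=
      tendsto_const_div_atTop_nhds_zero_nat 15
    have h2 := (tendsto_const_nhds (x := (15/32 : ℝ))).div ((tendsto_const_nhds (x := (1:ℝ))).sub h1)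
      (by norm_num)
    rw [sub_zero, div_one] at h2
    exact h2
  refine tendsto_of_tendsto_of_tendsto_of_le_of_le' tendsto_const_nhds h ?_ ?_
  · filter_upwards [Filter.eventually_ge_atTop 6] with n hn using lamKLmax_ge n hn
  · filter_upwards [Filter.eventually_ge_atTop 16] with n hn using lamKLmax_le n hn

/-- The graph obtained by making the adjacencies of `v` agree with the colouring. -/
def fixV {n : ℕ} (G : SimpleGraph (Fin n)) (c : Fin n → Fin 2) (v : Fin n) : SimpleGraph (Fin n) where
  Adj u x := (u = v ∨ x = v) ∧ u ≠ x ∧ c u = c x ∨ ¬ (u = v ∨ x = v) ∧ G.Adj u x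
  symm := ⟨fun u x h => by
    rcases h with ⟨h1, h2, h3⟩ | ⟨h1, h2⟩
    · exact Or.inl ⟨h1.symm, h2.symm, h3.symm⟩
    · exact Or.inr ⟨fun h => h1 h.symm, h2.symm⟩⟩
  loopless := ⟨fun u h => by
    rcases h with ⟨_, h2, _⟩ | ⟨_, h2⟩
    · exact h2 rfl
    · exact G.loopless.irrefl u h2⟩

theorem eq2_iff (a b : Fin 2) : eq2 a b = true ↔ a = b := by
  rw [eq2, beq_iff_eq, Fin.ext_iff]

theorem eq2_eq (a b : Fin 2) : eq2 a b = decide (a = b) := by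
  rw [Bool.eq_iff_iff, eq2_iff, decide_eq_true_iff]

theorem eq2_comm (a b : Fin 2) : eq2 a b = eq2 b a := by
  revert a b; decide

theorem eq2_tri (e a b : Fin 2) : eq2 a b = (eq2 e a == eq2 e b) := by
  revert e a b; decide

theorem adjB_fix_left {n : ℕ} (G : SimpleGraph (Fin n)) (c : Fin n → Fin 2) (v u : Fin n) (h : v ≠ u) :
    adjB (fixV G c v) v u = eq2 (c v) (c u) := by
  rw [eq2_eq]
  unfold adjB
  congr 1
  simp [fixV, h]

theorem adjB_fix_other {n : ℕ} (G : SimpleGraph (Fin n)) (c : Fin n → Fin 2) (v u x : Fin n) (hu : u ≠ v)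
    (hx : x ≠ v) : adjB (fixV G c v) u x = adjB G u x := by
  unfold adjB
  congr 1
  simp [fixV, hu, hx]

/-- Pairs whose adjacency disagrees with the colouring. -/
def Wr {n : ℕ} (G : SimpleGraph (Fin n)) (c : Fin n → Fin 2) (u x : Fin n) : Prop :=
  u ≠ x ∧ adjB G u x ≠ eq2 (c u) (c x)

noncomputable def wr {n : ℕ} (G : SimpleGraph (Fin n)) (c : Fin n → Fin 2) (u x : Fin n) : ℤ :=
  if Wr G c u x then 1 else 0

theorem Wr_symm {n : ℕ} (G : SimpleGraph (Fin n)) (c : Fin n → Fin 2) (u x : Fin n) :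
    Wr G c u x ↔ Wr G c x u := by
  unfold Wr
  rw [adjB_symm G u x, eq2_comm (c u), ne_comm]

theorem wr_symm {n : ℕ} (G : SimpleGraph (Fin n)) (c : Fin n → Fin 2) (u x : Fin n) :
    wr G c u x = wr G c x u := by
  unfold wr
  rw [Wr_symm]

theorem wr_nonneg {n : ℕ} (G : SimpleGraph (Fin n)) (c : Fin n → Fin 2) (u x : Fin n) :
    0 ≤ wr G c u x := by
  unfold wr; split_ifs <;> norm_num

theorem wr_self {n : ℕ} (G : SimpleGraph (Fin n)) (c : Fin n → Fin 2) (u : Fin n) :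
    wr G c u u = 0 := by
  unfold wr Wr; simp

/-- Signed change of the indicator on injective tuples. -/
noncomputable def Dx {n : ℕ} (G G' : SimpleGraph (Fin n)) (x : Fin 6 → Fin n) : ℤ :=
  if Function.Injective x then
    (if EcV (adjB G') x = 7 then 1 else 0) - (if EcV (adjB G) x = 7 then 1 else 0) else 0

theorem numKL_sum {n : ℕ} (G : SimpleGraph (Fin n)) :
    720 * (numKL 6 7 G : ℤ) = ∑ x : Fin 6 → Fin n,
      if Function.Injective x then (if EcV (adjB G) x = 7 then (1 : ℤ) else 0) else 0 := by
  have := numKL_tuples G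
  have h3 : ((720 * numKL 6 7 G : ℕ) : ℤ) = 720 * (numKL 6 7 G : ℤ) := by push_cast; ring
  rw [← h3, this, Finset.card_filter]
  push_cast
  refine Finset.sum_congr rfl fun x _ => ?_
  by_cases h1 : Function.Injective x <;> by_cases h2 : EcV (adjB G) x = 7 <;> simp [h1, h2]

theorem diff_sum {n : ℕ} (G G' : SimpleGraph (Fin n)) :
    720 * (numKL 6 7 G' : ℤ) - 720 * (numKL 6 7 G : ℤ) = ∑ x : Fin 6 → Fin n, Dx G G' x := by
  rw [numKL_sum, numKL_sum, ← Finset.sum_sub_distrib]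
  refine Finset.sum_congr rfl fun x _ => ?_
  unfold Dx
  split_ifs <;> simp

theorem Dx_perm {n : ℕ} (G G' : SimpleGraph (Fin n)) (x : Fin 6 → Fin n) (e : Equiv.Perm (Fin 6)) :
    Dx G G' (fun i => x (e i)) = Dx G G' x := by
  unfold Dx
  rw [EcV_perm _ (adjB_symm G) (adjB_self G), EcV_perm _ (adjB_symm G') (adjB_self G')]
  have : Function.Injective (fun i => x (e i)) ↔ Function.Injective x := by
    constructor
    · intro h i j hij
      have := h (a₁ := e.symm i) (a₂ := e.symm j) (by simpa using hij)
      simpa using this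
    · exact fun h => h.comp e.injective
  simp only [this]

theorem EcV_congr {V : Type} (a b : V → V → Bool) (x : Fin 6 → V)
    (h : ∀ i j : Fin 6, i < j → a (x i) (x j) = b (x i) (x j)) : EcV a x = EcV b x := by
  unfold EcV
  rw [h 0 1 (by decide), h 0 2 (by decide), h 0 3 (by decide), h 0 4 (by decide), h 0 5 (by decide),
    h 1 2 (by decide), h 1 3 (by decide), h 1 4 (by decide), h 1 5 (by decide), h 2 3 (by decide),
    h 2 4 (by decide), h 2 5 (by decide), h 3 4 (by decide), h 3 5 (by decide), h 4 5 (by decide)]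

theorem Dx_eq_zero_of_notMem {n : ℕ} (G : SimpleGraph (Fin n)) (c : Fin n → Fin 2) (v : Fin n)
    (x : Fin 6 → Fin n) (h : ∀ i, x i ≠ v) : Dx G (fixV G c v) x = 0 := by
  unfold Dx
  rw [EcV_congr (adjB (fixV G c v)) (adjB G) x fun i j _ => adjB_fix_other G c v _ _ (h i) (h j)]
  simp

theorem diff_fix {n : ℕ} (G : SimpleGraph (Fin n)) (c : Fin n → Fin 2) (v : Fin n) :
    120 * (numKL 6 7 (fixV G c v) : ℤ) - 120 * (numKL 6 7 G : ℤ)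
      = ∑ y : Fin 5 → Fin n, Dx G (fixV G c v) (Fin.cons v y) := by
  have h := diff_sum G (fixV G c v)
  have h1 : ∀ x : Fin 6 → Fin n, Dx G (fixV G c v) x
      = ∑ i : Fin 6, if x i = v then Dx G (fixV G c v) x else 0 := by
    intro x
    by_cases hi : Function.Injective x
    · by_cases hv : ∃ i, x i = v
      · obtain ⟨i, hi'⟩ := hv
        rw [Finset.sum_eq_single i]
        · rw [if_pos hi']
        · intro j _ hj
          rw [if_neg]
          exact fun h => hj (hi (h.trans hi'.symm))
        · intro h
          exact absurd (Finset.mem_univ i) h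
      · push Not at hv
        rw [Dx_eq_zero_of_notMem G c v x hv]
        simp
    · have : Dx G (fixV G c v) x = 0 := by
        unfold Dx
        rw [if_neg hi]
      rw [this]
      simp
  have h2 : ∀ i : Fin 6, (∑ x : Fin 6 → Fin n, if x i = v then Dx G (fixV G c v) x else 0)
      = ∑ y : Fin 5 → Fin n, Dx G (fixV G c v) (Fin.cons v y) := by
    intro i
    have h3 := sum_reindex (Equiv.swap 0 i) (fun x : Fin 6 → Fin n => if x i = v then Dx G (fixV G c v) x else 0)
    rw [← h3]
    simp only [Equiv.swap_apply_right, Dx_perm]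
    rw [sumTupleCons]
    rw [Finset.sum_eq_single v]
    · simp
    · intro u _ hu
      refine Finset.sum_eq_zero fun y _ => ?_
      rw [Fin.cons_zero, if_neg hu]
    · intro h
      exact absurd (Finset.mem_univ v) h
  rw [Finset.sum_congr rfl fun x _ => h1 x, Finset.sum_comm, Finset.sum_congr rfl fun i _ => h2 i] at h
  simp only [Finset.sum_const, Finset.card_univ, Fintype.card_fin] at h
  rw [nsmul_eq_mul] at h
  push_cast at h
  linarith

def g5 (p s : Fin 5 → Bool) : ℕ :=
  Ec (p 0) (p 1) (p 2) (p 3) (s 0 == s 1) (s 0 == s 2) (s 0 == s 3) (s 1 == s 2) (s 1 == s 3) (s 2 == s 3)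
    (p 4) (s 0 == s 4) (s 1 == s 4) (s 2 == s 4) (s 3 == s 4)

def D0 (p s : Fin 5 → Bool) : ℤ := (if g5 s s = 7 then 1 else 0) - (if g5 p s = 7 then 1 else 0)

theorem D0_le (p s : Fin 5 → Bool) : D0 p s ≤ 1 := by
  unfold D0; split_ifs <;> norm_num

theorem Dx_ge {n : ℕ} (G G' : SimpleGraph (Fin n)) (x : Fin 6 → Fin n) : -1 ≤ Dx G G' x := by
  unfold Dx; split_ifs <;> norm_num

/-- Adjacency to `v`, where `v` counts as adjacent to itself. -/
noncomputable def aV {n : ℕ} (G : SimpleGraph (Fin n)) (v u : Fin n) : Bool := adjB G v u || decide (u = v)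

def sV {n : ℕ} (c : Fin n → Fin 2) (v u : Fin n) : Bool := eq2 (c v) (c u)

theorem aV_eq_sV {n : ℕ} (G : SimpleGraph (Fin n)) (c : Fin n → Fin 2) (v u : Fin n)
    (h : wr G c v u = 0) : aV G v u = sV c v u := by
  unfold aV sV
  by_cases huv : u = v
  · subst huv
    simp only [decide_true, Bool.or_true]
    rw [eq_comm, eq2_iff]
  · have h1 : ¬ Wr G c v u := by
      intro h2
      simp [wr, h2] at h
    have h3 : adjB G v u = eq2 (c v) (c u) := by
      by_contra h4
      exact h1 ⟨fun h => huv h.symm, h4⟩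
    simp [huv, h3]

noncomputable def zc {n : ℕ} (G : SimpleGraph (Fin n)) (c : Fin n → Fin 2) (u x : Fin n) : ℤ :=
  wr G c u x + if u = x then 1 else 0

theorem zc_nonneg {n : ℕ} (G : SimpleGraph (Fin n)) (c : Fin n → Fin 2) (u x : Fin n) :
    0 ≤ zc G c u x := by
  unfold zc
  have := wr_nonneg G c u x
  split_ifs <;> linarith

noncomputable def badS {n : ℕ} (G : SimpleGraph (Fin n)) (c : Fin n → Fin 2) (v : Fin n) (y : Fin 5 → Fin n) : ℤ :=
  ∑ i, wr G c v (y i) * (∑ j, ((∑ k, if j ≠ k then zc G c (y j) (y k) else 0) + if y j = v then 1 else 0))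

theorem inner_nonneg {n : ℕ} (G : SimpleGraph (Fin n)) (c : Fin n → Fin 2) (v : Fin n) (y : Fin 5 → Fin n)
    (j : Fin 5) : 0 ≤ ((∑ k, if j ≠ k then zc G c (y j) (y k) else 0) + if y j = v then (1 : ℤ) else 0) := by
  refine add_nonneg (Finset.sum_nonneg fun k _ => ?_) ?_
  · split_ifs
    · exact zc_nonneg _ _ _ _
    · exact le_rfl
  · split_ifs <;> norm_num

theorem EcV_cons {V : Type} (a : V → V → Bool) (v : V) (y : Fin 5 → V) : EcV a (Fin.cons v y : Fin 6 → V) =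
    Ec (a v (y 0)) (a v (y 1)) (a v (y 2)) (a v (y 3)) (a (y 0) (y 1)) (a (y 0) (y 2)) (a (y 0) (y 3))
      (a (y 1) (y 2)) (a (y 1) (y 3)) (a (y 2) (y 3)) (a v (y 4)) (a (y 0) (y 4)) (a (y 1) (y 4))
      (a (y 2) (y 4)) (a (y 3) (y 4)) := rfl

theorem EcV_cons_g5 {V : Type} (a : V → V → Bool) (v : V) (y : Fin 5 → V) (p s : Fin 5 → Bool)
    (hp : ∀ i, a v (y i) = p i) (hs : ∀ i j, i < j → a (y i) (y j) = (s i == s j)) :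
    EcV a (Fin.cons v y : Fin 6 → V) = g5 p s := by
  rw [EcV_cons, g5]
  simp only [hp]
  rw [hs 0 1 (by decide), hs 0 2 (by decide), hs 0 3 (by decide), hs 0 4 (by decide),
    hs 1 2 (by decide), hs 1 3 (by decide), hs 1 4 (by decide), hs 2 3 (by decide),
    hs 2 4 (by decide), hs 3 4 (by decide)]

theorem cons_injective {V : Type} (v : V) (y : Fin 5 → V) (h1 : ∀ i, y i ≠ v)
    (h2 : ∀ i j, i ≠ j → y i ≠ y j) : Function.Injective (Fin.cons v y : Fin 6 → V) := by
  rw [Fin.cons_injective_iff]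
  refine ⟨?_, fun i j hij => ?_⟩
  · rintro ⟨i, hi⟩
    exact h1 i hi
  · by_contra h
    exact h2 i j h hij

theorem cmp_D {n : ℕ} (G : SimpleGraph (Fin n)) (c : Fin n → Fin 2) (v : Fin n) (y : Fin 5 → Fin n) :
    D0 (fun i => aV G v (y i)) (fun i => sV c v (y i))
      ≤ Dx G (fixV G c v) (Fin.cons v y) + 2 * badS G c v y := by
  have hterm : ∀ i, 0 ≤ wr G c v (y i) *
      (∑ j, ((∑ k, if j ≠ k then zc G c (y j) (y k) else 0) + if y j = v then (1 : ℤ) else 0)) :=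
    fun i => mul_nonneg (wr_nonneg _ _ _ _) (Finset.sum_nonneg fun j _ => inner_nonneg G c v y j)
  have hb : 0 ≤ badS G c v y := Finset.sum_nonneg fun i _ => hterm i
  by_cases hb0 : badS G c v y = 0
  swap
  · have h1 : 1 ≤ badS G c v y := by omega
    have := D0_le (fun i => aV G v (y i)) (fun i => sV c v (y i))
    have := Dx_ge G (fixV G c v) (Fin.cons v y)
    linarith
  rw [hb0, mul_zero, add_zero]
  by_cases ht : ∀ i, wr G c v (y i) = 0
  · have h1 : D0 (fun i => aV G v (y i)) (fun i => sV c v (y i)) = 0 := by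
      have : (fun i => aV G v (y i)) = (fun i => sV c v (y i)) := by
        funext i
        exact aV_eq_sV G c v (y i) (ht i)
      rw [this, D0, sub_self]
    rw [h1]
    unfold Dx
    split_ifs with hinj h7 h8 h8
    · norm_num
    · norm_num
    · exfalso
      apply h7
      rw [← h8]
      rw [Fin.cons_injective_iff] at hinj
      have hne : ∀ i, y i ≠ v := fun i hi => hinj.1 ⟨i, hi⟩
      have e1 : ∀ i, adjB (fixV G c v) v (y i) = adjB G v (y i) := by
        intro i
        rw [adjB_fix_left G c v _ (hne i).symm]
        have := aV_eq_sV G c v (y i) (ht i)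
        unfold aV sV at this
        rw [← this]
        simp [hne i]
      have e2 : ∀ i j, adjB (fixV G c v) (y i) (y j) = adjB G (y i) (y j) :=
        fun i j => adjB_fix_other G c v _ _ (hne i) (hne j)
      rw [EcV_cons, EcV_cons]
      simp only [e1, e2]
    · norm_num
    · norm_num
  · push Not at ht
    obtain ⟨i, hi⟩ := ht
    have h1 := (Finset.sum_eq_zero_iff_of_nonneg fun i _ => hterm i).mp hb0 i (Finset.mem_univ i)
    have h2 := (mul_eq_zero.mp h1).resolve_left hi
    have h3 : ∀ j, (∑ k, if j ≠ k then zc G c (y j) (y k) else 0) + (if y j = v then (1 : ℤ) else 0) = 0 :=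
      fun j => (Finset.sum_eq_zero_iff_of_nonneg fun j _ => inner_nonneg G c v y j).mp h2 j (Finset.mem_univ j)
    have hk : ∀ j k, 0 ≤ (if j ≠ k then zc G c (y j) (y k) else 0) := by
      intro j k
      split_ifs
      · exact zc_nonneg _ _ _ _
      · exact le_rfl
    have h4 : ∀ j, y j ≠ v := by
      intro j hj
      have := h3 j
      have h5 : 0 ≤ ∑ k, if j ≠ k then zc G c (y j) (y k) else 0 := Finset.sum_nonneg fun k _ => hk j k
      rw [if_pos hj] at this
      linarith
    have h5 : ∀ j k, j ≠ k → zc G c (y j) (y k) = 0 := by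
      intro j k hjk
      have := h3 j
      rw [if_neg (h4 j), add_zero] at this
      have h6 := (Finset.sum_eq_zero_iff_of_nonneg fun k _ => hk j k).mp this k (Finset.mem_univ k)
      rwa [if_pos hjk] at h6
    have h6 : ∀ j k, j ≠ k → y j ≠ y k ∧ wr G c (y j) (y k) = 0 := by
      intro j k hjk
      have h7 := h5 j k hjk
      have h8 := wr_nonneg G c (y j) (y k)
      unfold zc at h7
      split_ifs at h7 with h9
      · linarith
      · exact ⟨h9, by linarith⟩
    have hinj := cons_injective v y h4 (fun j k h => (h6 j k h).1)
    have h7 : ∀ j k, j ≠ k → adjB G (y j) (y k) = (sV c v (y j) == sV c v (y k)) := by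
      intro j k hjk
      obtain ⟨h8, h9⟩ := h6 j k hjk
      unfold sV
      rw [← eq2_tri]
      by_contra h10
      have : Wr G c (y j) (y k) := ⟨h8, h10⟩
      simp [wr, this] at h9
    unfold Dx D0
    rw [if_pos hinj]
    rw [EcV_cons_g5 (adjB G) v y (fun i => aV G v (y i)) (fun i => sV c v (y i)) (fun i => by
      unfold aV
      simp [h4 i]) (fun i j hij => h7 i j hij.ne)]
    rw [EcV_cons_g5 (adjB (fixV G c v)) v y (fun i => sV c v (y i)) (fun i => sV c v (y i))
      (fun i => adjB_fix_left G c v _ (h4 i).symm)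
      (fun i j hij => by rw [adjB_fix_other G c v _ _ (h4 i) (h4 j)]; exact h7 i j hij.ne)]

theorem sum_reindex5 {V : Type} [Fintype V] (e : Equiv.Perm (Fin 5)) (f : (Fin 5 → V) → ℤ) :
    ∑ x : Fin 5 → V, f (fun i => x (e i)) = ∑ x : Fin 5 → V, f x :=
  Equiv.sum_comp (Equiv.arrowCongr e.symm (Equiv.refl V)) f

theorem sum_five {V : Type} [Fintype V] (f : V → V → V → V → V → ℤ) :
    ∑ x : Fin 5 → V, f (x 0) (x 1) (x 2) (x 3) (x 4)
      = ∑ u0, ∑ u1, ∑ u2, ∑ u3, ∑ u4, f u0 u1 u2 u3 u4 := by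
  simp only [sumTupleCons]
  simp only [Fintype.sum_unique]
  rfl

theorem perm3 (i j k : Fin 5) (h1 : i ≠ j) (h2 : i ≠ k) (h3 : j ≠ k) :
    ∃ e : Equiv.Perm (Fin 5), e 0 = i ∧ e 1 = j ∧ e 2 = k := by
  refine ⟨(Equiv.swap 0 i) * (Equiv.swap 1 (Equiv.swap 0 i j)) *
    (Equiv.swap 2 (Equiv.swap 1 (Equiv.swap 0 i j) (Equiv.swap 0 i k))), ?_⟩
  revert i j k
  decide +kernel

theorem sum_at3 {n : ℕ} (i j k : Fin 5) (h1 : i ≠ j) (h2 : i ≠ k) (h3 : j ≠ k)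
    (f : Fin n → Fin n → Fin n → ℤ) :
    ∑ y : Fin 5 → Fin n, f (y i) (y j) (y k) = (n : ℤ) ^ 2 * ∑ u, ∑ x, ∑ z, f u x z := by
  obtain ⟨e, rfl, rfl, rfl⟩ := perm3 i j k h1 h2 h3
  rw [sum_reindex5 e (fun y => f (y 0) (y 1) (y 2))]
  rw [sum_five (fun u0 u1 u2 _ _ => f u0 u1 u2)]
  simp only [Finset.sum_const, Finset.card_univ, Fintype.card_fin, nsmul_eq_mul, Finset.mul_sum]
  refine Finset.sum_congr rfl fun _ _ => Finset.sum_congr rfl fun _ _ => Finset.sum_congr rfl fun _ _ => ?_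
  ring

theorem sum_at2 {n : ℕ} (i j : Fin 5) (h1 : i ≠ j) (f : Fin n → Fin n → ℤ) :
    ∑ y : Fin 5 → Fin n, f (y i) (y j) = (n : ℤ) ^ 3 * ∑ u, ∑ x, f u x := by
  obtain ⟨k, h2, h3⟩ : ∃ k : Fin 5, i ≠ k ∧ j ≠ k := by
    revert i j; decide
  rw [sum_at3 i j k h1 h2 h3 (fun u x _ => f u x)]
  simp only [Finset.sum_const, Finset.card_univ, Fintype.card_fin, nsmul_eq_mul, Finset.mul_sum]
  refine Finset.sum_congr rfl fun _ _ => Finset.sum_congr rfl fun _ _ => ?_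
  ring

/-- Number of wrong pairs at `v`. -/
noncomputable def wd {n : ℕ} (G : SimpleGraph (Fin n)) (c : Fin n → Fin 2) (v : Fin n) : ℤ :=
  ∑ u, wr G c v u

/-- Total number of wrong ordered pairs. -/
noncomputable def WW {n : ℕ} (G : SimpleGraph (Fin n)) (c : Fin n → Fin 2) : ℤ :=
  ∑ v, wd G c v

theorem wd_nonneg {n : ℕ} (G : SimpleGraph (Fin n)) (c : Fin n → Fin 2) (v : Fin n) : 0 ≤ wd G c v :=
  Finset.sum_nonneg fun _ _ => wr_nonneg _ _ _ _

theorem WW_nonneg {n : ℕ} (G : SimpleGraph (Fin n)) (c : Fin n → Fin 2) : 0 ≤ WW G c :=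
  Finset.sum_nonneg fun _ _ => wd_nonneg _ _ _

theorem zc_symm {n : ℕ} (G : SimpleGraph (Fin n)) (c : Fin n → Fin 2) (u x : Fin n) :
    zc G c u x = zc G c x u := by
  unfold zc
  rw [wr_symm]
  simp only [eq_comm]

theorem sum_zc {n : ℕ} (G : SimpleGraph (Fin n)) (c : Fin n → Fin 2) (u : Fin n) :
    ∑ x, zc G c u x = wd G c u + 1 := by
  unfold zc wd
  rw [Finset.sum_add_distrib]
  simp

/-- The quantity `∑ wr v u * wd u`. -/
noncomputable def qd {n : ℕ} (G : SimpleGraph (Fin n)) (c : Fin n → Fin 2) (v : Fin n) : ℤ :=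
  ∑ u, wr G c v u * wd G c u

theorem qd_nonneg {n : ℕ} (G : SimpleGraph (Fin n)) (c : Fin n → Fin 2) (v : Fin n) : 0 ≤ qd G c v :=
  Finset.sum_nonneg fun _ _ => mul_nonneg (wr_nonneg _ _ _ _) (wd_nonneg _ _ _)

theorem term_le {n : ℕ} (G : SimpleGraph (Fin n)) (c : Fin n → Fin 2) (v : Fin n) (i j k : Fin 5)
    (hjk : j ≠ k) :
    ∑ y : Fin 5 → Fin n, wr G c v (y i) * zc G c (y j) (y k)
      ≤ n ^ 2 * (wd G c v * (WW G c + n)) + n ^ 3 * (qd G c v + wd G c v) := by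
  have hw := wd_nonneg G c v
  have hW := WW_nonneg G c
  have hq := qd_nonneg G c v
  have hQ : ∀ i k : Fin 5, i ≠ k → ∑ y : Fin 5 → Fin n, wr G c v (y i) * zc G c (y i) (y k)
      = n ^ 3 * (qd G c v + wd G c v) := by
    intro i k hik
    rw [sum_at2 i k hik (fun u x => wr G c v u * zc G c u x)]
    simp only [← Finset.mul_sum, sum_zc]
    unfold qd
    conv_rhs => rw [wd, ← Finset.sum_add_distrib]
    congr 1
    refine Finset.sum_congr rfl fun _ _ => ?_
    ring
  have hA : (0 : ℤ) ≤ n ^ 2 * (wd G c v * (WW G c + n)) := by positivity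
  have hB : (0 : ℤ) ≤ n ^ 3 * (qd G c v + wd G c v) := by positivity
  by_cases hij : i = j
  · subst hij
    rw [hQ i k hjk]
    linarith
  by_cases hik : i = k
  · subst hik
    have := hQ i j hij
    have h2 : ∀ y : Fin 5 → Fin n, zc G c (y j) (y i) = zc G c (y i) (y j) := fun y => zc_symm _ _ _ _
    simp only [h2]
    rw [this]
    linarith
  rw [sum_at3 i j k hij hik hjk (fun u x z => wr G c v u * zc G c x z)]
  simp only [← Finset.mul_sum, sum_zc]
  rw [← Finset.sum_mul, Finset.sum_add_distrib]
  simp only [Finset.sum_const, Finset.card_univ, Fintype.card_fin, nsmul_eq_mul, mul_one]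
  change (n : ℤ) ^ 2 * (wd G c v * (WW G c + n)) ≤ _
  linarith

theorem term2_le {n : ℕ} (G : SimpleGraph (Fin n)) (c : Fin n → Fin 2) (v : Fin n) (i j : Fin 5) :
    ∑ y : Fin 5 → Fin n, wr G c v (y i) * (if y j = v then (1 : ℤ) else 0) ≤ n ^ 3 * wd G c v := by
  have hw := wd_nonneg G c v
  by_cases hij : i = j
  · subst hij
    have : ∀ y : Fin 5 → Fin n, wr G c v (y i) * (if y i = v then (1 : ℤ) else 0) = 0 := by
      intro y
      split_ifs with h
      · rw [h, wr_self]; rfl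
      · simp
    simp only [this, Finset.sum_const_zero]
    positivity
  · rw [sum_at2 i j hij (fun u x => wr G c v u * (if x = v then (1 : ℤ) else 0))]
    simp only [← Finset.mul_sum]
    simp [wd]

theorem badS_le {n : ℕ} (G : SimpleGraph (Fin n)) (c : Fin n → Fin 2) (v : Fin n) :
    ∑ y : Fin 5 → Fin n, badS G c v y
      ≤ 100 * (n ^ 2 * (wd G c v * (WW G c + n)) + n ^ 3 * (qd G c v + wd G c v))
        + 25 * (n ^ 3 * wd G c v) := by
  set A : ℤ := n ^ 2 * (wd G c v * (WW G c + n)) + n ^ 3 * (qd G c v + wd G c v) with hA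
  set B : ℤ := n ^ 3 * wd G c v with hB
  have h1 : ∑ y : Fin 5 → Fin n, badS G c v y = ∑ i : Fin 5, ∑ j : Fin 5,
      ((∑ k : Fin 5, if j ≠ k then ∑ y : Fin 5 → Fin n, wr G c v (y i) * zc G c (y j) (y k) else 0)
        + ∑ y : Fin 5 → Fin n, wr G c v (y i) * (if y j = v then (1 : ℤ) else 0)) := by
    unfold badS
    rw [Finset.sum_comm]
    refine Finset.sum_congr rfl fun i _ => ?_
    simp only [Finset.mul_sum]
    rw [Finset.sum_comm]
    refine Finset.sum_congr rfl fun j _ => ?_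
    simp only [mul_add, Finset.sum_add_distrib, Finset.mul_sum]
    congr 1
    rw [Finset.sum_comm]
    refine Finset.sum_congr rfl fun k _ => ?_
    split_ifs
    · rfl
    · simp
  rw [h1]
  calc _ ≤ ∑ i : Fin 5, ∑ j : Fin 5, ((∑ k : Fin 5, if j ≠ k then A else 0) + B) := by
        refine Finset.sum_le_sum fun i _ => Finset.sum_le_sum fun j _ => add_le_add
          (Finset.sum_le_sum fun k _ => ?_) (term2_le G c v i j)
        split_ifs with h
        · exact term_le G c v i j k h
        · exact le_rfl
    _ = 100 * A + 25 * B := by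
        simp [Fin.sum_univ_five]
        ring

def h5 (k t : ℕ) : ℤ := (if k = 1 ∨ k = 3 then 1 else 0) -
  (if (k = 1 ∧ t = 1) ∨ (k = 2 ∧ t = 3) ∨ (k = 3 ∧ t = 3) ∨ (k = 4 ∧ t = 1) then 1 else 0)

theorem D0_eq_aux : ∀ p0 p1 p2 p3 p4 s0 s1 s2 s3 s4 : Bool,
    (if Ec s0 s1 s2 s3 (s0 == s1) (s0 == s2) (s0 == s3) (s1 == s2) (s1 == s3) (s2 == s3)
    s4 (s0 == s4) (s1 == s4) (s2 == s4) (s3 == s4) = 7 then (1 : ℤ) else 0)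
    - (if Ec p0 p1 p2 p3 (s0 == s1) (s0 == s2) (s0 == s3) (s1 == s2) (s1 == s3) (s2 == s3)
    p4 (s0 == s4) (s1 == s4) (s2 == s4) (s3 == s4) = 7 then (1 : ℤ) else 0)
      = h5 (s0.toNat + s1.toNat + s2.toNat + s3.toNat + s4.toNat)
        (p0.toNat + p1.toNat + p2.toNat + p3.toNat + p4.toNat) := by
  decide +kernel

theorem D0_eq (p s : Fin 5 → Bool) : D0 p s = h5 (∑ i, (s i).toNat) (∑ i, (p i).toNat) := by
  rw [Fin.sum_univ_five, Fin.sum_univ_five, ← D0_eq_aux]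
  rfl

def FF (n1 n2 n3 n4 : ℤ) : ℕ → ℕ → ℕ → ℤ
  | 0, k, t => h5 k t
  | m + 1, k, t => n1 * FF n1 n2 n3 n4 m (k + 1) (t + 1) + n2 * FF n1 n2 n3 n4 m (k + 1) t
      + n3 * FF n1 n2 n3 n4 m k (t + 1) + n4 * FF n1 n2 n3 n4 m k t

noncomputable def ncl {n : ℕ} (s p : Fin n → Bool) (x y : Bool) : ℤ :=
  ∑ u, if s u = x ∧ p u = y then 1 else 0

theorem sum_FF {n : ℕ} (s p : Fin n → Bool) (m k t : ℕ) :
    ∑ y : Fin m → Fin n, h5 (k + ∑ i, (s (y i)).toNat) (t + ∑ i, (p (y i)).toNat)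
      = FF (ncl s p true true) (ncl s p true false) (ncl s p false true) (ncl s p false false) m k t := by
  induction m generalizing k t with
  | zero => simp [FF]
  | succ m ih =>
    rw [sumTupleCons]
    simp only [Fin.sum_univ_succ, Fin.cons_zero, Fin.cons_succ, ← add_assoc, ih]
    rw [FF]
    conv_rhs =>
      unfold ncl
      simp only [Finset.sum_mul, ← Finset.sum_add_distrib]
    refine Finset.sum_congr rfl fun u _ => ?_
    cases h1 : s u <;> cases h2 : p u <;> simp [ncl]

theorem FF_five (n1 n2 n3 n4 : ℤ) : FF n1 n2 n3 n4 5 0 0 =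
    10 * (n1 + n2) ^ 3 * (n3 + n4) ^ 2 + 5 * (n1 + n2) * (n3 + n4) ^ 4
    - (10 * n1 ^ 3 * n4 ^ 2 + 60 * n1 ^ 2 * n2 * n3 * n4 + 30 * n1 * n2 ^ 2 * n3 ^ 2 + 5 * n1 * n4 ^ 4
      + 20 * n2 * n3 * n4 ^ 3 + 20 * n1 * n2 ^ 3 * n4 + 5 * n2 ^ 4 * n3 + 30 * n1 ^ 2 * n3 * n4 ^ 2
      + 60 * n1 * n2 * n3 ^ 2 * n4 + 10 * n2 ^ 2 * n3 ^ 3) := by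
  simp [FF, h5]
  ring

theorem sum_D0 {n : ℕ} (s p : Fin n → Bool) :
    ∑ y : Fin 5 → Fin n, D0 (fun i => p (y i)) (fun i => s (y i))
      = FF (ncl s p true true) (ncl s p true false) (ncl s p false true) (ncl s p false false) 5 0 0 := by
  rw [← sum_FF]
  refine Finset.sum_congr rfl fun y _ => ?_
  rw [D0_eq, zero_add, zero_add]

def pf0 (p q r : ℝ) : ℝ :=
    15 * p ^ 5 + 25 * p ^ 4 * q + 50 * p ^ 4 * r + 150 * p ^ 3 * q ^ 2 + 200 * p ^ 3 * q * r +
    110 * p ^ 3 * r ^ 2 + (-50) * p ^ 2 * q ^ 3 + 150 * p ^ 2 * q ^ 2 * r +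
    240 * p ^ 2 * q * r ^ 2 + 110 * p ^ 2 * r ^ 3 + 75 * p * q ^ 4 + 100 * p * q ^ 3 * r +
    90 * p * q ^ 2 * r ^ 2 + 80 * p * q * r ^ 3 + 35 * p * r ^ 4 + 15 * q ^ 5 +
    75 * q ^ 4 * r + 110 * q ^ 3 * r ^ 2 + 60 * q ^ 2 * r ^ 3 + 10 * q * r ^ 4

def pf1 (p q r : ℝ) : ℝ :=
    (-30) * p ^ 4 + 80 * p ^ 3 * q + (-20) * p ^ 3 * r + (-330) * p ^ 2 * q ^ 2 +
    (-120) * p ^ 2 * q * r + (-30) * p ^ 2 * r ^ 2 + 180 * p * q ^ 3 + (-60) * p * q ^ 2 * r +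
    (-120) * p * q * r ^ 2 + (-20) * p * r ^ 3 + (-5) * q ^ 4 + 60 * q ^ 3 * r +
    60 * q ^ 2 * r ^ 2

def pf2 (p q r : ℝ) : ℝ :=
    30 * p ^ 3 + (-240) * p ^ 2 * q + (-30) * p ^ 2 * r + 330 * p * q ^ 2 +
    (-30) * p * r ^ 2 + (-50) * q ^ 3 + 60 * q ^ 2 * r + 60 * q * r ^ 2

def pf3 (p q r : ℝ) : ℝ :=
    (-50) * p ^ 2 + 200 * p * q + (-20) * p * r + (-100) * q ^ 2

def pf4 (p q r : ℝ) : ℝ :=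
    35 * p + (-70) * q

theorem pf0_ge (p q r : ℝ) (hp : 0 ≤ p) (hq : 0 ≤ q) (hr : 0 ≤ r) (hm : 0 < p + q + r) :
    3 * (p + q) * (p + q + r) ^ 4 ≤ pf0 p q r := by
  have h1 : (pf0 p q r - 3 * (p + q) * (p + q + r) ^ 4) * (p + q + r) ^ 2 =
    12 * p ^ 7 + 34 * p ^ 6 * q + 62 * p ^ 6 * r + 152 * p ^ 5 * q ^ 2 + 272 * p ^ 5 * q * r +
    180 * p ^ 5 * r ^ 2 + 170 * p ^ 4 * q ^ 3 + 680 * p ^ 4 * q ^ 2 * r +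
    760 * p ^ 4 * q * r ^ 2 + 320 * p ^ 4 * r ^ 3 + 20 * p ^ 3 * q ^ 4 +
    440 * p ^ 3 * q ^ 3 * r + 1080 * p ^ 3 * q ^ 2 * r ^ 2 + 960 * p ^ 3 * q * r ^ 3 +
    320 * p ^ 3 * r ^ 4 + 52 * p ^ 2 * q ^ 5 + 205 * p ^ 2 * q ^ 4 * r +
    530 * p ^ 2 * q ^ 3 * r ^ 2 + 780 * p ^ 2 * q ^ 2 * r ^ 3 + 565 * p ^ 2 * q * r ^ 4 +
    162 * p ^ 2 * r ^ 5 + 84 * p * q ^ 6 + 322 * p * q ^ 5 * r + 510 * p * q ^ 4 * r ^ 2 +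
    460 * p * q ^ 3 * r ^ 3 + 290 * p * q ^ 2 * r ^ 4 + 134 * p * q * r ^ 5 + 32 * p * r ^ 6 +
    12 * q ^ 7 + 87 * q ^ 6 * r + 230 * q ^ 5 * r ^ 2 + 295 * q ^ 4 * r ^ 3 +
    195 * q ^ 3 * r ^ 4 + 62 * q ^ 2 * r ^ 5 + 7 * q * r ^ 6 := by
    unfold pf0; ring
  have h2 : 0 ≤ (pf0 p q r - 3 * (p + q) * (p + q + r) ^ 4) * (p + q + r) ^ 2 := by
    rw [h1]; positivity
  have h3 : 0 ≤ pf0 p q r - 3 * (p + q) * (p + q + r) ^ 4 := nonneg_of_mul_nonneg_left h2 (by positivity)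
  linarith

theorem pf1_abs (p q r : ℝ) (hp : 0 ≤ p) (hq : 0 ≤ q) (hr : 0 ≤ r) :
    |pf1 p q r| ≤ 55 * (p + q) * (p + q + r) ^ 3 := by
  have h1 : 55 * (p + q) * (p + q + r) ^ 3 + pf1 p q r =
    25 * p ^ 4 + 300 * p ^ 3 * q + 145 * p ^ 3 * r + 375 * p ^ 2 * q * r +
    135 * p ^ 2 * r ^ 2 + 400 * p * q ^ 3 + 435 * p * q ^ 2 * r + 210 * p * q * r ^ 2 +
    35 * p * r ^ 3 + 50 * q ^ 4 + 225 * q ^ 3 * r + 225 * q ^ 2 * r ^ 2 + 55 * q * r ^ 3 := by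
    unfold pf1; ring
  have h2 : 55 * (p + q) * (p + q + r) ^ 3 - pf1 p q r =
    85 * p ^ 4 + 140 * p ^ 3 * q + 185 * p ^ 3 * r + 660 * p ^ 2 * q ^ 2 +
    615 * p ^ 2 * q * r + 195 * p ^ 2 * r ^ 2 + 40 * p * q ^ 3 + 555 * p * q ^ 2 * r +
    450 * p * q * r ^ 2 + 75 * p * r ^ 3 + 60 * q ^ 4 + 105 * q ^ 3 * r +
    105 * q ^ 2 * r ^ 2 + 55 * q * r ^ 3 := by
    unfold pf1; ring
  have h3 : 0 ≤ 55 * (p + q) * (p + q + r) ^ 3 + pf1 p q r := by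
    rw [h1]; positivity
  have h4 : 0 ≤ 55 * (p + q) * (p + q + r) ^ 3 - pf1 p q r := by
    rw [h2]; positivity
  rw [abs_le]
  constructor <;> linarith

theorem pf2_abs (p q r : ℝ) (hp : 0 ≤ p) (hq : 0 ≤ q) (hr : 0 ≤ r) :
    |pf2 p q r| ≤ 110 * (p + q) * (p + q + r) ^ 2 := by
  have h1 : 110 * (p + q) * (p + q + r) ^ 2 + pf2 p q r =
    140 * p ^ 3 + 90 * p ^ 2 * q + 190 * p ^ 2 * r + 660 * p * q ^ 2 + 440 * p * q * r +
    80 * p * r ^ 2 + 60 * q ^ 3 + 280 * q ^ 2 * r + 170 * q * r ^ 2 := by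
    unfold pf2; ring
  have h2 : 110 * (p + q) * (p + q + r) ^ 2 - pf2 p q r =
    80 * p ^ 3 + 570 * p ^ 2 * q + 250 * p ^ 2 * r + 440 * p * q * r + 140 * p * r ^ 2 +
    160 * q ^ 3 + 160 * q ^ 2 * r + 50 * q * r ^ 2 := by
    unfold pf2; ring
  have h3 : 0 ≤ 110 * (p + q) * (p + q + r) ^ 2 + pf2 p q r := by
    rw [h1]; positivity
  have h4 : 0 ≤ 110 * (p + q) * (p + q + r) ^ 2 - pf2 p q r := by
    rw [h2]; positivity
  rw [abs_le]
  constructor <;> linarith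

theorem pf3_abs (p q r : ℝ) (hp : 0 ≤ p) (hq : 0 ≤ q) (hr : 0 ≤ r) :
    |pf3 p q r| ≤ 100 * (p + q) * (p + q + r) ^ 1 := by
  have h1 : 100 * (p + q) * (p + q + r) ^ 1 + pf3 p q r =
    50 * p ^ 2 + 400 * p * q + 80 * p * r + 100 * q * r := by
    unfold pf3; ring
  have h2 : 100 * (p + q) * (p + q + r) ^ 1 - pf3 p q r =
    150 * p ^ 2 + 120 * p * r + 200 * q ^ 2 + 100 * q * r := by
    unfold pf3; ring
  have h3 : 0 ≤ 100 * (p + q) * (p + q + r) ^ 1 + pf3 p q r := by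
    rw [h1]; positivity
  have h4 : 0 ≤ 100 * (p + q) * (p + q + r) ^ 1 - pf3 p q r := by
    rw [h2]; positivity
  rw [abs_le]
  constructor <;> linarith

theorem pf4_abs (p q r : ℝ) (hp : 0 ≤ p) (hq : 0 ≤ q) (hr : 0 ≤ r) :
    |pf4 p q r| ≤ 70 * (p + q) * (p + q + r) ^ 0 := by
  have h1 : 70 * (p + q) * (p + q + r) ^ 0 + pf4 p q r =
    105 * p := by
    unfold pf4; ring
  have h2 : 70 * (p + q) * (p + q + r) ^ 0 - pf4 p q r =
    35 * p + 140 * q := by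
    unfold pf4; ring
  have h3 : 0 ≤ 70 * (p + q) * (p + q + r) ^ 0 + pf4 p q r := by
    rw [h1]; positivity
  have h4 : 0 ≤ 70 * (p + q) * (p + q + r) ^ 0 - pf4 p q r := by
    rw [h2]; positivity
  rw [abs_le]
  constructor <;> linarith

def MF (n1 n2 n3 n4 : ℝ) : ℝ :=
    10 * (n1 + n2) ^ 3 * (n3 + n4) ^ 2 + 5 * (n1 + n2) * (n3 + n4) ^ 4
    - (10 * n1 ^ 3 * n4 ^ 2 + 60 * n1 ^ 2 * n2 * n3 * n4 + 30 * n1 * n2 ^ 2 * n3 ^ 2 + 5 * n1 * n4 ^ 4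
      + 20 * n2 * n3 * n4 ^ 3 + 20 * n1 * n2 ^ 3 * n4 + 5 * n2 ^ 4 * n3 + 30 * n1 ^ 2 * n3 * n4 ^ 2
      + 60 * n1 * n2 * n3 ^ 2 * n4 + 10 * n2 ^ 2 * n3 ^ 3)

theorem MF_eq (p q r d : ℝ) : MF (q + r + d) p q (p + r - d) =
    pf0 p q r + d * pf1 p q r + d ^ 2 * pf2 p q r + d ^ 3 * pf3 p q r + d ^ 4 * pf4 p q r := by
  unfold MF pf0 pf1 pf2 pf3 pf4
  ring

theorem MF_ge (p q r d : ℝ) (hp : 0 ≤ p) (hq : 0 ≤ q) (hr : 0 ≤ r) (hm : 0 < p + q + r)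
    (hd : |d| ≤ (p + q + r) / 100) :
    2 * (p + q) * (p + q + r) ^ 4 ≤ MF (q + r + d) p q (p + r - d) := by
  rw [MF_eq]
  have h0 := pf0_ge p q r hp hq hr hm
  have h1 := pf1_abs p q r hp hq hr
  have h2 := pf2_abs p q r hp hq hr
  have h3 := pf3_abs p q r hp hq hr
  have h4 := pf4_abs p q r hp hq hr
  set m := p + q + r with hmd
  have hw : 0 ≤ p + q := by positivity
  set w := p + q with hwd
  have key : ∀ (j : ℕ) (f K : ℝ) (e : ℕ), 0 ≤ K → |f| ≤ K * w * m ^ e → e + j = 4 →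
      -(K / 100 ^ j * (w * m ^ 4)) ≤ d ^ j * f := by
    intro j f K e hK hf he
    have h5 : |d ^ j * f| ≤ (m / 100) ^ j * (K * w * m ^ e) := by
      rw [abs_mul, abs_pow]
      exact mul_le_mul (pow_le_pow_left₀ (abs_nonneg d) hd j) hf (abs_nonneg f) (by positivity)
    have h6 : (m / 100) ^ j * (K * w * m ^ e) = K / 100 ^ j * (w * m ^ 4) := by
      rw [← he, div_pow, pow_add]
      ring
    rw [h6] at h5
    exact (abs_le.mp h5).1
  have k1 := key 1 _ 55 3 (by norm_num) h1 rfl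
  have k2 := key 2 _ 110 2 (by norm_num) h2 rfl
  have k3 := key 3 _ 100 1 (by norm_num) h3 rfl
  have k4 := key 4 _ 70 0 (by norm_num) h4 rfl
  have hwm : 0 ≤ w * m ^ 4 := by positivity
  rw [pow_one] at k1
  norm_num at k1 k2 k3 k4
  linarith

theorem wr_le_one {n : ℕ} (G : SimpleGraph (Fin n)) (c : Fin n → Fin 2) (u x : Fin n) :
    wr G c u x ≤ 1 := by
  unfold wr; split_ifs <;> norm_num

theorem qd_le_WW {n : ℕ} (G : SimpleGraph (Fin n)) (c : Fin n → Fin 2) (v : Fin n) :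
    qd G c v ≤ WW G c := by
  unfold qd WW
  refine Finset.sum_le_sum fun u _ => ?_
  have := wr_le_one G c v u
  have := wd_nonneg G c u
  nlinarith

theorem qd_le_sq {n : ℕ} (G : SimpleGraph (Fin n)) (c : Fin n → Fin 2) (v : Fin n)
    (h : ∀ u, wd G c u ≤ wd G c v) : qd G c v ≤ wd G c v * wd G c v := by
  unfold qd
  conv_rhs => rw [wd, Finset.sum_mul]
  refine Finset.sum_le_sum fun u _ => mul_le_mul_of_nonneg_left (h u) (wr_nonneg _ _ _ _)

noncomputable def bal {n : ℕ} (c : Fin n → Fin 2) (v : Fin n) : ℤ := ∑ u, sg (sV c v u)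

theorem wr_eq {n : ℕ} (G : SimpleGraph (Fin n)) (c : Fin n → Fin 2) (v u : Fin n) :
    wr G c v u = if aV G v u ≠ sV c v u then 1 else 0 := by
  unfold wr
  congr 1
  apply propext
  unfold Wr aV sV
  by_cases h : u = v
  · subst h
    simp [(eq2_iff (c u) (c u)).mpr rfl]
  · simp [h, Ne.symm h]

theorem wd_ncl {n : ℕ} (G : SimpleGraph (Fin n)) (c : Fin n → Fin 2) (v : Fin n) :
    ncl (sV c v) (aV G v) true false + ncl (sV c v) (aV G v) false true = wd G c v := by
  unfold ncl wd
  rw [← Finset.sum_add_distrib]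
  refine Finset.sum_congr rfl fun u _ => ?_
  rw [wr_eq]
  cases sV c v u <;> cases aV G v u <;> simp

theorem n_ncl {n : ℕ} (s p : Fin n → Bool) :
    ncl s p true true + ncl s p true false + ncl s p false true + ncl s p false false = n := by
  unfold ncl
  rw [← Finset.sum_add_distrib, ← Finset.sum_add_distrib, ← Finset.sum_add_distrib]
  have : ∀ u : Fin n, ((((if s u = true ∧ p u = true then (1 : ℤ) else 0) + if s u = true ∧ p u = false then 1 else 0) +
    if s u = false ∧ p u = true then 1 else 0) + if s u = false ∧ p u = false then 1 else 0) = 1 := by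
    intro u
    cases s u <;> cases p u <;> simp
  simp only [this]
  simp

theorem bal_ncl {n : ℕ} (s p : Fin n → Bool) :
    ncl s p true true + ncl s p true false - ncl s p false true - ncl s p false false = ∑ u, sg (s u) := by
  unfold ncl
  rw [← Finset.sum_add_distrib, ← Finset.sum_sub_distrib, ← Finset.sum_sub_distrib]
  refine Finset.sum_congr rfl fun u _ => ?_
  cases s u <;> cases p u <;> simp [sg]

theorem ncl_nonneg {n : ℕ} (s p : Fin n → Bool) (x y : Bool) : 0 ≤ ncl s p x y :=
  Finset.sum_nonneg fun u _ => by split_ifs <;> norm_num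

theorem main_ge {n : ℕ} (hn : 0 < n) (G : SimpleGraph (Fin n)) (c : Fin n → Fin 2) (v : Fin n)
    (hb : 100 * |bal c v| ≤ n) (hw : 2 * wd G c v ≤ n) :
    (wd G c v : ℝ) * n ^ 4 / 8 ≤
      ((∑ y : Fin 5 → Fin n, D0 (fun i => aV G v (y i)) (fun i => sV c v (y i)) : ℤ) : ℝ) := by
  rw [sum_D0, FF_five]
  have e1 := wd_ncl G c v
  have e2 := n_ncl (sV c v) (aV G v)
  have e3 := bal_ncl (sV c v) (aV G v)
  have q2 := ncl_nonneg (sV c v) (aV G v) true false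
  have q3 := ncl_nonneg (sV c v) (aV G v) false true
  generalize ncl (sV c v) (aV G v) true true = n1 at *
  generalize ncl (sV c v) (aV G v) true false = n2 at *
  generalize ncl (sV c v) (aV G v) false true = n3 at *
  generalize ncl (sV c v) (aV G v) false false = n4 at *
  change _ = bal c v at e3
  rw [← e1] at hw
  rw [← e1]
  rw [← e3] at hb
  have e2' : (n1 : ℝ) + n2 + n3 + n4 = n := by exact_mod_cast e2
  have hw' : 2 * ((n2 : ℝ) + n3) ≤ n := by exact_mod_cast hw
  have hb' : 100 * |(n1 : ℝ) + n2 - n3 - n4| ≤ n := by exact_mod_cast hb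
  have q2' : (0 : ℝ) ≤ n2 := by exact_mod_cast q2
  have q3' : (0 : ℝ) ≤ n3 := by exact_mod_cast q3
  have hn' : (0 : ℝ) < n := by exact_mod_cast hn
  have h := MF_ge (n2 : ℝ) n3 (n / 2 - n2 - n3) (((n1 : ℝ) + n2 - n3 - n4) / 2) q2' q3' (by linarith)
    (by linarith) (by rw [abs_div, abs_two]; linarith)
  have x1 : (n3 : ℝ) + (n / 2 - n2 - n3) + ((n1 : ℝ) + n2 - n3 - n4) / 2 = n1 := by
    rw [← e2']; ring
  have x2 : (n2 : ℝ) + (n / 2 - n2 - n3) - ((n1 : ℝ) + n2 - n3 - n4) / 2 = n4 := by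
    rw [← e2']; ring
  have x3 : (n2 : ℝ) + n3 + (n / 2 - n2 - n3) = n / 2 := by ring
  rw [x1, x2, x3] at h
  unfold MF at h
  push_cast
  refine le_trans (le_of_eq ?_) h
  ring

theorem vertex_step {n : ℕ} (hn : 100000 ≤ n) (G : SimpleGraph (Fin n)) (c : Fin n → Fin 2) (v : Fin n)
    (hb : 100 * |bal c v| ≤ n) (hw : 2 * wd G c v ≤ n) (hmax : ∀ u, wd G c u ≤ wd G c v)
    (hW : 400000000 * WW G c ≤ n ^ 2) :
    (wd G c v : ℝ) * n ^ 4 ≤ 1920 * ((numKL 6 7 (fixV G c v) : ℝ) - numKL 6 7 G) := by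
  have h1 := main_ge (by omega) G c v hb hw
  have h2 := diff_fix G c v
  have h3 := badS_le G c v
  have h4 := Finset.sum_le_sum fun (y : Fin 5 → Fin n) (_ : y ∈ Finset.univ) => cmp_D G c v y
  rw [Finset.sum_add_distrib, ← Finset.mul_sum, ← h2] at h4
  have h5 : (∑ y : Fin 5 → Fin n, D0 (fun i => aV G v (y i)) (fun i => sV c v (y i))) ≤
     120 * (numKL 6 7 (fixV G c v) : ℤ) - 120 * (numKL 6 7 G : ℤ) +
     2 * (100 * (n ^ 2 * (wd G c v * (WW G c + n)) + n ^ 3 * (qd G c v + wd G c v))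
        + 25 * (n ^ 3 * wd G c v)) := by linarith
  have h6 : ((∑ y : Fin 5 → Fin n, D0 (fun i => aV G v (y i)) (fun i => sV c v (y i)) : ℤ) : ℝ) ≤
     120 * (numKL 6 7 (fixV G c v) : ℝ) - 120 * (numKL 6 7 G : ℝ) +
     2 * (100 * ((n : ℝ) ^ 2 * (wd G c v * (WW G c + n)) + n ^ 3 * (qd G c v + wd G c v))
        + 25 * (n ^ 3 * wd G c v)) := by exact_mod_cast h5
  have hq1 : (qd G c v : ℝ) ≤ WW G c := by exact_mod_cast qd_le_WW G c v
  have hq2 : (qd G c v : ℝ) ≤ wd G c v * wd G c v := by exact_mod_cast qd_le_sq G c v hmax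
  have hw0 : (0 : ℝ) ≤ wd G c v := by exact_mod_cast wd_nonneg G c v
  have hW' : 400000000 * (WW G c : ℝ) ≤ n ^ 2 := by exact_mod_cast hW
  have hn' : (100000 : ℝ) ≤ n := by exact_mod_cast hn
  generalize (wd G c v : ℝ) = w at *
  generalize (WW G c : ℝ) = W at *
  generalize (qd G c v : ℝ) = q at *
  generalize (n : ℝ) = N at *
  have hN0 : 0 < N := by linarith
  have hq3 : q ≤ w * N / 20000 := by
    by_cases hc : w ≤ N / 20000
    · nlinarith
    · push Not at hc
      nlinarith
  have b1 : N ^ 2 * (w * (W + N)) ≤ N ^ 2 * (w * (N ^ 2 / 400000000 + N ^ 2 / 100000)) := by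
    gcongr
    · linarith
    · nlinarith
  have b2 : N ^ 3 * (q + w) ≤ N ^ 3 * (w * N / 20000 + w * N / 100000) := by
    gcongr
    have : w * 100000 ≤ w * N := by gcongr
    linarith
  have b3 : N ^ 3 * w ≤ N ^ 3 * (w * N / 100000) := by
    gcongr
    have : w * 100000 ≤ w * N := by gcongr
    linarith
  have b4 : 0 ≤ w * N ^ 4 := by positivity
  have c1 : N ^ 2 * (w * (N ^ 2 / 400000000 + N ^ 2 / 100000)) = (w * N ^ 4) * (1 / 400000000 + 1 / 100000) := by ring
  have c2 : N ^ 3 * (w * N / 20000 + w * N / 100000) = (w * N ^ 4) * (1 / 20000 + 1 / 100000) := by ring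
  have c3 : N ^ 3 * (w * N / 100000) = (w * N ^ 4) / 100000 := by ring
  rw [c1] at b1
  rw [c2] at b2
  rw [c3] at b3
  linarith

theorem wr_fix {n : ℕ} (G : SimpleGraph (Fin n)) (c : Fin n → Fin 2) (v u x : Fin n) :
    wr (fixV G c v) c u x = if u = v ∨ x = v then 0 else wr G c u x := by
  split_ifs with h
  · unfold wr
    rw [if_neg]
    rintro ⟨h1, h2⟩
    rcases h with rfl | rfl
    · exact h2 (adjB_fix_left G c u x h1)
    · apply h2
      rw [adjB_symm, adjB_fix_left G c x u h1.symm, eq2_comm]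
  · push Not at h
    unfold wr Wr
    rw [adjB_fix_other G c v u x h.1 h.2]

theorem wd_fix_le {n : ℕ} (G : SimpleGraph (Fin n)) (c : Fin n → Fin 2) (v u : Fin n) :
    wd (fixV G c v) c u ≤ wd G c u := by
  refine Finset.sum_le_sum fun x _ => ?_
  rw [wr_fix]
  have := wr_nonneg G c u x
  split_ifs <;> linarith

theorem wd_fix_self {n : ℕ} (G : SimpleGraph (Fin n)) (c : Fin n → Fin 2) (v : Fin n) :
    wd (fixV G c v) c v = 0 := by
  refine Finset.sum_eq_zero fun x _ => ?_
  rw [wr_fix]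
  simp

theorem WW_fix_lt {n : ℕ} (G : SimpleGraph (Fin n)) (c : Fin n → Fin 2) (v : Fin n) (h : 0 < wd G c v) :
    WW (fixV G c v) c < WW G c := by
  refine Finset.sum_lt_sum (fun u _ => wd_fix_le G c v u) ⟨v, Finset.mem_univ v, ?_⟩
  rw [wd_fix_self]; exact h

theorem WW_le_fix {n : ℕ} (G : SimpleGraph (Fin n)) (c : Fin n → Fin 2) (v : Fin n) :
    WW G c ≤ WW (fixV G c v) c + 2 * wd G c v := by
  have h : ∀ u x, wr G c u x ≤ wr (fixV G c v) c u x + (if u = v then wr G c v x else 0)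
      + (if x = v then wr G c v u else 0) := by
    intro u x
    rw [wr_fix]
    have h0 := wr_nonneg G c u x
    have h1 := wr_nonneg G c v x
    have h2 := wr_nonneg G c v u
    by_cases hu : u = v
    · subst hu
      simp only [true_or, if_true]
      split_ifs <;> linarith
    · by_cases hx : x = v
      · subst hx
        simp only [or_true, if_true, if_neg hu]
        rw [wr_symm]
        linarith
      · simp [hu, hx]
  have h2 := Finset.sum_le_sum fun (u : Fin n) (_ : u ∈ Finset.univ) =>
    Finset.sum_le_sum fun (x : Fin n) (_ : x ∈ Finset.univ) => h u x
  simp only [Finset.sum_add_distrib] at h2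
  have e1 : ∑ u : Fin n, ∑ x : Fin n, (if u = v then wr G c v x else 0) = wd G c v := by
    rw [Finset.sum_comm]
    simp [wd]
  have e2 : ∑ u : Fin n, ∑ x : Fin n, (if x = v then wr G c v u else 0) = wd G c v := by
    simp [wd]
  rw [e1, e2] at h2
  change WW G c ≤ WW (fixV G c v) c + wd G c v + wd G c v at h2
  linarith

theorem wr_zero_iff {n : ℕ} (G : SimpleGraph (Fin n)) (c : Fin n → Fin 2) (u x : Fin n) :
    wr G c u x = 0 ↔ (G.Adj u x ↔ (twoCl c).Adj u x) := by
  have h1 : (twoCl c).Adj u x ↔ (u ≠ x ∧ c u = c x) := Iff.rfl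
  rw [h1]
  unfold wr Wr adjB
  rw [eq2_eq]
  by_cases hux : u = x
  · subst hux
    simp
  · by_cases ha : G.Adj u x <;> by_cases hc : c u = c x <;> simp [hux, ha, hc]

theorem eq_twoCl {n : ℕ} (G : SimpleGraph (Fin n)) (c : Fin n → Fin 2) (h : WW G c = 0) : G = twoCl c := by
  have h1 : ∀ u x, wr G c u x = 0 := by
    intro u x
    have h2 := (Finset.sum_eq_zero_iff_of_nonneg fun u _ => wd_nonneg G c u).mp h u (Finset.mem_univ u)
    exact (Finset.sum_eq_zero_iff_of_nonneg fun x _ => wr_nonneg G c u x).mp h2 x (Finset.mem_univ x)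
  ext u x
  exact (wr_zero_iff G c u x).mp (h1 u x)

theorem repair {n : ℕ} (hn : 100000 ≤ n) (c : Fin n → Fin 2) (hb : ∀ v, 100 * |bal c v| ≤ n) (k : ℕ) :
    ∀ G : SimpleGraph (Fin n), (WW G c).toNat = k → (∀ v, 2 * wd G c v ≤ n) →
      400000000 * WW G c ≤ n ^ 2 →
      (WW G c : ℝ) * n ^ 4 ≤ 3840 * ((numKL 6 7 (twoCl c) : ℝ) - numKL 6 7 G) := by
  induction k using Nat.strong_induction_on with
  | _ k ih =>
    intro G hk hw hW
    have hW0 := WW_nonneg G c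
    by_cases h0 : WW G c = 0
    · rw [← eq_twoCl G c h0, h0]
      simp
    · haveI : Nonempty (Fin n) := ⟨⟨0, by omega⟩⟩
      obtain ⟨v, -, hv⟩ := Finset.exists_max_image Finset.univ (fun u => wd G c u) Finset.univ_nonempty
      have hv' : ∀ u, wd G c u ≤ wd G c v := fun u => hv u (Finset.mem_univ u)
      have hpos : 0 < wd G c v := by
        by_contra hneg
        push Not at hneg
        apply h0
        refine Finset.sum_eq_zero fun u _ => ?_
        have := wd_nonneg G c u
        have := hv' u
        omega
      have h1 := vertex_step hn G c v (hb v) (hw v) hv' hW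
      have h2 := WW_fix_lt G c v hpos
      have h3 := WW_le_fix G c v
      have h4 := ih (WW (fixV G c v) c).toNat (by have := WW_nonneg (fixV G c v) c; omega) (fixV G c v) rfl
        (fun u => le_trans (by have := wd_fix_le G c v u; linarith) (hw u)) (by linarith)
      have h5 : (WW G c : ℝ) ≤ WW (fixV G c v) c + 2 * wd G c v := by exact_mod_cast h3
      have h6 : (WW G c : ℝ) * n ^ 4 ≤ (WW (fixV G c v) c + 2 * wd G c v) * n ^ 4 := by gcongr
      linarith

theorem WW_le_sq {n : ℕ} (G : SimpleGraph (Fin n)) (c : Fin n → Fin 2) : WW G c ≤ n ^ 2 := by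
  have h := Finset.sum_le_sum fun (u : Fin n) (_ : u ∈ Finset.univ) =>
    Finset.sum_le_sum fun (x : Fin n) (_ : x ∈ Finset.univ) => wr_le_one G c u x
  simp only [Finset.sum_const, Finset.card_univ, Fintype.card_fin, nsmul_eq_mul, mul_one] at h
  rw [sq]
  exact h

theorem dist_le {n : ℕ} (G : SimpleGraph (Fin n)) (c : Fin n → Fin 2) :
    (distToFam G isTwoCliques : ℤ) ≤ WW G c := by
  have h1 : distToFam G isTwoCliques ≤ editDist G (twoCl c) :=
    ciInf_le (f := fun H : {H : SimpleGraph (Fin n) // isTwoCliques H} => editDist G H.1)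
      (OrderBot.bddBelow _) ⟨twoCl c, twoCl_isTwo c⟩
  have h2 : editDist G (twoCl c) ≤ (Finset.univ.filter (fun p : Fin n × Fin n =>
      p.1 < p.2 ∧ ¬ (G.Adj p.1 p.2 ↔ (twoCl c).Adj p.1 p.2))).card :=
    ciInf_le (f := fun σ : Equiv.Perm (Fin n) => (Finset.univ.filter (fun p : Fin n × Fin n =>
      p.1 < p.2 ∧ ¬ (G.Adj p.1 p.2 ↔ (twoCl c).Adj (σ p.1) (σ p.2)))).card)
      (OrderBot.bddBelow _) (1 : Equiv.Perm (Fin n))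
  have h3 : (((Finset.univ.filter (fun p : Fin n × Fin n =>
      p.1 < p.2 ∧ ¬ (G.Adj p.1 p.2 ↔ (twoCl c).Adj p.1 p.2))).card : ℕ) : ℤ) ≤ WW G c := by
    rw [Finset.card_filter]
    push_cast
    unfold WW wd
    rw [← Fintype.sum_prod_type']
    refine Finset.sum_le_sum fun p _ => ?_
    have h0 := wr_nonneg G c p.1 p.2
    split_ifs with h
    · have : wr G c p.1 p.2 ≠ 0 := fun h4 => h.2 ((wr_zero_iff G c _ _).mp h4)
      omega
    · exact h0
  have h4 : ((distToFam G isTwoCliques : ℕ) : ℤ) ≤ (((Finset.univ.filter (fun p : Fin n × Fin n =>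
      p.1 < p.2 ∧ ¬ (G.Adj p.1 p.2 ↔ (twoCl c).Adj p.1 p.2))).card : ℕ) : ℤ) := by
    exact_mod_cast h1.trans h2
  exact h4.trans h3

/-- Colouring by adjacency to `v`. -/
noncomputable def col0 {n : ℕ} (G : SimpleGraph (Fin n)) (v u : Fin n) : Fin 2 :=
  if u = v ∨ G.Adj v u then 0 else 1

theorem bd_tri (p q r : Bool) (h : r ≠ (p == q)) : bd p q r = 1 := by
  revert h; revert p q r; decide

theorem wr_col0 {n : ℕ} (G : SimpleGraph (Fin n)) (v u x : Fin n) :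
    wr G (col0 G v) u x ≤ bd (adjB G v u) (adjB G v x) (adjB G u x) := by
  have hb := bd_nonneg (adjB G v u) (adjB G v x) (adjB G u x)
  by_cases h0 : wr G (col0 G v) u x = 0
  · rw [h0]; exact hb
  have h1 := wr_le_one G (col0 G v) u x
  have hW : Wr G (col0 G v) u x := by
    by_contra h
    exact h0 (by simp [wr, h])
  have hv : ∀ x, v ≠ x → adjB G v x = eq2 (col0 G v v) (col0 G v x) := by
    intro x hx
    rw [eq2_eq]
    unfold adjB col0
    by_cases ha : G.Adj v x <;> simp [ha, hx.symm]
  obtain ⟨h2, h3⟩ := hW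
  by_cases hu : v = u
  · subst hu
    exact absurd (hv x h2) h3
  by_cases hx : v = x
  · subst hx
    rw [adjB_symm, eq2_comm] at h3
    exact absurd (hv u hu) h3
  rw [bd_tri]
  · exact h1
  · rw [hv u hu, hv x hx, ← eq2_tri]
    exact h3

theorem exists_col0 {n : ℕ} (hn : 0 < n) (G : SimpleGraph (Fin n)) : ∃ c : Fin n → Fin 2,
    n * WW G c ≤ ∑ u : Fin n, ∑ v : Fin n, ∑ w : Fin n, bd (adjB G u v) (adjB G u w) (adjB G v w) := by
  by_contra hcon
  push Not at hcon
  have h1 : ∀ v : Fin n, n * (∑ u : Fin n, ∑ w : Fin n, bd (adjB G v u) (adjB G v w) (adjB G u w))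
      > ∑ u : Fin n, ∑ v : Fin n, ∑ w : Fin n, bd (adjB G u v) (adjB G u w) (adjB G v w) := by
    intro v
    refine lt_of_lt_of_le (hcon (col0 G v)) ?_
    refine mul_le_mul_of_nonneg_left ?_ (by positivity)
    exact Finset.sum_le_sum fun u _ => Finset.sum_le_sum fun x _ => wr_col0 G v u x
  have h2 := Finset.sum_lt_sum_of_nonempty (s := (Finset.univ : Finset (Fin n)))
    ⟨⟨0, hn⟩, Finset.mem_univ _⟩ fun v _ => h1 v
  rw [← Finset.mul_sum] at h2
  simp at h2

theorem flip_pt {n : ℕ} (G : SimpleGraph (Fin n)) (c c' : Fin n → Fin 2) (v : Fin n)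
    (h : ∀ u, u ≠ v → c' u = c u) (u x : Fin n) :
    wr G c u x + (if u = v then wr G c' v x else 0) + (if x = v then wr G c' v u else 0) =
    wr G c' u x + (if u = v then wr G c v x else 0) + (if x = v then wr G c v u else 0) := by
  by_cases hu : u = v
  · subst hu
    by_cases hx : x = u
    · subst hx
      simp [wr_self]
    · simp [hx]; ring
  · by_cases hx : x = v
    · subst hx
      simp only [if_true, if_neg hu]
      rw [wr_symm G c u x, wr_symm G c' u x]
      ring
    · simp only [if_neg hu, if_neg hx]
      unfold wr Wr
      rw [h u hu, h x hx]

theorem flip_WW {n : ℕ} (G : SimpleGraph (Fin n)) (c c' : Fin n → Fin 2) (v : Fin n)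
    (h : ∀ u, u ≠ v → c' u = c u) : WW G c + 2 * wd G c' v = WW G c' + 2 * wd G c v := by
  have h2 : ∑ u : Fin n, ∑ x : Fin n, _ = ∑ u : Fin n, ∑ x : Fin n, _ :=
    Finset.sum_congr rfl fun u _ => Finset.sum_congr rfl fun x _ => flip_pt G c c' v h u x
  simp only [Finset.sum_add_distrib] at h2
  have e1 : ∀ c, ∑ u : Fin n, ∑ x : Fin n, (if u = v then wr G c v x else 0) = wd G c v := by
    intro c
    rw [Finset.sum_comm]
    simp [wd]
  have e2 : ∀ c, ∑ u : Fin n, ∑ x : Fin n, (if x = v then wr G c v u else 0) = wd G c v := by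
    intro c
    simp [wd]
  rw [e1, e2, e1, e2] at h2
  change WW G c + wd G c' v + wd G c' v = WW G c' + wd G c v + wd G c v at h2
  linarith

theorem eq2_flip (a b : Fin 2) : eq2 (1 - a) b = !(eq2 a b) := by
  revert a b; decide

theorem min_wd {n : ℕ} (G : SimpleGraph (Fin n)) (c : Fin n → Fin 2)
    (hmin : ∀ c', WW G c ≤ WW G c') (v : Fin n) : 2 * wd G c v ≤ n := by
  have h1 := flip_WW G c (Function.update c v (1 - c v)) v fun u hu => Function.update_of_ne hu _ _
  have h2 := hmin (Function.update c v (1 - c v))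
  have h3 : wd G c v + wd G (Function.update c v (1 - c v)) v ≤ n := by
    unfold wd
    rw [← Finset.sum_add_distrib]
    have : ∀ u, wr G c v u + wr G (Function.update c v (1 - c v)) v u ≤ 1 := by
      intro u
      by_cases hu : u = v
      · subst hu
        simp [wr_self]
      · unfold wr Wr
        rw [Function.update_of_ne hu, Function.update_self, eq2_flip]
        cases adjB G v u <;> cases eq2 (c v) (c u) <;> simp <;> split_ifs <;> norm_num
    have h4 := Finset.sum_le_sum fun (u : Fin n) (_ : u ∈ Finset.univ) => this u
    simpa using h4
  linarith

theorem bal_sq {n : ℕ} (G : SimpleGraph (Fin n)) (c : Fin n → Fin 2) (v : Fin n) :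
    bal c v ^ 2 ≤ (∑ u : Fin n, ∑ x : Fin n, sg (adjB G u x)) + 2 * WW G c + 2 * n := by
  have h1 : bal c v ^ 2 = ∑ u : Fin n, ∑ x : Fin n, sg (eq2 (c u) (c x)) := by
    unfold bal
    rw [sq, Finset.sum_mul_sum]
    refine Finset.sum_congr rfl fun u _ => Finset.sum_congr rfl fun x _ => ?_
    unfold sV
    generalize c u = a
    generalize c x = b
    generalize c v = e
    revert a b e
    decide
  have h2 : ∀ u x, sg (eq2 (c u) (c x)) ≤ sg (adjB G u x) + 2 * wr G c u x + (if u = x then 2 else 0) := by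
    intro u x
    have h0 := wr_nonneg G c u x
    by_cases hux : u = x
    · rw [if_pos hux]
      cases eq2 (c u) (c x) <;> cases adjB G u x <;> simp [sg] <;> linarith
    · rw [if_neg hux]
      unfold wr Wr
      cases eq2 (c u) (c x) <;> cases adjB G u x <;> simp [sg, hux]
  have h3 := Finset.sum_le_sum fun (u : Fin n) (_ : u ∈ Finset.univ) =>
    Finset.sum_le_sum fun (x : Fin n) (_ : x ∈ Finset.univ) => h2 u x
  simp only [Finset.sum_add_distrib, ← Finset.mul_sum] at h3
  rw [h1]
  refine h3.trans (le_of_eq ?_)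
  change _ + 2 * WW G c + _ = _
  simp
  ring

theorem stab_part : ∃ C : ℝ, 0 < C ∧ ∀ n : ℕ, (C ≤ n) → ∀ G : SimpleGraph (Fin n),
      (distToFam G isTwoCliques : ℝ) ≤ C * (lamKLmax 6 7 n - lamKL 6 7 G) * n ^ 2 := by
  refine ⟨10 ^ 15, by norm_num, fun n hn G => ?_⟩
  have hnN : 10 ^ 15 ≤ n := by exact_mod_cast hn
  have hn6 : 6 ≤ n := le_trans (by norm_num) hnN
  have hD0 := lamKL_le_max G
  have hpos : (0 : ℝ) < n := lt_of_lt_of_le (by norm_num) hn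
  by_cases hD : 1 / 10 ^ 14 ≤ lamKLmax 6 7 n - lamKL 6 7 G
  · have h1 := dist_le G (fun _ => 0)
    have h2 := WW_le_sq G (fun _ => 0)
    have h3 : (distToFam G isTwoCliques : ℝ) ≤ n ^ 2 := by exact_mod_cast h1.trans h2
    have h4 : (1 : ℝ) * n ^ 2 ≤ 10 ^ 15 * (lamKLmax 6 7 n - lamKL 6 7 G) * n ^ 2 := by
      gcongr
      linarith
    linarith
  push Not at hD
  have hge := lamKLmax_ge n hn6
  have hC0 : (0 : ℝ) < n.choose 6 := by exact_mod_cast Nat.choose_pos hn6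
  have hlo := desc_lower n hn6
  have hup := desc_upper n hn6
  have hnum : (numKL 6 7 G : ℝ) = lamKL 6 7 G * n.choose 6 := by
    unfold lamKL
    field_simp
  have hcore := core_num G
  obtain ⟨c0, hc0⟩ := exists_col0 (by omega : 0 < n) G
  obtain ⟨c, -, hc⟩ := Finset.exists_min_image Finset.univ (fun c : Fin n → Fin 2 => WW G c) ⟨c0, Finset.mem_univ _⟩
  have hmin : ∀ d, WW G c ≤ WW G d := fun d => hc d (Finset.mem_univ d)
  have hbal := bal_sq G c
  have hW0 := WW_nonneg G c
  generalize (∑ u : Fin n, ∑ v : Fin n, sg (adjB G u v)) = S at hcore hbal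
  generalize (∑ u : Fin n, ∑ v : Fin n, ∑ w : Fin n, bd (adjB G u v) (adjB G u w) (adjB G v w)) = B at hcore hc0
  have hcore' : (960000 : ℝ) * (720 * numKL 6 7 G) + 108000 * n ^ 2 * S ^ 2 + 20 * (n ^ 3 * B)
      ≤ 450000 * n ^ 6 := by exact_mod_cast hcore
  have hWB : (n : ℝ) * WW G c ≤ B := by
    have h1 : (n : ℤ) * WW G c ≤ n * WW G c0 := mul_le_mul_of_nonneg_left (hmin c0) (by positivity)
    exact_mod_cast h1.trans hc0
  have hW0' : (0 : ℝ) ≤ WW G c := by exact_mod_cast hW0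
  have hlam : 15 / 32 - 1 / 10 ^ 14 ≤ lamKL 6 7 G := by linarith
  have hn5 : (n : ℝ) ^ 5 ≤ n ^ 6 / 10 ^ 15 := by
    have : (n : ℝ) ^ 6 = n ^ 5 * n := by ring
    rw [this, le_div_iff₀ (by norm_num)]
    gcongr
  have h6 : (0 : ℝ) < n ^ 6 := by positivity
  have hL : (15 / 32 - 2 / 10 ^ 14) * (n : ℝ) ^ 6 ≤ 720 * numKL 6 7 G := by
    rw [hnum]
    have h1 : (15 / 32 - 1 / 10 ^ 14) * (720 * (n.choose 6 : ℝ)) ≤ lamKL 6 7 G * (720 * (n.choose 6 : ℝ)) := by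
      gcongr
    have h2 : (15 / 32 - 1 / 10 ^ 14) * ((n : ℝ) ^ 6 - 15 * (n ^ 6 / 10 ^ 15)) ≤
        (15 / 32 - 1 / 10 ^ 14) * (720 * (n.choose 6 : ℝ)) := by
      refine mul_le_mul_of_nonneg_left ?_ (by norm_num)
      linarith
    have h3 : (15 / 32 - 2 / 10 ^ 14) * (n : ℝ) ^ 6 ≤
        (15 / 32 - 1 / 10 ^ 14) * ((n : ℝ) ^ 6 - 15 * (n ^ 6 / 10 ^ 15)) := by
      nlinarith
    linarith
  have hB0 : (0 : ℝ) ≤ B := le_trans (by positivity) hWB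
  have k1 : 108000 * (n : ℝ) ^ 2 * S ^ 2 + 20 * (n ^ 3 * B) ≤ 2 / 10 ^ 8 * n ^ 6 := by
    linarith
  have k2 : (n : ℝ) ^ 3 * B ≤ n ^ 3 * (n ^ 3 / 10 ^ 9) := by
    have : 0 ≤ 108000 * (n : ℝ) ^ 2 * S ^ 2 := by positivity
    linarith
  have k3 : (B : ℝ) ≤ n ^ 3 / 10 ^ 9 := le_of_mul_le_mul_left k2 (by positivity)
  have k4 : (n : ℝ) * WW G c ≤ n * (n ^ 2 / 10 ^ 9) := by linarith
  have k5 : (WW G c : ℝ) ≤ n ^ 2 / 10 ^ 9 := le_of_mul_le_mul_left k4 hpos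
  have k6 : (n : ℝ) ^ 2 * S ^ 2 ≤ n ^ 2 * (n ^ 2 / 10 ^ 5) ^ 2 := by
    have : 0 ≤ 20 * ((n : ℝ) ^ 3 * B) := by positivity
    nlinarith
  have k7 : (S : ℝ) ^ 2 ≤ (n ^ 2 / 10 ^ 5) ^ 2 := le_of_mul_le_mul_left k6 (by positivity)
  have k8 : (S : ℝ) ≤ n ^ 2 / 10 ^ 5 := (abs_le_of_sq_le_sq' k7 (by positivity)).2
  have hn2 : (n : ℝ) ≤ n ^ 2 / 10 ^ 15 := by
    rw [le_div_iff₀ (by norm_num), sq]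
    gcongr
  have hb : ∀ v, 100 * |bal c v| ≤ n := by
    intro v
    have h1 : ((bal c v : ℤ) : ℝ) ^ 2 ≤ S + 2 * WW G c + 2 * n := by exact_mod_cast hbal v
    have h2 : (100 * (bal c v : ℝ)) ^ 2 ≤ (n : ℝ) ^ 2 := by
      have : (0 : ℝ) < n ^ 2 := by positivity
      nlinarith
    have h3 : |100 * (bal c v : ℝ)| ≤ n := abs_le_of_sq_le_sq h2 hpos.le
    rw [abs_mul] at h3
    norm_num at h3
    exact_mod_cast h3
  have hrep := repair (le_trans (by norm_num) hnN) c hb _ G rfl (min_wd G c hmin) (by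
    have : (400000000 * WW G c : ℝ) ≤ n ^ 2 := by
      have : (0 : ℝ) < n ^ 2 := by positivity
      linarith
    exact_mod_cast this)
  have hH : (numKL 6 7 (twoCl c) : ℝ) ≤ lamKLmax 6 7 n * n.choose 6 := by
    have := lamKL_le_max (twoCl c)
    unfold lamKL at this
    rwa [div_le_iff₀ hC0] at this
  have hfin : (numKL 6 7 (twoCl c) : ℝ) - numKL 6 7 G ≤ (lamKLmax 6 7 n - lamKL 6 7 G) * (n ^ 6 / 720) := by
    rw [hnum]
    have : (lamKLmax 6 7 n - lamKL 6 7 G) * (n.choose 6 : ℝ) ≤ (lamKLmax 6 7 n - lamKL 6 7 G) * (n ^ 6 / 720) := by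
      gcongr
      · linarith
    linarith
  have hdist : (distToFam G isTwoCliques : ℝ) ≤ WW G c := by exact_mod_cast dist_le G c
  have hWf : (WW G c : ℝ) * n ^ 4 ≤ (3840 / 720 * (lamKLmax 6 7 n - lamKL 6 7 G) * n ^ 2) * n ^ 4 := by
    have : (3840 / 720 * (lamKLmax 6 7 n - lamKL 6 7 G) * (n : ℝ) ^ 2) * n ^ 4
      = 3840 * ((lamKLmax 6 7 n - lamKL 6 7 G) * (n ^ 6 / 720)) := by ring
    rw [this]
    linarith
  have hWf2 := le_of_mul_le_mul_right hWf (by positivity)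
  refine hdist.trans (hWf2.trans ?_)
  gcongr
  · linarith

theorem edge_inducibility_6_7 :
    Filter.Tendsto (fun n => lamKLmax 6 7 n) Filter.atTop (nhds (15/32)) ∧
    ∃ C : ℝ, 0 < C ∧ ∀ n : ℕ, (C ≤ n) → ∀ G : SimpleGraph (Fin n),
      (distToFam G isTwoCliques : ℝ) ≤ C * (lamKLmax 6 7 n - lamKL 6 7 G) * n ^ 2 := by
  exact ⟨limit_part, stab_part⟩
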